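/- There is a sentence φ in the first-order language with a single binary relation symbol ∈ such that φ is a logical consequence of ZC_fnd + GC (every model of ZC_fnd + GC satisfies φ) but φ is not a logical consequence of ZC_fnd (some model of ZC_fnd satisfies ¬φ). Hence Global Choice is not conservative over ZC with Foundation. -/

import Mathlib

/-!
Statement 1: Global Choice is not conservative over ZC with Foundation.

There is a sentence φ in the first-order language with a single binary relation
symbol ∈ such that every model of ZC + GC satisfies φ, but some model of ZC
satisfies ¬φ (i.e. φ is not a logical consequence of ZC).
-/

open FirstOrder FirstOrder.Language

/-- The relation symbols for the language `{∈}`: a single binary relation. -/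
inductive memRel : ℕ → Type
  | mem : memRel 2

/-- The first-order language with a single binary relation symbol `∈`. -/
def Lmem : FirstOrder.Language := ⟨fun _ => Empty, memRel⟩

/-- The function symbols of the language `{∈, j}`: a single unary function symbol `j`. -/
inductive jFun : ℕ → Type
  | j : jFun 1

/-- The first-order language `{∈, j}` with a binary relation `∈` and a unary function `j`. -/
def Lmemj : FirstOrder.Language := ⟨jFun, memRel⟩

/-- A binary relation on `M` interprets the language `{∈}`. -/
def memStructure {M : Type*} (mem : M → M → Prop) : Lmem.Structure M where
  funMap := fun f _ => f.elim
  RelMap | .mem => fun x => mem (x 0) (x 1)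

/-- A binary relation and a unary function on `M` interpret the language `{∈, j}`. -/
def memjStructure {M : Type*} (mem : M → M → Prop) (j : M → M) : Lmemj.Structure M where
  funMap | .j => fun x => j (x 0)
  RelMap | .mem => fun x => mem (x 0) (x 1)

section Axioms

variable (M : Type*) (mem : M → M → Prop)

/-- Extensionality. -/
def AxExt : Prop := ∀ x y : M, (∀ z, mem z x ↔ mem z y) → x = y

/-- Pairing. -/
def AxPairing : Prop := ∀ a b : M, ∃ p : M, ∀ z, mem z p ↔ (z = a ∨ z = b)

/-- Union. -/
def AxUnion : Prop := ∀ x : M, ∃ u : M, ∀ z, mem z u ↔ ∃ w, mem z w ∧ mem w x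

/-- Power Set. -/
def AxPower : Prop := ∀ x : M, ∃ P : M, ∀ z, mem z P ↔ ∀ w, mem w z → mem w x

/-- Infinity: there is a set containing an empty set and closed under successor
`x ↦ x ∪ {x}`. -/
def AxInfinity : Prop :=
  ∃ I : M, (∃ e, mem e I ∧ ∀ z, ¬ mem z e) ∧
    ∀ x, mem x I → ∃ s, mem s I ∧ ∀ z, mem z s ↔ (mem z x ∨ z = x)

/-- Foundation: every nonempty set has an `∈`-minimal element. -/
def AxFound : Prop :=
  ∀ x : M, (∃ y, mem y x) → ∃ y, mem y x ∧ ∀ z, ¬ (mem z y ∧ mem z x)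

/-- The Axiom of Choice (Zermelo's form): every set of nonempty pairwise disjoint
sets admits a transversal. -/
def AxChoice : Prop :=
  ∀ F : M, (∀ a, mem a F → ∃ b, mem b a) →
    (∀ a b, mem a F → mem b F → (∃ z, mem z a ∧ mem z b) → a = b) →
    ∃ c : M, ∀ a, mem a F → ∃! z, mem z a ∧ mem z c

/-- The Comprehension schema for the language `{∈}`: for every first-order formula
`φ(z, p̄)` of `{∈}`, every set `x` and parameters `p̄`, the set `{z ∈ x : φ(z, p̄)}` exists. -/
def AxComp : Prop :=
  ∀ (n : ℕ) (φ : Lmem.Formula (Fin (n + 1))) (x : M) (p : Fin n → M),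
    ∃ s : M, ∀ z, mem z s ↔
      (mem z x ∧ (letI := memStructure mem; φ.Realize (Fin.cons z p)))

/-- The theory ZC_fnd: Extensionality, Pairing, Union, Power Set, Infinity,
the Comprehension schema for `{∈}`-formulas, Choice, and Foundation. -/
def ZCfnd : Prop :=
  AxExt M mem ∧ AxPairing M mem ∧ AxUnion M mem ∧ AxPower M mem ∧
    AxInfinity M mem ∧ AxComp M mem ∧ AxChoice M mem ∧ AxFound M mem

variable (j : M → M)

/-- Global Choice: `j` picks an element of every nonempty set. -/
def AxGC : Prop := ∀ x : M, (∃ y, mem y x) → mem (j x) x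

/-- The Comprehension schema extended to all formulas of the language `{∈, j}`. -/
def AxCompJ : Prop :=
  ∀ (n : ℕ) (φ : Lmemj.Formula (Fin (n + 1))) (x : M) (p : Fin n → M),
    ∃ s : M, ∀ z, mem z s ↔
      (mem z x ∧ (letI := memjStructure mem j; φ.Realize (Fin.cons z p)))

end Axioms

namespace ZCForcing

/-- Index set of size `ℵ₂`. -/
abbrev Idx : Type := (Cardinal.aleph 2).out

noncomputable instance : DecidableEq Idx := Classical.decEq _

/-- Finitely supported `ZMod 2`-valued functions on finite sets of indices. -/
abbrev Vec : Type := Finset Idx →₀ ZMod 2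

inductive Atom : Type
  | star
  | lab (k : Idx)
  | pt (i : Idx) (a : Vec)
  | link (i : Idx) (a : Vec)
  | edge (i : Idx) (a : Vec) (j : Idx) (b : Vec) (k : Idx)

/-- The functor whose initial algebra is the universe of well-founded sets over `Atom`. -/
def SetF (X : Type 1) : Type 1 := Atom ⊕ {S : Set X // Small.{0} S}

instance : Functor SetF where
  map f := Sum.map id fun S => ⟨f '' S.1, by have := S.2; infer_instance⟩

noncomputable instance : QPF SetF where
  P := ⟨Atom ⊕ Type, Sum.elim (fun _ => PEmpty) (fun α => ULift α)⟩
  abs := fun p => match p with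
    | ⟨.inl a, _⟩ => .inl a
    | ⟨.inr α, f⟩ => .inr ⟨Set.range f, small_range (α := ULift α) f⟩
  repr := fun x => match x with
    | .inl a => ⟨.inl a, PEmpty.elim⟩
    | .inr S => ⟨.inr (@Shrink S.1 S.2), fun z => ((@equivShrink S.1 S.2).symm z.down).1⟩
  abs_repr := by
    rintro α (a | ⟨S, hS⟩)
    · rfl
    · simp only
      congr 2
      ext x
      constructor
      · rintro ⟨z, rfl⟩
        exact Subtype.coe_prop _
      · intro hx
        exact ⟨⟨equivShrink S ⟨x, hx⟩⟩, by simp⟩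
  abs_map := by
    rintro α β f ⟨a | γ, g⟩
    · rfl
    · change Sum.inr _ = Sum.inr _
      congr 2
      exact Set.range_comp f g

/-- Well-founded sets over atoms. -/
def W : Type 1 := QPF.Fix SetF

namespace W

noncomputable def atm (a : Atom) : W := QPF.Fix.mk (F := SetF) (.inl a)

noncomputable def node (S : Set W) [h : Small.{0} S] : W := QPF.Fix.mk (F := SetF) (.inr ⟨S, h⟩)

/-- The membership relation of the universe of sets over atoms. -/
def E (y x : W) : Prop :=
  match QPF.Fix.dest (F := SetF) x with
  | .inl _ => False
  | .inr S => y ∈ S.1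

theorem dest_at (a : Atom) : QPF.Fix.dest (F := SetF) (atm a) = .inl a := QPF.Fix.dest_mk _

theorem dest_node (S : Set W) [h : Small.{0} S] :
    QPF.Fix.dest (F := SetF) (node S) = .inr ⟨S, h⟩ := QPF.Fix.dest_mk _

@[simp] theorem E_at (y : W) (a : Atom) : ¬ E y (atm a) := by
  simp [E, dest_at]

@[simp] theorem E_node (y : W) (S : Set W) [Small.{0} S] : E y (node S) ↔ y ∈ S := by
  unfold E
  rw [dest_node]
  exact Iff.rfl

@[simp] theorem at_inj {a b : Atom} : atm a = atm b ↔ a = b := by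
  refine ⟨fun h => ?_, fun h => h ▸ rfl⟩
  have := congrArg (QPF.Fix.dest (F := SetF)) h
  rw [dest_at, dest_at] at this
  exact Sum.inl.inj this

@[simp] theorem node_ne_at (a : Atom) (S : Set W) [Small.{0} S] : node S ≠ atm a := by
  intro h
  have := congrArg (QPF.Fix.dest (F := SetF)) h
  rw [dest_at, dest_node] at this
  cases this

@[simp] theorem at_ne_node (a : Atom) (S : Set W) [Small.{0} S] : atm a ≠ node S :=
  (node_ne_at a S).symm

theorem node_congr {S T : Set W} [Small.{0} S] [Small.{0} T] (h : S = T) : node S = node T := by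
  subst h; rfl

@[elab_as_elim]
theorem ind {p : W → Prop} (atom : ∀ a, p (atm a))
    (set : ∀ (S : Set W) [Small.{0} S], (∀ y ∈ S, p y) → p (node S)) (x : W) : p x := by
  refine QPF.Fix.ind (F := SetF) p ?_ x
  rintro _ ⟨y | y, rfl⟩
  · exact atom y
  · have : Small.{0} (Subtype.val '' y.1 : Set W) := @small_image _ _ _ _ y.2
    exact set (Subtype.val '' y.1) (by rintro _ ⟨z, -, rfl⟩; exact z.2)

theorem cases (x : W) : (∃ a, x = atm a) ∨ ∃ (S : Set W) (_ : Small.{0} S), x = node S := by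
  induction x using ind with
  | atom a => exact .inl ⟨a, rfl⟩
  | set S _ => exact .inr ⟨S, ‹_›, rfl⟩

def IsNode (x : W) : Prop := ∀ a, x ≠ atm a

@[simp] theorem isNode_node (S : Set W) [Small.{0} S] : IsNode (node S) := fun a => node_ne_at a S

instance small_E (x : W) : Small.{0} {y | E y x} := by
  rcases cases x with ⟨a, rfl⟩ | ⟨S, hS, rfl⟩
  · simp only [E_at, Set.ofPred_false]; infer_instance
  · simpa using hS

theorem IsNode.eq_node {x : W} (h : IsNode x) : x = node {y | E y x} := by
  rcases cases x with ⟨a, rfl⟩ | ⟨S, hS, rfl⟩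
  · exact absurd rfl (h a)
  · exact node_congr (by simp)

theorem IsNode.of_E {x y : W} (h : E y x) : IsNode x := by
  rintro a rfl; exact E_at _ _ h

theorem ext {x y : W} (hx : IsNode x) (hy : IsNode y) (h : ∀ z, E z x ↔ E z y) : x = y := by
  rw [hx.eq_node, hy.eq_node]
  exact node_congr (Set.ext h)

theorem E_wf : WellFounded E := by
  refine ⟨fun x => ?_⟩
  induction x using ind with
  | atom a => exact ⟨_, fun y h => absurd h (E_at _ _)⟩
  | set S ih => exact ⟨_, fun y h => ih y (by simpa using h)⟩

/-- Substitution of sets for atoms. -/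
noncomputable def subst (f : Atom → W) : W → W :=
  QPF.Fix.rec (F := SetF) fun x => match x with
    | .inl a => f a
    | .inr S => @node S.1 S.2

@[simp] theorem subst_at (f : Atom → W) (a : Atom) : subst f (atm a) = f a :=
  QPF.Fix.rec_eq (F := SetF) _ _

@[simp] theorem subst_node (f : Atom → W) (S : Set W) [Small.{0} S] :
    subst f (node S) = node (subst f '' S) :=
  QPF.Fix.rec_eq (F := SetF) _ _

end W

/-- The atoms out of which the set substituted for an atom is built. -/
def Atom.legs : Atom → Set Atom
  | star => {star}
  | lab k => {lab k}
  | pt i a => {pt i a}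
  | link i a => {link i a, pt i a, star, lab i}
  | edge i a j b k => {edge i a j b k, pt i a, pt j b, lab k}

theorem Atom.mem_legs (a : Atom) : a ∈ a.legs := by
  cases a <;> simp [legs]

theorem Atom.eq_of_mem_legs {a b : Atom} (h : a ∈ b.legs) (h' : b ∈ a.legs) : a = b := by
  cases a <;> cases b <;> simp_all [legs]

theorem Atom.legs_injective : Function.Injective Atom.legs := fun a b h =>
  Atom.eq_of_mem_legs (h ▸ a.mem_legs) (h ▸ b.mem_legs)

/-- `Tri τ a b c`: the atom `τ` codes the triple `a, b, c`. -/
inductive Tri : Atom → Atom → Atom → Atom → Prop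
  | link (i : Idx) (a : Vec) : Tri (.link i a) (.pt i a) .star (.lab i)
  | edge (i : Idx) (a : Vec) (j : Idx) (b : Vec) (k : Idx) :
      Tri (.edge i a j b k) (.pt i a) (.pt j b) (.lab k)

theorem Tri.legs {τ a b c : Atom} (h : Tri τ a b c) : τ.legs = {τ, a, b, c} := by
  cases h <;> rfl

theorem Tri.legs_a {τ a b c : Atom} (h : Tri τ a b c) : a.legs = {a} := by
  cases h <;> rfl

theorem Tri.legs_b {τ a b c : Atom} (h : Tri τ a b c) : b.legs = {b} := by
  cases h <;> rfl

theorem Tri.legs_c {τ a b c : Atom} (h : Tri τ a b c) : c.legs = {c} := by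
  cases h <;> rfl

theorem Tri.ne_a {τ a b c : Atom} (h : Tri τ a b c) : a ≠ τ := by
  cases h <;> simp

theorem Atom.tri_or (τ : Atom) : (∃ a b c, Tri τ a b c) ∨ τ.legs = {τ} := by
  cases τ with
  | link i a => exact .inl ⟨_, _, _, .link i a⟩
  | edge i a j b k => exact .inl ⟨_, _, _, .edge i a j b k⟩
  | _ => exact .inr rfl

/-- Translate the second coordinates of an atom. -/
noncomputable def Atom.sh (s : Idx → Vec) : Atom → Atom
  | star => star
  | lab k => lab k
  | pt i a => pt i (a + s i)
  | link i a => link i (a + s i)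
  | edge i a j b k => edge i (a + s i) j (b + s j) k

theorem Atom.legs_sh (s : Idx → Vec) (a : Atom) : (a.sh s).legs = Atom.sh s '' a.legs := by
  cases a <;> simp [legs, sh, Set.image_insert_eq]

theorem Atom.sh_sh (s t : Idx → Vec) (a : Atom) : (a.sh s).sh t = a.sh (s + t) := by
  cases a <;> simp [sh, add_assoc]

theorem Tri.sh {τ a b c : Atom} (h : Tri τ a b c) (s : Idx → Vec) :
    Tri (τ.sh s) (a.sh s) (b.sh s) (c.sh s) := by
  cases h <;> constructor

open W

/-- Self-maps of the universe that respect membership and send sets to their pointwise images. -/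
structure Emb (g : W → W) : Prop where
  inj : Function.Injective g
  map_node : ∀ (S : Set W) [Small.{0} S], g (node S) = node (g '' S)
  atom : ∀ a y, ¬ E (g y) (g (atm a))

namespace Emb

variable {g h : W → W}

theorem E_iff (hg : Emb g) {x y : W} : E (g y) (g x) ↔ E y x := by
  rcases W.cases x with ⟨a, rfl⟩ | ⟨S, hS, rfl⟩
  · simp [hg.atom]
  · simp [hg.map_node, hg.inj.eq_iff]

theorem E_node (hg : Emb g) {x z : W} (hx : IsNode x) : E z (g x) ↔ ∃ y, E y x ∧ g y = z := by
  rw [hx.eq_node, hg.map_node]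
  simp

theorem isNode (hg : Emb g) {x : W} (hx : IsNode x) : IsNode (g x) := by
  rw [hx.eq_node, hg.map_node]
  simp

theorem comp (hg : Emb g) (hh : Emb h) : Emb (g ∘ h) where
  inj := hg.inj.comp hh.inj
  map_node S _ := by
    simp only [Function.comp_apply, hh.map_node, hg.map_node]
    exact node_congr (Set.image_image _ _ _)
  atom a y := by
    simp only [Function.comp_apply, hg.E_iff]
    exact hh.atom a y

theorem id : Emb id := ⟨fun _ _ h => h, fun S _ => node_congr (by simp), fun a y => by simp⟩

theorem iterate (hg : Emb g) (n : ℕ) : Emb g^[n] := by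
  induction n with
  | zero => exact Emb.id
  | succ n ih => exact ih.comp hg

end Emb

theorem subst_comp (f : Atom → W) (g : Atom → Atom) (x : W) :
    subst f (subst (atm ∘ g) x) = subst (f ∘ g) x := by
  induction x using W.ind with
  | atom a => simp
  | set S ih =>
    simp only [subst_node]
    refine node_congr ?_
    rw [Set.image_image]
    exact Set.image_congr ih

/-- The map induced by a translation of atoms. -/
noncomputable def rho (s : Idx → Vec) : W → W := subst (atm ∘ Atom.sh s)

@[simp] theorem rho_at (s : Idx → Vec) (a : Atom) : rho s (atm a) = atm (a.sh s) := by simp [rho]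

theorem rho_rho (s t : Idx → Vec) (x : W) : rho t (rho s x) = rho (s + t) x := by
  rw [rho, rho, subst_comp, rho]
  congr 1
  funext a
  simp [Atom.sh_sh]

theorem rho_zero (x : W) : rho 0 x = x := by
  have : (atm ∘ Atom.sh 0 : Atom → W) = atm := by
    funext a
    cases a <;> simp [Atom.sh]
  rw [rho, this]
  induction x using W.ind with
  | atom a => simp
  | set S ih =>
    rw [subst_node]
    exact node_congr ((Set.image_congr ih).trans (by simp))

theorem rho_add_self (s : Idx → Vec) : s + s = 0 := by
  funext i
  ext t
  exact CharTwo.add_self_eq_zero _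

theorem rho_self (s : Idx → Vec) (x : W) : rho s (rho s x) = x := by
  rw [rho_rho, rho_add_self, rho_zero]

theorem rho_emb (s : Idx → Vec) : Emb (rho s) where
  inj := Function.LeftInverse.injective (rho_self s)
  map_node S _ := subst_node _ S
  atom a y := by simp

/-- Replace every atom by a set built out of its legs. -/
noncomputable def unf : W → W := subst fun a => node (atm '' a.legs)

@[simp] theorem unf_at (a : Atom) : unf (atm a) = node (atm '' a.legs) := by simp [unf]

theorem isNode_unf (x : W) : IsNode (unf x) := by
  rcases W.cases x with ⟨a, rfl⟩ | ⟨S, hS, rfl⟩ <;> simp [unf]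

theorem unf_ne_at (x : W) (a : Atom) : unf x ≠ atm a := isNode_unf x a

theorem unf_emb : Emb unf where
  inj := by
    intro x
    induction x using W.ind with
    | atom a =>
      intro y h
      rcases W.cases y with ⟨b, rfl⟩ | ⟨S, hS, rfl⟩
      · have h' : ∀ c, c ∈ a.legs ↔ c ∈ b.legs := fun c => by
          have := congrArg (E (atm c)) h
          simpa using this
        rw [Atom.legs_injective (Set.ext h')]
      · have := congrArg (E (atm a)) h
        simp [unf, a.mem_legs] at this
        obtain ⟨z, -, hz⟩ := this
        exact absurd hz (unf_ne_at z a)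
    | set S ih =>
      intro y h
      rcases W.cases y with ⟨b, rfl⟩ | ⟨T, hT, rfl⟩
      · have := congrArg (E (atm b)) h
        simp [unf, b.mem_legs] at this
        obtain ⟨z, -, hz⟩ := this
        exact absurd hz (unf_ne_at z b)
      · have h' : ∀ c, (∃ y ∈ S, unf y = c) ↔ (∃ y ∈ T, unf y = c) := fun c => by
          have := congrArg (E c) h
          simpa [unf] using this
        refine node_congr (Set.ext fun z => ⟨fun hz => ?_, fun hz => ?_⟩)
        · obtain ⟨y, hy, e⟩ := (h' _).1 ⟨z, hz, rfl⟩
          rwa [ih z hz e.symm]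
        · obtain ⟨y, hy, e⟩ := (h' _).2 ⟨z, hz, rfl⟩
          rwa [← ih y hy e]
  map_node S _ := subst_node _ S
  atom a y := by
    simp only [unf_at, E_node, Set.mem_image, not_exists, not_and]
    exact fun b _ h => unf_ne_at y b h.symm

theorem unf_rho (s : Idx → Vec) (x : W) : unf (rho s x) = rho s (unf x) := by
  induction x using W.ind with
  | atom a =>
    rw [rho_at, unf_at, unf_at, (rho_emb s).map_node]
    refine node_congr ?_
    rw [Atom.legs_sh, Set.image_image, Set.image_image]
    simp
  | set S ih =>
    rw [(rho_emb s).map_node, unf_emb.map_node, unf_emb.map_node, (rho_emb s).map_node]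
    refine node_congr ?_
    rw [Set.image_image, Set.image_image]
    exact Set.image_congr ih

theorem unf_iterate_rho (n : ℕ) (s : Idx → Vec) (x : W) :
    unf^[n] (rho s x) = rho s (unf^[n] x) :=
  (Function.Commute.iterate_left (f := unf) (g := rho s) (unf_rho s) n) x

/-- The `n`-th unfolding of an atom. -/
noncomputable abbrev ut (n : ℕ) (a : Atom) : W := unf^[n] (atm a)

theorem ut_inj {n m : ℕ} {a b : Atom} : ut n a = ut m b ↔ n = m ∧ a = b := by
  refine ⟨fun h => ?_, fun ⟨h, h'⟩ => by rw [h, h']⟩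
  have key : ∀ {n k : ℕ} {a b : Atom}, ut n a ≠ ut (n + (k + 1)) b := by
    intro n k a b h
    rw [ut, ut, Function.iterate_add_apply] at h
    have := (unf_emb.iterate n).inj h
    rw [Function.iterate_succ_apply'] at this
    exact unf_ne_at _ _ this.symm
  rcases lt_trichotomy n m with hnm | rfl | hnm
  · obtain ⟨k, rfl⟩ := Nat.exists_eq_add_of_lt hnm
    exact absurd h key
  · exact ⟨rfl, at_inj.1 ((unf_emb.iterate n).inj h)⟩
  · obtain ⟨k, rfl⟩ := Nat.exists_eq_add_of_lt hnm
    exact absurd h.symm key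

theorem E_ut_succ {w : W} {n : ℕ} {a : Atom} : E w (ut (n + 1) a) ↔ ∃ b ∈ a.legs, w = ut n b := by
  rw [ut, Function.iterate_succ_apply, unf_at, (unf_emb.iterate n).E_node (isNode_node _)]
  simp [eq_comm]

theorem unf_ut (n : ℕ) (a : Atom) : unf (ut n a) = ut (n + 1) a :=
  (Function.iterate_succ_apply' _ _ _).symm

theorem isNode_ut_succ (n : ℕ) (a : Atom) : IsNode (ut (n + 1) a) := by
  rw [← unf_ut]; exact isNode_unf _

theorem rho_ut (s : Idx → Vec) (n : ℕ) (a : Atom) : rho s (ut n a) = ut n (a.sh s) := by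
  rw [ut, ← unf_iterate_rho, rho_at]

/-- The map `unf^m ∘ rho s`. -/
noncomputable def mor (m : ℕ) (s : Idx → Vec) : W → W := unf^[m] ∘ rho s

theorem mor_emb (m : ℕ) (s : Idx → Vec) : Emb (mor m s) := (unf_emb.iterate m).comp (rho_emb s)

theorem mor_ut (m : ℕ) (s : Idx → Vec) (n : ℕ) (a : Atom) :
    mor m s (ut n a) = ut (m + n) (a.sh s) := by
  rw [mor, Function.comp_apply, rho_ut, ut, ut, Function.iterate_add_apply]

theorem mor_mor (m n : ℕ) (s t : Idx → Vec) (x : W) :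
    mor n t (mor m s x) = mor (n + m) (s + t) x := by
  simp only [mor, Function.comp_apply]
  rw [← unf_iterate_rho, rho_rho, Function.iterate_add_apply]

/-- Sets hereditarily supported by the atoms in `A`. -/
inductive Sup (A : Set Atom) : W → Prop
  | atm {a : Atom} : a ∈ A → Sup A (atm a)
  | node {S : Set W} [Small.{0} S] : (∀ y ∈ S, Sup A y) → Sup A (node S)

@[simp] theorem Sup_at {A : Set Atom} {a : Atom} : Sup A (W.atm a) ↔ a ∈ A := by
  refine ⟨fun h => ?_, .atm⟩
  generalize hx : W.atm a = x at h
  cases h with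
  | atm h => rwa [at_inj.1 hx]
  | node h => simp at hx

theorem Sup_of_node {A : Set Atom} {x : W} (hx : IsNode x) : Sup A x ↔ ∀ y, E y x → Sup A y := by
  constructor
  · intro h y hy
    cases h with
    | atm h => simp at hy
    | node h => exact h y (by simpa using hy)
  · intro h
    rw [hx.eq_node]
    exact .node h

@[simp] theorem Sup_node {A : Set Atom} {S : Set W} [Small.{0} S] :
    Sup A (W.node S) ↔ ∀ y ∈ S, Sup A y := by
  rw [Sup_of_node (isNode_node S)]; simp

theorem Sup.of_E {A : Set Atom} {x y : W} (h : Sup A x) (hy : E y x) : Sup A y :=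
  (Sup_of_node (.of_E hy)).1 h y hy

theorem Sup_unf {A : Set Atom} (hA : ∀ a ∈ A, a.legs ⊆ A) {x : W} : Sup A (unf x) ↔ Sup A x := by
  induction x using W.ind with
  | atom a =>
    simp only [unf_at, Sup_node, Set.forall_mem_image, Sup_at]
    exact ⟨fun h => h a.mem_legs, fun h b hb => hA a h hb⟩
  | set S ih =>
    rw [unf_emb.map_node, Sup_node, Sup_node, Set.forall_mem_image]
    exact forall₂_congr ih

theorem Sup_unf_iterate {A : Set Atom} (hA : ∀ a ∈ A, a.legs ⊆ A) {n : ℕ} {x : W} :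
    Sup A (unf^[n] x) ↔ Sup A x := by
  induction n with
  | zero => rfl
  | succ n ih => rw [Function.iterate_succ_apply', Sup_unf hA, ih]

theorem Sup.rho {A B : Set Atom} {s : Idx → Vec} (hs : ∀ a ∈ A, a.sh s ∈ B) {x : W} (h : Sup A x) :
    Sup B (rho s x) := by
  induction h with
  | atm h => simpa using hs _ h
  | node h ih =>
    rw [(rho_emb s).map_node, Sup_node, Set.forall_mem_image]
    exact ih

theorem Sup_ut {A : Set Atom} (hA : ∀ a ∈ A, a.legs ⊆ A) {n : ℕ} {a : Atom} :
    Sup A (ut n a) ↔ a ∈ A := by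
  rw [Sup_unf_iterate hA, Sup_at]

open W

open Classical in
/-- The indicator (in `ZMod 2`) of the element chosen from `t ∩ F`. -/
noncomputable def ch (F t : Finset Idx) (i : Idx) : ZMod 2 :=
  if ∃ h : (t ∩ F).Nonempty, h.choose = i then 1 else 0

theorem ch_congr {F G t : Finset Idx} (h : t ∩ F = t ∩ G) (i : Idx) : ch F t i = ch G t i := by
  unfold ch; rw [h]

theorem ch_spec {F t : Finset Idx} (h : (t ∩ F).Nonempty) :
    ∃ i ∈ t ∩ F, ∀ j, ch F t j = if j = i then 1 else 0 := by
  classical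
  refine ⟨h.choose, h.choose_spec, fun j => ?_⟩
  unfold ch
  congr 1
  exact propext ⟨fun ⟨_, e⟩ => e.symm, fun e => ⟨h, e.symm⟩⟩

/-- The obstruction to the presence of an edge. -/
noncomputable def sig (F : Finset Idx) (i : Idx) (a : Vec) (j : Idx) (b : Vec) (k : Idx) : ZMod 2 :=
  a {i, j, k} + b {i, j, k} + ch F {i, j, k} i + ch F {i, j, k} j

/-- The atoms allowed at the stage `F`. -/
def Al (F : Finset Idx) : Set Atom := fun τ => match τ with
  | .star => True
  | .lab _ => True
  | .pt i _ => i ∈ F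
  | .link i _ => i ∈ F
  | .edge i a j b k => i ∈ F ∧ j ∈ F ∧ i ≠ j ∧ k ≠ i ∧ k ≠ j ∧ sig F i a j b k = 0

variable {F G H : Finset Idx}

@[simp] theorem star_mem_Al : Atom.star ∈ Al F := trivial
@[simp] theorem lab_mem_Al (k : Idx) : Atom.lab k ∈ Al F := trivial
@[simp] theorem pt_mem_Al {i : Idx} {a : Vec} : Atom.pt i a ∈ Al F ↔ i ∈ F := Iff.rfl
@[simp] theorem link_mem_Al {i : Idx} {a : Vec} : Atom.link i a ∈ Al F ↔ i ∈ F := Iff.rfl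
@[simp] theorem edge_mem_Al {i : Idx} {a : Vec} {j : Idx} {b : Vec} {k : Idx} :
    Atom.edge i a j b k ∈ Al F ↔
      i ∈ F ∧ j ∈ F ∧ i ≠ j ∧ k ≠ i ∧ k ≠ j ∧ sig F i a j b k = 0 := Iff.rfl

theorem Al_legs (F : Finset Idx) : ∀ a ∈ Al F, a.legs ⊆ Al F := by
  intro a h b hb
  cases a <;> simp [Atom.legs] at hb h <;>
    grind [star_mem_Al, lab_mem_Al, pt_mem_Al, link_mem_Al, edge_mem_Al]

/-- Compatibility of a translation with the choices made at the stages `F` and `G`. -/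
def Cmp (s : Idx → Vec) (F G : Finset Idx) : Prop :=
  ∀ i ∈ F, ∀ j ∈ F, i ≠ j → ∀ k, k ≠ i → k ≠ j →
    s i {i, j, k} + s j {i, j, k} =
      ch F {i, j, k} i + ch F {i, j, k} j + ch G {i, j, k} i + ch G {i, j, k} j

theorem Cmp.trans {s t : Idx → Vec} (h : Cmp s F G) (h' : Cmp t G H) (hFG : F ⊆ G) :
    Cmp (s + t) F H := by
  intro i hi j hj hij k hki hkj
  have h1 := h i hi j hj hij k hki hkj
  have h2 := h' i (hFG hi) j (hFG hj) hij k hki hkj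
  simp only [Pi.add_apply, Finsupp.add_apply]
  grind

theorem Cmp.sig {s : Idx → Vec} (h : Cmp s F G) {i j k : Idx} {a b : Vec} (hi : i ∈ F) (hj : j ∈ F)
    (hij : i ≠ j) (hki : k ≠ i) (hkj : k ≠ j) :
    sig G i (a + s i) j (b + s j) k = sig F i a j b k := by
  have h1 := h i hi j hj hij k hki hkj
  simp only [ZCForcing.sig, Finsupp.add_apply]
  grind

theorem Cmp.sh_mem {s : Idx → Vec} (h : Cmp s F G) (hFG : F ⊆ G) {τ : Atom} (hτ : τ ∈ Al F) :
    τ.sh s ∈ Al G := by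
  cases τ with
  | edge i a j b k =>
    obtain ⟨hi, hj, hij, hki, hkj, e⟩ := hτ
    exact ⟨hFG hi, hFG hj, hij, hki, hkj, by rw [h.sig hi hj hij hki hkj, e]⟩
  | pt i a => exact hFG hτ
  | link i a => exact hFG hτ
  | _ => trivial

/-- The sets existing at the stage `F`. -/
def Dom (F : Finset Idx) : Set W := {x | Sup (Al F) x}

/-- The transition maps between stages. -/
def Hom (F G : Finset Idx) (g : W → W) : Prop := ∃ m s, F ⊆ G ∧ Cmp s F G ∧ g = mor m s

theorem Hom.sub {g : W → W} (h : Hom F G g) : F ⊆ G := by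
  obtain ⟨_, _, h, _⟩ := h; exact h

theorem Hom.emb {g : W → W} (h : Hom F G g) : Emb g := by
  obtain ⟨m, s, -, -, rfl⟩ := h; exact mor_emb m s

theorem Hom.dom {g : W → W} (h : Hom F G g) {x : W} (hx : x ∈ Dom F) : g x ∈ Dom G := by
  obtain ⟨m, s, h, h', rfl⟩ := h
  exact (Sup_unf_iterate (Al_legs G)).2 (Sup.rho (fun a ha => h'.sh_mem h ha) hx)

theorem Hom.comp {g g' : W → W} (h' : Hom G H g') (h : Hom F G g) : Hom F H (g' ∘ g) := by
  obtain ⟨m, s, h1, h2, rfl⟩ := h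
  obtain ⟨n, t, h3, h4, rfl⟩ := h'
  exact ⟨n + m, s + t, h1.trans h3, h2.trans h4 h1, funext fun x => mor_mor _ _ _ _ _⟩

theorem Cmp.zero (F : Finset Idx) : Cmp 0 F F := by
  intro i hi j hj hij k hki hkj
  simp only [Pi.zero_apply, Finsupp.zero_apply]
  grind

theorem Hom.unf (F : Finset Idx) (m : ℕ) : Hom F F unf^[m] :=
  ⟨m, 0, subset_rfl, .zero F, funext fun x => by simp [mor, rho_zero]⟩

theorem Hom.id (F : Finset Idx) : Hom F F id := Hom.unf F 0

/-- Elements of `Vec` given by a function vanishing outside the subsets of `G`. -/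
noncomputable def Vec.mk (G : Finset Idx) (f : Finset Idx → ZMod 2) : Vec := by
  classical exact Finsupp.onFinset G.powerset (fun t => if t ⊆ G then f t else 0) (by simp; grind)

theorem Vec.mk_apply (G : Finset Idx) (f : Finset Idx → ZMod 2) (t : Finset Idx) :
    Vec.mk G f t = if t ⊆ G then f t else 0 := by
  unfold Vec.mk
  simp only [Finsupp.onFinset_apply]

theorem exists_cmp (h : F ⊆ G) : ∃ s, Cmp s F G := by
  refine ⟨fun i => Vec.mk G fun t => ch F t i + ch G t i, ?_⟩
  intro i hi j hj hij k hki hkj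
  rw [Vec.mk_apply, Vec.mk_apply]
  split_ifs with hG
  · ring
  · have hk : k ∉ G := fun hk => hG (by grind)
    have e : ({i, j, k} : Finset Idx) ∩ F = {i, j, k} ∩ G := by grind
    rw [ch_congr e i, ch_congr e j]
    grind

theorem exists_hom (h : F ⊆ G) : ∃ g, Hom F G g := by
  obtain ⟨s, hs⟩ := exists_cmp h
  exact ⟨_, 0, s, h, hs, rfl⟩

open W

variable {G₁ G₂ : Finset Idx}

theorem rho_congr {s s' : Idx → Vec} (h : ∀ i ∈ F, s i = s' i) {x : W} (hx : x ∈ Dom F) :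
    rho s x = rho s' x := by
  change Sup _ x at hx
  induction hx with
  | @atm a ha =>
    rw [rho_at, rho_at]
    cases a with
    | pt i a => simp [Atom.sh, h i ha]
    | link i a => simp [Atom.sh, h i ha]
    | edge i a j b k => simp [Atom.sh, h i ha.1, h j ha.2.1]
    | _ => rfl
  | node _ ih =>
    rw [(rho_emb s).map_node, (rho_emb s').map_node]
    exact node_congr (Set.image_congr ih)

theorem exists_third {t : Finset Idx} (ht : t.card = 3) {i j : Idx} (hi : i ∈ t) (hj : j ∈ t)
    (hij : i ≠ j) : ∃ k, k ≠ i ∧ k ≠ j ∧ t = {i, j, k} := by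
  have h1 : ((t.erase i).erase j).card = 1 := by
    rw [Finset.card_erase_of_mem (by grind), Finset.card_erase_of_mem hi, ht]
  obtain ⟨k, hk⟩ := Finset.card_eq_one.1 h1
  have hk' : k ∈ (t.erase i).erase j := hk ▸ Finset.mem_singleton_self k
  refine ⟨k, by grind, by grind, ?_⟩
  ext x
  have : x ∈ (t.erase i).erase j ↔ x ∈ ({k} : Finset Idx) := by rw [hk]
  grind

theorem exists_extension (e : Idx → Vec)
    (he : ∀ i ∈ F, ∀ j ∈ F, ∀ t : Finset Idx, t.card = 3 → i ∈ t → j ∈ t → e i t = e j t) :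
    ∃ h : Idx → Vec, (∀ i ∈ F, h i = e i) ∧
      ∀ i j, ∀ t : Finset Idx, t.card = 3 → i ∈ t → j ∈ t → h i t = h j t := by
  classical
  let f : Finset Idx → ZMod 2 := fun t => if h : (t ∩ F).Nonempty then e h.choose t else 0
  let h : Idx → Vec := fun i => if i ∈ F then e i else
    Finsupp.onFinset (F.biUnion fun l => (e l).support) f (by
      intro t ht
      by_cases hn : (t ∩ F).Nonempty
      · simp only [f, hn, dite_true] at ht
        have := hn.choose_spec
        simp only [Finset.mem_biUnion]
        exact ⟨_, (Finset.mem_inter.1 this).2, by simpa using ht⟩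
      · simp [f, hn] at ht)
  have hf : ∀ i, ∀ t : Finset Idx, t.card = 3 → i ∈ t → h i t = f t := by
    intro i t ht hi
    by_cases hF : i ∈ F
    · have hn : (t ∩ F).Nonempty := ⟨i, Finset.mem_inter.2 ⟨hi, hF⟩⟩
      have hs := Finset.mem_inter.1 hn.choose_spec
      simp only [h, hF, if_true, f, hn, dite_true]
      exact he _ hF _ hs.2 t ht hi hs.1
    · simp [h, hF]
  exact ⟨h, fun i hi => by simp [h, hi], fun i j t ht hi hj => by rw [hf i t ht hi, hf j t ht hj]⟩

theorem amalgamation {g₁ g₂ : W → W} (h₁ : Hom F G₁ g₁) (h₂ : Hom F G₂ g₂) :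
    ∃ G k₁ k₂, Hom G₁ G k₁ ∧ Hom G₂ G k₂ ∧ ∀ x ∈ Dom F, k₁ (g₁ x) = k₂ (g₂ x) := by
  obtain ⟨m₁, s₁, hF₁, c₁, rfl⟩ := h₁
  obtain ⟨m₂, s₂, hF₂, c₂, rfl⟩ := h₂
  obtain ⟨r₁, d₁⟩ := exists_cmp (Finset.subset_union_left : G₁ ⊆ G₁ ∪ G₂)
  obtain ⟨r₂, d₂⟩ := exists_cmp (Finset.subset_union_right : G₂ ⊆ G₁ ∪ G₂)
  have t₁ := c₁.trans d₁ hF₁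
  have t₂ := c₂.trans d₂ hF₂
  obtain ⟨h, hF, hh⟩ := exists_extension (F := F) (fun i => (s₁ + r₁) i + (s₂ + r₂) i) (by
    intro i hi j hj t ht hit hjt
    by_cases hij : i = j
    · rw [hij]
    obtain ⟨k, hki, hkj, rfl⟩ := exists_third ht hit hjt hij
    have e₁ := t₁ i hi j hj hij k hki hkj
    have e₂ := t₂ i hi j hj hij k hki hkj
    simp only [Finsupp.add_apply]
    grind)
  refine ⟨G₁ ∪ G₂, mor m₂ r₁, mor m₁ (r₂ + h), ⟨_, _, Finset.subset_union_left, d₁, rfl⟩,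
    ⟨_, _, Finset.subset_union_right, ?_, rfl⟩, ?_⟩
  · intro i hi j hj hij k hki hkj
    have e₁ := d₂ i hi j hj hij k hki hkj
    have e₂ := hh i j {i, j, k} (Finset.card_eq_three.2 ⟨i, j, k, hij, hki.symm, hkj.symm, rfl⟩)
      (by simp) (by simp)
    simp only [Pi.add_apply, Finsupp.add_apply]
    grind
  · intro x hx
    rw [mor_mor, mor_mor, add_comm m₂ m₁, mor, mor, Function.comp_apply, Function.comp_apply]
    congr 1
    refine rho_congr (fun i hi => ?_) hx
    ext t
    have := DFunLike.congr_fun (hF i hi) t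
    simp only [Pi.add_apply, Finsupp.add_apply] at this ⊢
    grind

theorem parity {i j k : Idx} (hi : i ∈ F) (hj : j ∈ F) (hk : k ∈ F) (hij : i ≠ j) (hki : k ≠ i)
    (hkj : k ≠ j) (a b c : Vec) :
    Atom.edge i a j b k ∈ Al F ∨ Atom.edge j b k c i ∈ Al F ∨ Atom.edge i a k c j ∈ Al F := by
  have e1 : ({j, k, i} : Finset Idx) = {i, j, k} := by grind
  have e2 : ({i, k, j} : Finset Idx) = {i, j, k} := by grind
  simp only [edge_mem_Al, sig, e1, e2]
  have : ∀ x y z : ZMod 2, x + y = 0 ∨ y + z = 0 ∨ x + z = 0 := by decide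
  have := this (a {i, j, k} + ch F {i, j, k} i) (b {i, j, k} + ch F {i, j, k} j)
    (c {i, j, k} + ch F {i, j, k} k)
  grind

theorem edge_finite {i j : Idx} {a b : Vec} {k : Idx} (h : Atom.edge i a j b k ∈ Al F) :
    k ∈ F ∪ a.support.biUnion id ∪ b.support.biUnion id := by
  obtain ⟨hi, hj, hij, hki, hkj, hs⟩ := h
  by_contra hk
  simp only [Finset.mem_union, Finset.mem_biUnion, Finsupp.mem_support_iff, not_or] at hk
  have ha : a {i, j, k} = 0 := by
    by_contra h
    exact hk.1.2 ⟨_, h, by simp⟩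
  have hb : b {i, j, k} = 0 := by
    by_contra h
    exact hk.2 ⟨_, h, by simp⟩
  obtain ⟨l, hl, hch⟩ := ch_spec (F := F) (t := {i, j, k}) ⟨i, by simp [hi]⟩
  rw [sig, ha, hb, hch, hch] at hs
  have : l = i ∨ l = j := by grind
  rcases this with rfl | rfl
  · simp [hij.symm] at hs
  · simp [hij] at hs

open Cardinal in
/-- A set mapping on pairs with finite values on a set of size `ℵ₂` has a free triple. -/
theorem exists_free_triple (S : Idx → Idx → Set Idx) (hS : ∀ i j, (S i j).Finite) :
    ∃ i j k, i ≠ j ∧ k ≠ i ∧ k ≠ j ∧ k ∉ S i j ∧ i ∉ S j k ∧ j ∉ S i k := by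
  have hI : #Idx = ℵ_ 2 := mk_out _
  have h12 : (ℵ_ 1 : Cardinal) < ℵ_ 2 := aleph_lt_aleph.2 (by norm_num)
  have h01 : (ℵ₀ : Cardinal) < ℵ_ 1 := by
    rw [← aleph_zero]; exact aleph_lt_aleph.2 (by norm_num)
  obtain ⟨A, hA⟩ := le_mk_iff_exists_set.1 (hI ▸ h12.le)
  have small1 : #(A ∪ ⋃ p : A × A, S p.1 p.2 : Set Idx) ≤ ℵ_ 1 := by
    refine (mk_union_le _ _).trans (add_le_of_le h01.le hA.le ?_)
    refine (mk_iUnion_le _).trans (mul_le_of_le h01.le ?_ ?_)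
    · rw [mk_prod]; simp only [lift_id]; rw [hA, mul_eq_self h01.le]
    · exact ciSup_le' fun p => (Set.Finite.lt_aleph0 (hS _ _)).le.trans h01.le
  obtain ⟨k, hk⟩ : ∃ k, k ∉ (A ∪ ⋃ p : A × A, S p.1 p.2 : Set Idx) := by
    by_contra! h
    rw [Set.eq_univ_of_forall h, mk_univ, hI] at small1
    exact absurd small1 (not_le.2 h12)
  obtain ⟨B, hBA, hB⟩ := le_mk_iff_exists_subset.1 (hA ▸ h01.le)
  have small2 : #(B ∪ ⋃ i : B, S i k : Set Idx) ≤ ℵ₀ := by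
    refine (mk_union_le _ _).trans (add_le_of_le le_rfl hB.le ?_)
    refine (mk_iUnion_le _).trans (mul_le_of_le le_rfl hB.le ?_)
    exact ciSup_le' fun p => (Set.Finite.lt_aleph0 (hS _ _)).le
  obtain ⟨j, hjA, hj⟩ : ∃ j ∈ A, j ∉ (B ∪ ⋃ i : B, S i k : Set Idx) := by
    by_contra! h
    exact absurd ((hA ▸ mk_le_mk_of_subset h).trans small2) (not_le.2 h01)
  obtain ⟨i, hiB, hi⟩ : ∃ i ∈ B, i ∉ S j k := by
    by_contra! h
    exact absurd (hB ▸ mk_le_mk_of_subset h) (not_le.2 (Set.Finite.lt_aleph0 (hS j k)))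
  simp only [Set.mem_union, Set.mem_iUnion, not_or, not_exists] at hk hj
  refine ⟨i, j, k, ?_, ?_, ?_, hk.2 (⟨i, hBA hiB⟩, ⟨j, hjA⟩), hi, hj.2 ⟨i, hiB⟩⟩
  · rintro rfl; exact hj.1 hiB
  · rintro rfl; exact hk.1 (hBA hiB)
  · rintro rfl; exact hk.1 hjA

open W

/-- A property of a tuple of sets and a further set (the witness) at a stage, preserved by the
transition maps. -/
structure Req where
  d : ℕ
  P : Finset Idx → (Fin d → W) → W → Prop
  persist : ∀ {F G : Finset Idx} {g : W → W} {v : Fin d → W} {w : W}, Hom F G g →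
    (∀ i, v i ∈ Dom F) → w ∈ Dom F → P F v w → P G (g ∘ v) (g w)

/-- A forcing condition: a stage together with finitely many named sets. -/
structure Cond where
  F : Finset Idx
  len : ℕ
  z : ℕ → W
  dom : ∀ i, z i ∈ Dom F

instance : Preorder Cond where
  le c c' := c.len ≤ c'.len ∧ ∃ g, Hom c.F c'.F g ∧ ∀ i < c.len, c'.z i = g (c.z i)
  le_refl c := ⟨le_rfl, id, Hom.id _, fun _ _ => rfl⟩
  le_trans c c' c'' := by
    rintro ⟨h, g, hg, e⟩ ⟨h', g', hg', e'⟩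
    exact ⟨h.trans h', _, hg'.comp hg, fun i hi => by
      rw [e' i (hi.trans_le h), e i hi, Function.comp_apply]⟩

/-- A model built out of a directed system of stages, in which every property from `Q` that can be
witnessed is witnessed. -/
structure GM (Q : Set Req) where
  M : Type
  mem : M → M → Prop
  Stage : Type 1
  F : Stage → Finset Idx
  At : Stage → M → W → Prop
  base : Stage
  dom : ∀ {c x w}, At c x w → w ∈ Dom (F c)
  eq_iff : ∀ {c x w y v}, At c x w → At c y v → (x = y ↔ w = v)
  mem_iff : ∀ {c x w y v}, At c x w → At c y v → (mem x y ↔ E w v)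
  grow' : ∀ c x, ∃ c' g, (Hom (F c) (F c') g ∧ ∀ y w, At c y w → At c' y (g w)) ∧ ∃ w, At c' x w
  name' : ∀ r ∈ Q, ∀ (c : Stage) (x : Fin r.d → M) (v : Fin r.d → W), (∀ i, At c (x i) (v i)) →
    ∀ H h, Hom (F c) H h → ∀ w ∈ Dom H, r.P H (h ∘ v) w →
    ∃ c' g, (Hom (F c) (F c') g ∧ ∀ y w, At c y w → At c' y (g w)) ∧
      ∃ x' w', At c' x' w' ∧ r.P (F c') (g ∘ v) w'

/-- The conditions deciding whether the property `r` of the sets named by `e` is witnessed. -/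
def decides (r : Req) (e : Fin r.d → ℕ) : Order.Cofinal Cond where
  carrier := {c | (∀ i, e i < c.len) ∧ ((∃ n < c.len, r.P c.F (c.z ∘ e) (c.z n)) ∨
    ∀ c' ≥ c, ∀ w ∈ Dom c'.F, ¬ r.P c'.F (c'.z ∘ e) w)}
  isCofinal := by
    classical
    intro c
    obtain ⟨N, hN⟩ : ∃ N, ∀ i, e i < N := by
      obtain ⟨N, hN⟩ := (Set.finite_range e).bddAbove
      exact ⟨N + 1, fun i => Nat.lt_succ_of_le (hN ⟨i, rfl⟩)⟩
    let c₁ : Cond := { c with len := max c.len N }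
    have hc₁ : c ≤ c₁ := ⟨le_max_left _ _, id, Hom.id _, fun _ _ => rfl⟩
    have he : ∀ i, e i < c₁.len := fun i => (hN i).trans_le (le_max_right _ _)
    by_cases h : ∃ c' ≥ c₁, ∃ w ∈ Dom c'.F, r.P c'.F (c'.z ∘ e) w
    · obtain ⟨c', hc', w, hw, hP⟩ := h
      let c₂ : Cond := ⟨c'.F, c'.len + 1, Function.update c'.z c'.len w, fun i => by
        rcases eq_or_ne i c'.len with rfl | hi
        · simpa using hw
        · simpa [hi] using c'.dom i⟩
      have hz : ∀ i < c'.len, c₂.z i = c'.z i := fun i hi =>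
        Function.update_of_ne hi.ne _ _
      have hc₂ : c' ≤ c₂ := ⟨Nat.le_succ _, id, Hom.id _, hz⟩
      refine ⟨c₂, ⟨fun i => ((he i).trans_le hc'.1).trans_le (Nat.le_succ _), .inl
        ⟨c'.len, Nat.lt_succ_self _, ?_⟩⟩, hc₁.trans (hc'.trans hc₂)⟩
      have h1 : c₂.z c'.len = w := Function.update_self _ _ _
      have h2 : c₂.z ∘ e = c'.z ∘ e := funext fun i => hz _ ((he i).trans_le hc'.1)
      rw [h1, h2]
      exact hP
    · push Not at h
      exact ⟨c₁, ⟨he, .inr h⟩, hc₁⟩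

theorem hom_of_amalgam {r : Req} {v : Fin r.d → W} {g h : W → W} {w : W} (hv : ∀ i, v i ∈ Dom F)
    (hg : Hom F G g) (hh : Hom F H h) (hw : w ∈ Dom H) (hP : r.P H (h ∘ v) w) :
    ∃ K k, Hom G K k ∧ ∃ w' ∈ Dom K, r.P K (k ∘ g ∘ v) w' := by
  obtain ⟨K, k₁, k₂, h₁, h₂, e⟩ := amalgamation hg hh
  refine ⟨K, k₁, h₁, k₂ w, h₂.dom hw, ?_⟩
  have : k₁ ∘ g ∘ v = k₂ ∘ h ∘ v := funext fun i => e _ (hv i)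
  rw [this]
  exact r.persist h₂ (fun i => hh.dom (hv i)) hw hP

theorem exists_model (Q : Set Req) (hQ : Q.Countable) : Nonempty (GM Q) := by
  classical
  let triv : Req := ⟨1, fun _ _ _ => True, fun _ _ _ _ => trivial⟩
  let Q' : Set Req := insert triv Q
  have hQ' : Q'.Countable := hQ.insert _
  have : Countable Q' := hQ'
  let I := Σ r : Q', Fin r.1.d → ℕ
  have : Encodable I := Encodable.ofCountable _
  let p₀ : Cond := ⟨∅, 0, fun _ => atm .star, fun _ => .atm trivial⟩
  let D : I → Order.Cofinal Cond := fun i => decides i.1.1 i.2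
  let 𝒢 := Order.idealOfCofinals p₀ D
  have meet : ∀ r ∈ Q', ∀ e, ∃ c ∈ 𝒢, c ∈ decides r e := fun r hr e => by
    obtain ⟨c, h1, h2⟩ := Order.cofinal_meets_idealOfCofinals p₀ D ⟨⟨r, hr⟩, e⟩
    exact ⟨c, h2, h1⟩
  have dir : ∀ c ∈ 𝒢, ∀ c' ∈ 𝒢, ∃ d ∈ 𝒢, c ≤ d ∧ c' ≤ d := fun c hc c' hc' => 𝒢.directed c hc c' hc'
  have long : ∀ c ∈ 𝒢, ∀ n, ∃ d ∈ 𝒢, c ≤ d ∧ n < d.len := fun c hc n => by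
    obtain ⟨c', hc', h⟩ := meet triv (.inl rfl) (fun _ => n)
    obtain ⟨d, hd, h1, h2⟩ := dir c hc c' hc'
    exact ⟨d, hd, h1, (h.1 ⟨0, Nat.one_pos⟩).trans_le h2.1⟩
  have eqv : ∀ c ∈ 𝒢, ∀ c' ∈ 𝒢, ∀ n m, n < c.len → m < c.len → n < c'.len → m < c'.len →
      (c.z n = c.z m ↔ c'.z n = c'.z m) ∧ (E (c.z n) (c.z m) ↔ E (c'.z n) (c'.z m)) := by
    intro c hc c' hc' n m h1 h2 h3 h4
    obtain ⟨d, hd, ⟨l, g, hg, e⟩, ⟨l', g', hg', e'⟩⟩ := dir c hc c' hc'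
    constructor
    · rw [← hg.emb.inj.eq_iff, ← e n h1, ← e m h2, e' n h3, e' m h4, hg'.emb.inj.eq_iff]
    · rw [← hg.emb.E_iff, ← e n h1, ← e m h2, e' n h3, e' m h4, hg'.emb.E_iff]
  let S : Setoid ℕ :=
    { r := fun n m => ∃ c ∈ 𝒢, n < c.len ∧ m < c.len ∧ c.z n = c.z m
      iseqv :=
        { refl := fun n => by
            obtain ⟨d, hd, -, h⟩ := long p₀ (Order.mem_idealOfCofinals p₀ D) n
            exact ⟨d, hd, h, h, rfl⟩
          symm := fun ⟨c, hc, h1, h2, e⟩ => ⟨c, hc, h2, h1, e.symm⟩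
          trans := by
            rintro n m k ⟨c, hc, h1, h2, e⟩ ⟨c', hc', h3, h4, e'⟩
            obtain ⟨d, hd, h, h'⟩ := dir c hc c' hc'
            refine ⟨d, hd, h1.trans_le h.1, h4.trans_le h'.1, ?_⟩
            rw [(eqv d hd c hc n m (h1.trans_le h.1) (h2.trans_le h.1) h1 h2).1.2 e,
              (eqv d hd c' hc' m k (h3.trans_le h'.1) (h4.trans_le h'.1) h3 h4).1.2 e'] } }
  let cls : ℕ → Quotient S := fun n => Quotient.mk S n
  have cls_eq : ∀ c ∈ 𝒢, ∀ n m, n < c.len → m < c.len → (cls n = cls m ↔ c.z n = c.z m) := by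
    intro c hc n m h1 h2
    refine ⟨fun h => ?_, fun h => Quotient.sound ⟨c, hc, h1, h2, h⟩⟩
    obtain ⟨c', hc', h3, h4, e⟩ := Quotient.exact h
    exact (eqv c hc c' hc' n m h1 h2 h3 h4).1.2 e
  let mem : Quotient S → Quotient S → Prop := fun a b =>
    ∃ n m, cls n = a ∧ cls m = b ∧ ∃ c ∈ 𝒢, n < c.len ∧ m < c.len ∧ E (c.z n) (c.z m)
  have mem_eq : ∀ c ∈ 𝒢, ∀ n m, n < c.len → m < c.len →
      (mem (cls n) (cls m) ↔ E (c.z n) (c.z m)) := by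
    intro c hc n m h1 h2
    refine ⟨?_, fun h => ⟨n, m, rfl, rfl, c, hc, h1, h2, h⟩⟩
    rintro ⟨n', m', e1, e2, c', hc', h3, h4, h⟩
    obtain ⟨d, hd, l, l'⟩ := dir c hc c' hc'
    have h1' := h1.trans_le l.1
    have h2' := h2.trans_le l.1
    have h3' := h3.trans_le l'.1
    have h4' := h4.trans_le l'.1
    rw [cls_eq d hd _ _ h3' h1'] at e1
    rw [cls_eq d hd _ _ h4' h2'] at e2
    rw [(eqv c hc d hd n m h1 h2 h1' h2').2, ← e1, ← e2]
    exact (eqv c' hc' d hd _ _ h3 h4 h3' h4').2.1 h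
  let At : 𝒢 → Quotient S → W → Prop := fun c x w => ∃ n < c.1.len, cls n = x ∧ c.1.z n = w
  have ext_of_le : ∀ c c' : 𝒢, c.1 ≤ c'.1 →
      ∃ g, Hom c.1.F c'.1.F g ∧ (∀ i < c.1.len, c'.1.z i = g (c.1.z i)) ∧
        ∀ y w, At c y w → At c' y (g w) := by
    rintro c c' ⟨l, g, hg, e⟩
    refine ⟨g, hg, e, ?_⟩
    rintro _ _ ⟨n, hn, rfl, rfl⟩
    exact ⟨n, hn.trans_le l, rfl, e n hn⟩
  refine ⟨⟨Quotient S, mem, 𝒢, fun c => c.1.F, At, ⟨p₀, Order.mem_idealOfCofinals p₀ D⟩, ?_, ?_, ?_,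
    ?_, ?_⟩⟩
  · rintro c _ _ ⟨n, hn, rfl, rfl⟩
    exact c.1.dom n
  · rintro c _ _ _ _ ⟨n, hn, rfl, rfl⟩ ⟨m, hm, rfl, rfl⟩
    exact cls_eq c.1 c.2 n m hn hm
  · rintro c _ _ _ _ ⟨n, hn, rfl, rfl⟩ ⟨m, hm, rfl, rfl⟩
    exact mem_eq c.1 c.2 n m hn hm
  · rintro c ⟨n⟩
    obtain ⟨d, hd, h1, h2⟩ := long c.1 c.2 n
    obtain ⟨g, hg, -, hA⟩ := ext_of_le c ⟨d, hd⟩ h1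
    exact ⟨⟨d, hd⟩, g, ⟨hg, hA⟩, _, n, h2, rfl, rfl⟩
  · intro r hr c x v hv H h hh w hw hP
    choose e he hx hz using hv
    obtain rfl : v = c.1.z ∘ e := (funext hz).symm
    obtain ⟨c₁, hc₁, he₁, hd⟩ := meet r (.inr hr) e
    obtain ⟨d, hdG, h1, h2⟩ := dir c.1 c.2 c₁ hc₁
    obtain ⟨g, hg, hgz, hA⟩ := ext_of_le c ⟨d, hdG⟩ h1
    obtain ⟨g₁, hg₁, hgz₁, -⟩ := ext_of_le ⟨c₁, hc₁⟩ ⟨d, hdG⟩ h2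
    have e1 : g ∘ c.1.z ∘ e = d.z ∘ e := funext fun i => (hgz _ (he i)).symm
    have e2 : g₁ ∘ c₁.z ∘ e = d.z ∘ e := funext fun i => (hgz₁ _ (he₁ i)).symm
    rcases hd with ⟨n, hn, hPn⟩ | hd
    · refine ⟨⟨d, hdG⟩, g, ⟨hg, hA⟩, cls n, d.z n, ⟨n, hn.trans_le h2.1, rfl, rfl⟩, ?_⟩
      have := r.persist (v := c₁.z ∘ e) hg₁ (fun i => c₁.dom _) (c₁.dom _) hPn
      rw [e2] at this
      rw [e1, hgz₁ n hn]
      exact this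
    · exfalso
      obtain ⟨K, k, hk, w', hw', hP'⟩ :=
        hom_of_amalgam (v := c.1.z ∘ e) (fun i => c.1.dom _) hg hh hw hP
      let d' : Cond := ⟨K, d.len, k ∘ d.z, fun i => hk.dom (d.dom i)⟩
      have hd' : d ≤ d' := ⟨le_rfl, k, hk, fun _ _ => rfl⟩
      refine hd d' (h2.trans hd') w' hw' ?_
      rw [e1] at hP'
      exact hP'

open W FirstOrder FirstOrder.Language

/-- The variable underlying a term of the language of set theory. -/
def tvar {α : Type} : Lmem.Term α → α
  | .var a => a
  | .func f _ => Empty.elim f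

theorem realize_tvar {M : Type*} {α : Type} (mem : M → M → Prop) (t : Lmem.Term α) (v : α → M) :
    (letI := memStructure mem; t.realize v) = v (tvar t) := by
  cases t with
  | var a => rfl
  | func f _ => exact Empty.elim f

/-- The potentialist interpretation of formulas: quantifiers range over all later stages. -/
def Psi {α : Type} : {n : ℕ} → Lmem.BoundedFormula α n → Finset Idx → (α → W) → (Fin n → W) → Prop
  | _, .falsum, _, _, _ => False
  | _, .equal t₁ t₂, _, v, xs => Sum.elim v xs (tvar t₁) = Sum.elim v xs (tvar t₂)
  | _, .rel R ts, _, v, xs =>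
    @Structure.RelMap Lmem W (memStructure E) _ R (fun i => Sum.elim v xs (tvar (ts i)))
  | _, .imp φ ψ, F, v, xs => Psi φ F v xs → Psi ψ F v xs
  | _, .all φ, F, v, xs => ∀ G g, Hom F G g → ∀ y ∈ Dom G, Psi φ G (g ∘ v) (Fin.snoc (g ∘ xs) y)

theorem relMap_congr {M N : Type*} {mem : M → M → Prop} {mem' : N → N → Prop} {l : ℕ}
    (R : Lmem.Relations l) {a : Fin l → M} {b : Fin l → N}
    (h : ∀ i j, mem (a i) (a j) ↔ mem' (b i) (b j)) :
    @Structure.RelMap Lmem M (memStructure mem) _ R a ↔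
      @Structure.RelMap Lmem N (memStructure mem') _ R b := by
  change memRel l at R
  cases R
  exact h 0 1

theorem snoc_dom {n : ℕ} {xs : Fin n → W} {y : W} (hx : ∀ i, xs i ∈ Dom F) (hy : y ∈ Dom F)
    (i : Fin (n + 1)) : (Fin.snoc xs y : Fin (n + 1) → W) i ∈ Dom F := by
  induction i using Fin.lastCases with
  | last => simpa using hy
  | cast i => simpa using hx i

theorem Psi_hom {α : Type} {n : ℕ} (φ : Lmem.BoundedFormula α n) :
    ∀ {F G g} {v : α → W} {xs : Fin n → W}, Hom F G g → (∀ a, v a ∈ Dom F) → (∀ i, xs i ∈ Dom F) →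
      (Psi φ F v xs ↔ Psi φ G (g ∘ v) (g ∘ xs)) := by
  induction φ with
  | falsum => intros; exact Iff.rfl
  | equal t₁ t₂ =>
    intro F G g v xs hg hv hx
    simp only [Psi, ← Sum.comp_elim, Function.comp_apply, hg.emb.inj.eq_iff]
  | rel R ts =>
    intro F G g v xs hg hv hx
    simp only [Psi, ← Sum.comp_elim, Function.comp_apply]
    exact relMap_congr R fun i j => hg.emb.E_iff.symm
  | imp φ ψ ih₁ ih₂ =>
    intro F G g v xs hg hv hx
    exact imp_congr (ih₁ hg hv hx) (ih₂ hg hv hx)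
  | all φ ih =>
    intro F G g v xs hg hv hx
    constructor
    · intro h G' g' hg' y hy
      exact h G' _ (hg'.comp hg) y hy
    · intro h G' g' hg' y hy
      obtain ⟨K, k₁, k₂, h₁, h₂, e⟩ := amalgamation hg hg'
      have := h K k₁ h₁ (k₂ y) (h₂.dom hy)
      have e1 : k₁ ∘ g ∘ v = k₂ ∘ g' ∘ v := funext fun i => e _ (hv i)
      have e2 : k₁ ∘ g ∘ xs = k₂ ∘ g' ∘ xs := funext fun i => e _ (hx i)
      rw [e1, e2, ← Fin.comp_snoc] at this
      exact (ih h₂ (fun i => hg'.dom (hv i)) (snoc_dom (fun i => hg'.dom (hx i)) hy)).2 this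

/-- The property of being a counterexample to a formula. -/
def fReq {k n : ℕ} (φ : Lmem.BoundedFormula (Fin k) (n + 1)) : Req where
  d := k + n
  P F v w := ¬ Psi φ F (v ∘ Fin.castAdd n) (Fin.snoc (v ∘ Fin.natAdd k) w)
  persist := by
    intro F G g v w hg hv hw h
    rw [Function.comp_assoc, Function.comp_assoc, ← Fin.comp_snoc]
    exact fun h' => h ((Psi_hom φ hg (fun i => hv _) (snoc_dom (fun i => hv _) hw)).2 h')

theorem fReq_P {k n : ℕ} (φ : Lmem.BoundedFormula (Fin k) (n + 1)) (g : W → W) (v : Fin k → W)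
    (vs : Fin n → W) (w : W) :
    (fReq φ).P F (g ∘ Fin.append v vs) w ↔ ¬ Psi φ F (g ∘ v) (Fin.snoc (g ∘ vs) w) := by
  have e1 : (g ∘ Fin.append v vs) ∘ Fin.castAdd n = g ∘ v := by ext1 i; simp
  have e2 : (g ∘ Fin.append v vs) ∘ Fin.natAdd k = g ∘ vs := by ext1 i; simp
  rw [← e1, ← e2]
  exact Iff.rfl

theorem countable_boundedFormula (k n : ℕ) : Countable (Lmem.BoundedFormula (Fin k) n) := by
  have : ∀ l, Countable (Lmem.Relations l) := fun l => by
    change Countable (memRel l)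
    have : Function.Injective (fun _ : memRel l => ()) := by
      rintro ⟨⟩ ⟨⟩ -
      rfl
    exact this.countable
  have : ∀ l, Countable (Lmem.Functions l) := fun l => by
    change Countable Empty
    infer_instance
  have : Countable Lmem.Symbols := by
    unfold Language.Symbols
    infer_instance
  exact Function.Injective.countable (β := Σ n, Lmem.BoundedFormula (Fin k) n)
    (f := fun φ => ⟨n, φ⟩) fun φ ψ h => by simpa using h

theorem countable_fReq :
    (Set.range fun p : Σ k n, Lmem.BoundedFormula (Fin k) (n + 1) => fReq p.2.2).Countable := by
  have := fun k n => countable_boundedFormula k (n + 1)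
  exact Set.countable_range _

namespace GM

variable {Q : Set Req} (𝔐 : GM Q)

/-- `𝔐.Ext c c' g`: the stage `c'` extends `c` by means of the transition map `g`. -/
def Ext (c c' : 𝔐.Stage) (g : W → W) : Prop :=
  Hom (𝔐.F c) (𝔐.F c') g ∧ ∀ y w, 𝔐.At c y w → 𝔐.At c' y (g w)

variable {𝔐} in
theorem Ext.comp {c c' c'' : 𝔐.Stage} {g g' : W → W} (h' : 𝔐.Ext c' c'' g') (h : 𝔐.Ext c c' g) :
    𝔐.Ext c c'' (g' ∘ g) :=
  ⟨h'.1.comp h.1, fun y w hy => h'.2 _ _ (h.2 y w hy)⟩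

theorem Ext.refl (c : 𝔐.Stage) : 𝔐.Ext c c id := ⟨Hom.id _, fun _ _ h => h⟩

theorem grow (c : 𝔐.Stage) (x : 𝔐.M) : ∃ c' g, 𝔐.Ext c c' g ∧ ∃ w, 𝔐.At c' x w := 𝔐.grow' c x

theorem name {r : Req} (hr : r ∈ Q) {c : 𝔐.Stage} {x : Fin r.d → 𝔐.M} {v : Fin r.d → W}
    (hv : ∀ i, 𝔐.At c (x i) (v i)) {H : Finset Idx} {h : W → W} (hh : Hom (𝔐.F c) H h) {w : W}
    (hw : w ∈ Dom H) (hP : r.P H (h ∘ v) w) :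
    ∃ c' g, 𝔐.Ext c c' g ∧ ∃ x' w', 𝔐.At c' x' w' ∧ r.P (𝔐.F c') (g ∘ v) w' :=
  𝔐.name' r hr c x v hv H h hh w hw hP

/-- Every finite tuple is available at some stage. -/
theorem grow_fin (c : 𝔐.Stage) (n : ℕ) (x : Fin n → 𝔐.M) :
    ∃ c' g, 𝔐.Ext c c' g ∧ ∃ v : Fin n → W, ∀ i, 𝔐.At c' (x i) (v i) := by
  induction n with
  | zero => exact ⟨c, id, Ext.refl _ _, Fin.elim0, fun i => i.elim0⟩
  | succ n ih =>
    obtain ⟨c', g, hg, v, hv⟩ := ih (Fin.init x)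
    obtain ⟨c'', g', hg', w, hw⟩ := 𝔐.grow c' (x (Fin.last n))
    refine ⟨c'', _, hg'.comp hg, Fin.snoc (g' ∘ v) w, fun i => ?_⟩
    induction i using Fin.lastCases with
    | last => simpa using hw
    | cast i => simpa using! hg'.2 _ _ (hv i)

theorem truth (hQ : ∀ k n (φ : Lmem.BoundedFormula (Fin k) (n + 1)), fReq φ ∈ Q) {k n : ℕ}
    (φ : Lmem.BoundedFormula (Fin k) n) : ∀ {c : 𝔐.Stage} {x : Fin k → 𝔐.M} {xs : Fin n → 𝔐.M}
      {v : Fin k → W} {vs : Fin n → W}, (∀ i, 𝔐.At c (x i) (v i)) → (∀ i, 𝔐.At c (xs i) (vs i)) →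
      ((letI := memStructure 𝔐.mem; φ.Realize x xs) ↔ Psi φ (𝔐.F c) v vs) := by
  have hS : ∀ {n : ℕ} {c : 𝔐.Stage} {x : Fin k → 𝔐.M} {xs : Fin n → 𝔐.M}
      {v : Fin k → W} {vs : Fin n → W}, (∀ i, 𝔐.At c (x i) (v i)) → (∀ i, 𝔐.At c (xs i) (vs i)) →
      ∀ a, 𝔐.At c (Sum.elim x xs a) (Sum.elim v vs a) := by
    intro n c x xs v vs h h' a
    cases a
    · exact h _
    · exact h' _
  induction φ with
  | falsum => intros; exact Iff.rfl
  | equal t₁ t₂ =>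
    intro c x xs v vs hx hxs
    simp only [Psi, BoundedFormula.Realize]
    rw [realize_tvar, realize_tvar]
    exact 𝔐.eq_iff (hS hx hxs _) (hS hx hxs _)
  | rel R ts =>
    intro c x xs v vs hx hxs
    refine relMap_congr R fun i j => ?_
    rw [realize_tvar, realize_tvar]
    exact 𝔐.mem_iff (hS hx hxs _) (hS hx hxs _)
  | imp φ ψ ih₁ ih₂ =>
    intro c x xs v vs hx hxs
    exact imp_congr (ih₁ hx hxs) (ih₂ hx hxs)
  | @all n φ ih =>
    intro c x xs v vs hx hxs
    have snoc : ∀ {c' : 𝔐.Stage} {g y w}, 𝔐.Ext c c' g → 𝔐.At c' y w → ∀ i,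
        𝔐.At c' ((Fin.snoc xs y : Fin (n + 1) → 𝔐.M) i)
          ((Fin.snoc (g ∘ vs) w : Fin (n + 1) → W) i) := by
      intro c' g y w hg hy i
      induction i using Fin.lastCases with
      | last => simpa using hy
      | cast i => simpa using hg.2 _ _ (hxs i)
    constructor
    · intro h
      by_contra hn
      simp only [Psi, not_forall] at hn
      obtain ⟨G, g, hg, y, hy, hn⟩ := hn
      obtain ⟨c', g', hg', x', w', hw', hP⟩ := 𝔐.name (hQ k n φ) (c := c)
        (x := Fin.append x xs) (v := Fin.append v vs) (fun i => by
          induction i using Fin.addCases with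
          | left i => simpa using hx i
          | right i => simpa using hxs i) hg hy
          ((fReq_P φ g v vs y).2 hn)
      rw [fReq_P, ← ih (v := g' ∘ v) (fun i => hg'.2 _ _ (hx i)) (snoc hg' hw')] at hP
      exact hP (h x')
    · intro h y
      obtain ⟨c', g, hg, w, hw⟩ := 𝔐.grow c y
      exact (ih (fun i => hg.2 _ _ (hx i)) (snoc hg hw)).2 (h _ g hg.1 w (𝔐.dom hw))

end GM

open W FirstOrder FirstOrder.Language

/-- Persistence of a unary property of a witness under the transition maps. -/
abbrev Pers₁ (P : Finset Idx → W → W → Prop) : Prop :=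
  ∀ ⦃F G g⦄, Hom F G g → ∀ ⦃x w⦄, x ∈ Dom F → w ∈ Dom F → P F x w → P G (g x) (g w)

abbrev Pers₂ (P : Finset Idx → W → W → W → Prop) : Prop :=
  ∀ ⦃F G g⦄, Hom F G g → ∀ ⦃x y w⦄, x ∈ Dom F → y ∈ Dom F → w ∈ Dom F →
    P F x y w → P G (g x) (g y) (g w)

abbrev Pers₃ (P : Finset Idx → W → W → W → W → Prop) : Prop :=
  ∀ ⦃F G g⦄, Hom F G g → ∀ ⦃x y z w⦄, x ∈ Dom F → y ∈ Dom F → z ∈ Dom F → w ∈ Dom F →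
    P F x y z w → P G (g x) (g y) (g z) (g w)

def req₁ (P : Finset Idx → W → W → Prop) (h : Pers₁ P) : Req :=
  ⟨1, fun F v w => P F (v 0) w, fun hg hv hw => h hg (hv 0) hw⟩

def req₂ (P : Finset Idx → W → W → W → Prop) (h : Pers₂ P) : Req :=
  ⟨2, fun F v w => P F (v 0) (v 1) w, fun hg hv hw => h hg (hv 0) (hv 1) hw⟩

def req₃ (P : Finset Idx → W → W → W → W → Prop) (h : Pers₃ P) : Req :=
  ⟨3, fun F v w => P F (v 0) (v 1) (v 2) w, fun hg hv hw => h hg (hv 0) (hv 1) (hv 2) hw⟩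

namespace GM

variable {Q : Set Req} (𝔐 : GM Q)

theorem name₁ {P p} (hr : req₁ P p ∈ Q) {c : 𝔐.Stage} {x : 𝔐.M} {v : W} (hv : 𝔐.At c x v)
    {H : Finset Idx} {h : W → W} (hh : Hom (𝔐.F c) H h) {w : W} (hw : w ∈ Dom H)
    (hP : P H (h v) w) :
    ∃ c' g, 𝔐.Ext c c' g ∧ ∃ x' w', 𝔐.At c' x' w' ∧ P (𝔐.F c') (g v) w' ∧
      ∀ G k, Hom (𝔐.F c') G k → P G (k (g v)) (k w') := by
  obtain ⟨c', g, hg, x', w', hw', hP'⟩ :=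
    𝔐.name hr (x := fun _ => x) (v := fun _ => v) (fun _ => hv) hh hw hP
  exact ⟨c', g, hg, x', w', hw', hP', fun G k hk =>
    p hk (𝔐.dom (hg.2 _ _ hv)) (𝔐.dom hw') hP'⟩

theorem name₂ {P p} (hr : req₂ P p ∈ Q) {c : 𝔐.Stage} {x y : 𝔐.M} {v u : W} (hv : 𝔐.At c x v)
    (hu : 𝔐.At c y u) {H : Finset Idx} {h : W → W} (hh : Hom (𝔐.F c) H h) {w : W} (hw : w ∈ Dom H)
    (hP : P H (h v) (h u) w) :
    ∃ c' g, 𝔐.Ext c c' g ∧ ∃ x' w', 𝔐.At c' x' w' ∧ P (𝔐.F c') (g v) (g u) w' ∧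
      ∀ G k, Hom (𝔐.F c') G k → P G (k (g v)) (k (g u)) (k w') := by
  obtain ⟨c', g, hg, x', w', hw', hP'⟩ :=
    𝔐.name hr (x := ![x, y]) (v := ![v, u]) (Fin.forall_fin_two.2 ⟨hv, hu⟩) hh hw hP
  exact ⟨c', g, hg, x', w', hw', hP', fun G k hk =>
    p hk (𝔐.dom (hg.2 _ _ hv)) (𝔐.dom (hg.2 _ _ hu)) (𝔐.dom hw') hP'⟩

theorem name₃ {P h} (hr : req₃ P h ∈ Q) {c : 𝔐.Stage} {x y z : 𝔐.M} {v u t : W}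
    (hv : 𝔐.At c x v) (hu : 𝔐.At c y u) (ht : 𝔐.At c z t) {H : Finset Idx} {h : W → W}
    (hh : Hom (𝔐.F c) H h) {w : W} (hw : w ∈ Dom H) (hP : P H (h v) (h u) (h t) w) :
    ∃ c' g, 𝔐.Ext c c' g ∧ ∃ x' w', 𝔐.At c' x' w' ∧ P (𝔐.F c') (g v) (g u) (g t) w' :=
  𝔐.name hr (x := ![x, y, z]) (v := ![v, u, t])
    (Fin.forall_fin_succ.2 ⟨hv, Fin.forall_fin_two.2 ⟨hu, ht⟩⟩) hh hw hP

variable {𝔐} in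
/-- Membership is computed at every stage. -/
theorem Ext.mem_iff {c c' : 𝔐.Stage} {g : W → W} (hg : 𝔐.Ext c c' g) {x y : 𝔐.M} {v w : W}
    (hv : 𝔐.At c x v) (hw : 𝔐.At c' y w) : 𝔐.mem y x ↔ E w (g v) :=
  𝔐.mem_iff hw (hg.2 _ _ hv)

end GM

theorem Dom_of_E {x y : W} (hx : x ∈ Dom F) (h : E y x) : y ∈ Dom F := Sup.of_E hx h

theorem node_dom {S : Set W} [Small.{0} S] (h : ∀ y ∈ S, y ∈ Dom F) : node S ∈ Dom F :=
  Sup_node.2 h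

/-- `w` belongs to `x` and not to `y`. -/
def diffReq : Req := req₂ (fun _ x y w => E w x ∧ ¬ E w y) <| by
  intro F G g hg x y w _ _ _ h
  rwa [hg.emb.E_iff, hg.emb.E_iff]

/-- `w` belongs to both `x` and `y`. -/
def interReq : Req := req₂ (fun _ x y w => E w x ∧ E w y) <| by
  intro F G g hg x y w _ _ _ h
  rwa [hg.emb.E_iff, hg.emb.E_iff]

/-- `w` lies between `x` and `y`. -/
def midReq : Req := req₂ (fun _ x y w => E x w ∧ E w y) <| by
  intro F G g hg x y w _ _ _ h
  rwa [hg.emb.E_iff, hg.emb.E_iff]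

def pairReq : Req := req₂ (fun _ x y w => w = node {x, y}) <| by
  intro F G g hg x y w _ _ _ h
  rw [h, hg.emb.map_node]
  exact node_congr (Set.image_pair _ _ _)

def unionReq : Req := req₁
  (fun _ x w => IsNode x ∧ (∀ y, E y x → IsNode y) ∧ IsNode w ∧
    ∀ z, E z w ↔ ∃ y, E z y ∧ E y x) <| by
    rintro F G g hg x w - - ⟨h1, h2, h3, h4⟩
    have hE := hg.emb
    refine ⟨hE.isNode h1, ?_, hE.isNode h3, ?_⟩
    · intro y hy
      obtain ⟨y₀, hy₀, rfl⟩ := (hE.E_node h1).1 hy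
      exact hE.isNode (h2 y₀ hy₀)
    · intro z
      rw [hE.E_node h3]
      constructor
      · rintro ⟨y, hy, rfl⟩
        obtain ⟨t, ht, ht'⟩ := (h4 _).1 hy
        exact ⟨g t, hE.E_iff.2 ht, hE.E_iff.2 ht'⟩
      · rintro ⟨t, ht, ht'⟩
        obtain ⟨t₀, ht₀, rfl⟩ := (hE.E_node h1).1 ht'
        obtain ⟨z₀, hz₀, rfl⟩ := (hE.E_node (h2 t₀ ht₀)).1 ht
        exact ⟨z₀, (h4 z₀).2 ⟨t₀, hz₀, ht₀⟩, rfl⟩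

def powerReq : Req := req₁
  (fun _ x w => IsNode x ∧ IsNode w ∧ ∀ z, E z w ↔ IsNode z ∧ ∀ y, E y z → E y x) <| by
    rintro F G g hg x w - - ⟨h1, h3, h4⟩
    have hE := hg.emb
    refine ⟨hE.isNode h1, hE.isNode h3, ?_⟩
    intro z
    rw [hE.E_node h3]
    constructor
    · rintro ⟨z₀, hz₀, rfl⟩
      obtain ⟨hz, h⟩ := (h4 _).1 hz₀
      refine ⟨hE.isNode hz, fun y hy => ?_⟩
      obtain ⟨y₀, hy₀, rfl⟩ := (hE.E_node hz).1 hy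
      exact hE.E_iff.2 (h y₀ hy₀)
    · rintro ⟨hz, h⟩
      let S : Set W := {y | E y x ∧ E (g y) z}
      have : Small.{0} S := small_subset (s := {y | E y x}) fun y hy => hy.1
      refine ⟨node S, (h4 _).2 ⟨isNode_node _, fun y hy => ((E_node _ _).1 hy).1⟩, ?_⟩
      refine W.ext (hE.isNode (isNode_node _)) hz fun y => ?_
      rw [hE.E_node (isNode_node _)]
      constructor
      · rintro ⟨y, hy, rfl⟩
        exact ((E_node _ _).1 hy).2
      · intro hy
        obtain ⟨y', hy', rfl⟩ := (hE.E_node h1).1 (h y hy)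
        exact ⟨y', (E_node _ _).2 ⟨hy', hy⟩, rfl⟩

def compReq {n : ℕ} (φ : Lmem.Formula (Fin (n + 1))) : Req where
  d := n + 1
  P F v w := IsNode (v 0) ∧ IsNode w ∧
    ∀ z, E z w ↔ E z (v 0) ∧ Psi φ F (Fin.cons z (Fin.tail v)) Fin.elim0
  persist := by
    intro F G g v w hg hv hw ⟨h1, h2, h3⟩
    have hE := hg.emb
    have key : ∀ y, E y (v 0) → (Psi φ F (Fin.cons y (Fin.tail v)) Fin.elim0 ↔
        Psi φ G (Fin.cons (g y) (Fin.tail (g ∘ v))) Fin.elim0) := by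
      intro y hy
      rw [Psi_hom φ hg (fun i => by
        induction i using Fin.cases with
        | zero => exact Dom_of_E (hv 0) hy
        | succ i => exact hv i.succ) (fun i => i.elim0), Fin.comp_cons]
      exact iff_of_eq (congrArg _ (Subsingleton.elim _ _))
    refine ⟨hE.isNode h1, hE.isNode h2, fun z => ?_⟩
    rw [hE.E_node h2]
    constructor
    · rintro ⟨y, hyw, rfl⟩
      obtain ⟨hy, h⟩ := (h3 y).1 hyw
      exact ⟨hE.E_iff.2 hy, (key y hy).1 h⟩
    · rintro ⟨hz, h⟩
      obtain ⟨y, hy, rfl⟩ := (hE.E_node h1).1 hz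
      exact ⟨y, (h3 y).2 ⟨hy, (key y hy).2 h⟩, rfl⟩

theorem countable_compReq :
    (Set.range fun p : Σ n, Lmem.Formula (Fin (n + 1)) => compReq p.2).Countable := by
  have : ∀ n, Countable (Lmem.Formula (Fin (n + 1))) := fun n => countable_boundedFormula _ 0
  exact Set.countable_range _

def minReq : Req := req₁ (fun _ x w => E w x ∧ ∀ z, ¬ (E z w ∧ E z x)) <| by
    rintro F G g hg x w - - ⟨h1, h2⟩
    have hE := hg.emb
    refine ⟨hE.E_iff.2 h1, fun z ⟨hz, hz'⟩ => ?_⟩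
    obtain ⟨z₀, hz₀, rfl⟩ := (hE.E_node (.of_E h1)).1 hz'
    exact h2 z₀ ⟨hE.E_iff.1 hz, hz₀⟩

def emptyReq : Req := req₁ (fun _ x w => E w x ∧ IsNode w ∧ ∀ z, ¬ E z w) <| by
    rintro F G g hg x w - - ⟨h1, h2, h3⟩
    have hE := hg.emb
    refine ⟨hE.E_iff.2 h1, hE.isNode h2, fun z hz => ?_⟩
    obtain ⟨z₀, hz₀, rfl⟩ := (hE.E_node h2).1 hz
    exact h3 z₀ hz₀

def overlapReq₁ : Req := req₁ (fun _ x w => E w x ∧ ∃ b, E b x ∧ w ≠ b ∧ ∃ z, E z w ∧ E z b) <| by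
    rintro F G g hg x w - - ⟨h1, b, h2, h3, z, h4, h5⟩
    have hE := hg.emb
    exact ⟨hE.E_iff.2 h1, g b, hE.E_iff.2 h2, hE.inj.ne h3, g z, hE.E_iff.2 h4, hE.E_iff.2 h5⟩

def overlapReq₂ : Req := req₂ (fun _ x a w => E w x ∧ a ≠ w ∧ ∃ z, E z a ∧ E z w) <| by
    rintro F G g hg x a w - - - ⟨h2, h3, z, h4, h5⟩
    have hE := hg.emb
    exact ⟨hE.E_iff.2 h2, hE.inj.ne h3, g z, hE.E_iff.2 h4, hE.E_iff.2 h5⟩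

theorem choice_persist {g : W → W} (hE : Emb g) {x w : W} (h1 : IsNode x) (h2 : IsNode w)
    (h3 : ∀ a, E a x → ∃ z, E z a ∧ E z w ∧ ∀ z', E z' a → E z' w → z' = z) :
    ∀ a, E a (g x) → ∃ z, E z a ∧ E z (g w) ∧ ∀ z', E z' a → E z' (g w) → z' = z := by
  intro a ha
  obtain ⟨a₀, ha₀, rfl⟩ := (hE.E_node h1).1 ha
  obtain ⟨z, hz, hz', hu⟩ := h3 a₀ ha₀
  refine ⟨g z, hE.E_iff.2 hz, hE.E_iff.2 hz', fun y hy hy' => ?_⟩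
  obtain ⟨y₀, hy₀, rfl⟩ := (hE.E_node h2).1 hy'
  rw [hu y₀ (hE.E_iff.1 hy) hy₀]

def choiceReq : Req := req₁ (fun _ x w => IsNode x ∧ IsNode w ∧
    ∀ a, E a x → ∃ z, E z a ∧ E z w ∧ ∀ z', E z' a → E z' w → z' = z) <| by
    rintro F G g hg x w - - ⟨h1, h2, h3⟩
    exact ⟨hg.emb.isNode h1, hg.emb.isNode h2, choice_persist hg.emb h1 h2 h3⟩

/-- The von Neumann natural numbers. -/
noncomputable def vn : ℕ → W
  | 0 => node ∅
  | n + 1 => node (insert (vn n) {z | E z (vn n)})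

theorem isNode_vn (n : ℕ) : IsNode (vn n) := by
  cases n <;> simp [vn]

theorem Emb.vn {g : W → W} (hg : Emb g) (n : ℕ) : g (vn n) = vn n := by
  induction n with
  | zero =>
    rw [ZCForcing.vn, hg.map_node]
    exact node_congr (by simp)
  | succ n ih =>
    rw [ZCForcing.vn, hg.map_node]
    refine node_congr ?_
    rw [Set.image_insert_eq, ih]
    congr 1
    ext z
    have := hg.E_node (z := z) (isNode_vn n)
    rw [ih] at this
    exact this.symm

/-- The set of von Neumann natural numbers. -/
noncomputable def om : W := node (Set.range vn)

theorem Emb.om {g : W → W} (hg : Emb g) : g om = om := by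
  rw [ZCForcing.om, hg.map_node]
  refine node_congr ?_
  rw [← Set.range_comp]
  congr 1
  exact funext hg.vn

theorem vn_dom (n : ℕ) : vn n ∈ Dom F := by
  induction n with
  | zero => exact node_dom (by simp)
  | succ n ih =>
    refine node_dom ?_
    rintro y (rfl | hy)
    · exact ih
    · exact Dom_of_E ih hy

theorem om_dom : om ∈ Dom F := node_dom (by rintro _ ⟨n, rfl⟩; exact vn_dom n)

/-- `x` is not an atom. -/
def nodeReq : Req := req₁ (fun _ x _ => IsNode x) fun _ _ _ hg _ _ _ _ h => hg.emb.isNode h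

def omReq : Req := ⟨0, fun _ _ w => w = om, fun hg _ _ h => by rw [h, hg.emb.om]⟩
def zeroReq : Req := ⟨0, fun _ _ w => w = vn 0, fun hg _ _ h => by rw [h, hg.emb.vn]⟩
def succReq : Req := req₁ (fun _ x w => ∃ n, x = vn n ∧ w = vn (n + 1)) <| by
    rintro F G g hg x w - - ⟨n, h1, h2⟩
    exact ⟨n, by rw [h1, hg.emb.vn], by rw [h2, hg.emb.vn]⟩

/-- The requirements ensuring the axioms of set theory. -/
def zcReqs : Set Req :=
  (Set.range fun p : Σ k n, Lmem.BoundedFormula (Fin k) (n + 1) => fReq p.2.2) ∪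
  (Set.range fun p : Σ n, Lmem.Formula (Fin (n + 1)) => compReq p.2) ∪
  {diffReq, interReq, midReq, pairReq, unionReq, powerReq, minReq, emptyReq, overlapReq₁,
    overlapReq₂, choiceReq, nodeReq, omReq, zeroReq, succReq}

theorem countable_zcReqs : zcReqs.Countable :=
  (countable_fReq.union countable_compReq).union (Set.toFinite _).countable

open W FirstOrder FirstOrder.Language

theorem small_powerset (v : W) : Small.{0} {z : W | IsNode z ∧ ∀ y, E y z → E y v} := by
  have hs : ∀ S : Set {y | E y v}, Small.{0} (Subtype.val '' S) := fun S =>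
    small_subset (s := {y | E y v}) (by rintro _ ⟨y, -, rfl⟩; exact y.2)
  let f : Set {y | E y v} → W := fun S => node (Subtype.val '' S)
  have : Small.{0} (Set.range f) := small_range f
  refine small_subset (s := Set.range f) ?_
  rintro z ⟨hz, h⟩
  refine ⟨{y | E y.1 z}, W.ext (isNode_node _) hz fun y => ?_⟩
  rw [E_node]
  constructor
  · rintro ⟨y, hy, rfl⟩
    exact hy
  · exact fun hy => ⟨⟨y, h y hy⟩, hy, rfl⟩

namespace GM

variable {Q : Set Req} (𝔐 : GM Q)

theorem At.node {𝔐 : GM Q} (h : zcReqs ⊆ Q) {c x v} (hv : 𝔐.At c x v) :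
    ∃ c' g, 𝔐.Ext c c' g ∧ IsNode (g v) := by
  obtain ⟨c', g, hg, -, -, -, hP, -⟩ := 𝔐.name₁ (show nodeReq ∈ Q from h (by simp [zcReqs])) hv
    (Hom.unf _ 1) (𝔐.dom (hv) |> (Hom.unf _ 1).dom) (isNode_unf v)
  exact ⟨c', g, hg, hP⟩

theorem grow_node (h : zcReqs ⊆ Q) (c : 𝔐.Stage) (x : 𝔐.M) :
    ∃ c' g, 𝔐.Ext c c' g ∧ ∃ w, 𝔐.At c' x w ∧ IsNode w := by
  obtain ⟨c₁, g₁, h₁, w, hw⟩ := 𝔐.grow c x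
  obtain ⟨c₂, g₂, h₂, hn⟩ := hw.node h
  exact ⟨c₂, _, h₂.comp h₁, _, h₂.2 _ _ hw, hn⟩

variable {𝔐}

theorem E_of_subset (h : zcReqs ⊆ Q) {c x y v u} (hv : 𝔐.At c x v) (hu : 𝔐.At c y u)
    (hxy : ∀ z, 𝔐.mem z x → 𝔐.mem z y) {w : W} (hw : E w v) : E w u := by
  by_contra hn
  obtain ⟨c', g, hg, z, w', hz, ⟨h1, h2⟩, -⟩ := 𝔐.name₂
    (show diffReq ∈ Q from h (by simp [zcReqs])) hv hu (Hom.id _) (Dom_of_E (𝔐.dom hv) hw) ⟨hw, hn⟩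
  exact h2 ((hg.mem_iff hu hz).1 (hxy z ((hg.mem_iff hv hz).2 h1)))

theorem eq_of_mem_iff (h : zcReqs ⊆ Q) {c x y v u} (hv : 𝔐.At c x v) (hu : 𝔐.At c y u)
    (nv : IsNode v) (nu : IsNode u) (hxy : ∀ z, 𝔐.mem z x ↔ 𝔐.mem z y) : v = u :=
  W.ext nv nu fun _ => ⟨E_of_subset h hv hu fun z => (hxy z).1,
    E_of_subset h hu hv fun z => (hxy z).2⟩

theorem axExt (h : zcReqs ⊆ Q) : AxExt 𝔐.M 𝔐.mem := by
  intro x y hxy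
  obtain ⟨c₁, g₁, h₁, v, hv, nv⟩ := 𝔐.grow_node h 𝔐.base x
  obtain ⟨c₂, g₂, h₂, u, hu, nu⟩ := 𝔐.grow_node h c₁ y
  exact (𝔐.eq_iff (h₂.2 _ _ hv) hu).2
    (eq_of_mem_iff h (h₂.2 _ _ hv) hu (h₂.1.emb.isNode nv) nu hxy)

theorem axPairing (h : zcReqs ⊆ Q) : AxPairing 𝔐.M 𝔐.mem := by
  intro x y
  obtain ⟨c₁, g₁, h₁, v, hv⟩ := 𝔐.grow 𝔐.base x
  obtain ⟨c₂, g₂, h₂, u, hu⟩ := 𝔐.grow c₁ y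
  have hv := h₂.2 _ _ hv
  obtain ⟨c₃, g₃, h₃, p, w, hw, -, hP⟩ := 𝔐.name₂ (show pairReq ∈ Q from h (by simp [zcReqs]))
    hv hu (Hom.id _) (w := node {id (g₂ v), id u}) (node_dom (by
      rintro _ (rfl | rfl)
      exacts [𝔐.dom hv, 𝔐.dom hu])) rfl
  refine ⟨p, fun z => ?_⟩
  obtain ⟨c₄, g₄, h₄, t, ht⟩ := 𝔐.grow c₃ z
  rw [h₄.mem_iff hw ht, hP _ _ h₄.1, E_node, 𝔐.eq_iff ht (h₄.2 _ _ (h₃.2 _ _ hv)),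
    𝔐.eq_iff ht (h₄.2 _ _ (h₃.2 _ _ hu))]
  rfl

theorem axUnion (h : zcReqs ⊆ Q) : AxUnion 𝔐.M 𝔐.mem := by
  intro x
  obtain ⟨c₁, g₁, h₁, v, hv, nv⟩ := 𝔐.grow_node h 𝔐.base x
  have hU := Hom.unf (𝔐.F c₁) 1
  have nn : ∀ y, E y (unf^[1] v) → IsNode y := by
    intro y hy
    obtain ⟨y₀, -, rfl⟩ := (hU.emb.E_node nv).1 hy
    exact isNode_unf _
  have : Small.{0} {z | ∃ y, E z y ∧ E y (unf^[1] v)} := by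
    refine small_subset (s := ⋃ y : {y | E y (unf^[1] v)}, {z | E z y.1}) ?_
    rintro z ⟨y, hz, hy⟩
    exact Set.mem_iUnion.2 ⟨⟨y, hy⟩, hz⟩
  obtain ⟨c₃, g₃, h₃, p, w, hw, -, hP⟩ := 𝔐.name₁ (show unionReq ∈ Q from h (by simp [zcReqs]))
    hv hU (w := node {z | ∃ y, E z y ∧ E y (unf^[1] v)}) (node_dom (by
      rintro z ⟨y, hz, hy⟩
      exact Dom_of_E (Dom_of_E (hU.dom (𝔐.dom hv)) hy) hz))
    ⟨isNode_unf _, nn, isNode_node _, fun z => E_node _ _⟩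
  refine ⟨p, fun z => ?_⟩
  obtain ⟨c₄, g₄, h₄, t, ht⟩ := 𝔐.grow c₃ z
  have hv₄ := h₄.2 _ _ (h₃.2 _ _ hv)
  rw [h₄.mem_iff hw ht]
  constructor
  · rw [(hP _ _ h₄.1).2.2.2]
    rintro ⟨y, hy, hyx⟩
    obtain ⟨c₅, g₅, h₅, m, w', hm, ⟨k1, k2⟩, -⟩ := 𝔐.name₂
      (show midReq ∈ Q from h (by simp [zcReqs])) ht hv₄ (Hom.id _)
      (Dom_of_E (𝔐.dom hv₄) hyx) ⟨hy, hyx⟩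
    exact ⟨m, (𝔐.mem_iff (h₅.2 _ _ ht) hm).2 k1, (h₅.mem_iff hv₄ hm).2 k2⟩
  · rintro ⟨m, hz, hx⟩
    obtain ⟨c₅, g₅, h₅, w', hw'⟩ := 𝔐.grow c₄ m
    exact h₅.1.emb.E_iff.1 (((hP _ _ (h₅.1.comp h₄.1)).2.2.2 _).2
      ⟨w', (𝔐.mem_iff (h₅.2 _ _ ht) hw').1 hz, (h₅.mem_iff hv₄ hw').1 hx⟩)

theorem axPower (h : zcReqs ⊆ Q) : AxPower 𝔐.M 𝔐.mem := by
  intro x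
  obtain ⟨c₁, g₁, h₁, v, hv, nv⟩ := 𝔐.grow_node h 𝔐.base x
  have := small_powerset v
  obtain ⟨c₃, g₃, h₃, p, w, hw, -, hP⟩ := 𝔐.name₁ (show powerReq ∈ Q from h (by simp [zcReqs]))
    hv (Hom.id _) (w := node {z : W | IsNode z ∧ ∀ y, E y z → E y v}) (node_dom (by
      rintro z ⟨hz, hzv⟩
      rw [hz.eq_node]
      exact node_dom fun y hy => Dom_of_E (𝔐.dom hv) (hzv y hy)))
    ⟨nv, isNode_node _, fun z => E_node _ _⟩
  refine ⟨p, fun z => ?_⟩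
  obtain ⟨c₄, g₄, h₄, t, ht, nt⟩ := 𝔐.grow_node h c₃ z
  obtain ⟨-, -, hP⟩ := hP _ _ h₄.1
  rw [h₄.mem_iff hw ht, hP]
  have hv := h₄.2 _ _ (h₃.2 _ _ hv)
  constructor
  · rintro ⟨-, hsub⟩ m hm
    obtain ⟨c₅, g₅, h₅, s, hs⟩ := 𝔐.grow c₄ m
    obtain ⟨s₀, hs₀, rfl⟩ := (h₅.1.emb.E_node nt).1 ((h₅.mem_iff ht hs).1 hm)
    exact (h₅.mem_iff hv hs).2 (h₅.1.emb.E_iff.2 (hsub _ hs₀))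
  · exact fun hsub => ⟨nt, fun y hy => E_of_subset h ht hv hsub hy⟩

theorem axInfinity (h : zcReqs ⊆ Q) : AxInfinity 𝔐.M 𝔐.mem := by
  obtain ⟨c₁, g₁, h₁, I, w, hw, rfl : w = om⟩ := 𝔐.name
    (show omReq ∈ Q from h (by simp [zcReqs])) (c := 𝔐.base) (x := Fin.elim0) (v := Fin.elim0)
    (fun i => Fin.elim0 i) (Hom.id _) om_dom rfl
  obtain ⟨c₂, g₂, h₂, e, w, he, rfl : w = vn 0⟩ := 𝔐.name
    (show zeroReq ∈ Q from h (by simp [zcReqs])) (c := c₁) (x := Fin.elim0) (v := Fin.elim0)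
    (fun i => Fin.elim0 i) (Hom.id _) (vn_dom 0) rfl
  refine ⟨I, ⟨e, ?_, fun z hz => ?_⟩, fun x hx => ?_⟩
  · rw [h₂.mem_iff hw he, h₂.1.emb.om, om, E_node]
    exact ⟨0, rfl⟩
  · obtain ⟨c₃, g₃, h₃, t, ht⟩ := 𝔐.grow c₂ z
    rw [h₃.mem_iff he ht, h₃.1.emb.vn, vn, E_node] at hz
    exact hz
  · obtain ⟨c₃, g₃, h₃, t, ht⟩ := 𝔐.grow c₁ x
    rw [h₃.mem_iff hw ht, h₃.1.emb.om, om, E_node] at hx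
    obtain ⟨n, rfl⟩ := hx
    obtain ⟨c₄, g₄, h₄, s, w, hs, ⟨m, hm, hm'⟩, -⟩ := 𝔐.name₁
      (show succReq ∈ Q from h (by simp [zcReqs])) ht (Hom.id _) (vn_dom (n + 1)) ⟨n, rfl, rfl⟩
    have hI := h₄.2 _ _ (h₃.2 _ _ hw)
    have ht' := h₄.2 _ _ ht
    rw [hm] at ht'
    subst hm'
    refine ⟨s, ?_, fun z => ?_⟩
    · rw [𝔐.mem_iff hs hI, h₃.1.emb.om, h₄.1.emb.om, om, E_node]
      exact ⟨_, rfl⟩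
    · obtain ⟨c₅, g₅, h₅, r, hr⟩ := 𝔐.grow c₄ z
      rw [h₅.mem_iff hs hr, h₅.mem_iff ht' hr, 𝔐.eq_iff hr (h₅.2 _ _ ht'), h₅.1.emb.vn,
        h₅.1.emb.vn, vn, E_node, or_comm]
      rfl

theorem axFound (h : zcReqs ⊆ Q) : AxFound 𝔐.M 𝔐.mem := by
  rintro x ⟨y, hy⟩
  obtain ⟨c₁, g₁, h₁, v, hv⟩ := 𝔐.grow 𝔐.base x
  obtain ⟨c₂, g₂, h₂, u, hu⟩ := 𝔐.grow c₁ y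
  have hv := h₂.2 _ _ hv
  obtain ⟨w, hw, hmin⟩ := E_wf.has_min {w | E w (g₂ v)} ⟨u, (𝔐.mem_iff hu hv).1 hy⟩
  obtain ⟨c₃, g₃, h₃, m, w', hm, -, hP⟩ := 𝔐.name₁ (show minReq ∈ Q from h (by simp [zcReqs])) hv
    (Hom.id _) (Dom_of_E (𝔐.dom hv) hw) ⟨hw, fun z hz => hmin z hz.2 hz.1⟩
  refine ⟨m, (h₃.mem_iff hv hm).2 ((hP _ _ (Hom.id _)).1), fun z hz => ?_⟩
  obtain ⟨c₄, g₄, h₄, t, ht⟩ := 𝔐.grow c₃ z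
  exact (hP _ _ h₄.1).2 t ⟨(h₄.mem_iff hm ht).1 hz.1,
    (𝔐.mem_iff ht (h₄.2 _ _ (h₃.2 _ _ hv))).1 hz.2⟩

theorem axComp (h : zcReqs ⊆ Q) : AxComp 𝔐.M 𝔐.mem := by
  intro n φ x p
  obtain ⟨c₁, g₁, h₁, v, hv⟩ := 𝔐.grow_fin 𝔐.base (n + 1) (Fin.cons x p)
  obtain ⟨c₂, g₂, h₂, nv⟩ := (hv 0).node h
  have hv := fun i => h₂.2 _ _ (hv i)
  set u : Fin (n + 1) → W := fun i => g₂ (v i)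
  let S : Set W := {z | E z (u 0) ∧ Psi φ (𝔐.F c₂) (Fin.cons z (Fin.tail u)) Fin.elim0}
  have : Small.{0} S := small_subset (s := {y | E y (u 0)}) fun y hy => hy.1
  obtain ⟨c₃, g₃, h₃, s, w, hw, hP⟩ :=
    𝔐.name (show compReq φ ∈ Q from h (Or.inl (Or.inr ⟨⟨n, φ⟩, rfl⟩)))
    hv (Hom.id _) (w := node S) (node_dom fun y hy => Dom_of_E (𝔐.dom (hv 0)) hy.1)
    ⟨nv, isNode_node _, fun z => E_node _ _⟩
  refine ⟨s, fun z => ?_⟩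
  obtain ⟨c₄, g₄, h₄, t, ht⟩ := 𝔐.grow c₃ z
  obtain ⟨-, -, hP⟩ := (compReq φ).persist h₄.1 (fun i => 𝔐.dom (h₃.2 _ _ (hv i))) (𝔐.dom hw) hP
  rw [h₄.mem_iff hw ht, hP]
  refine and_congr (𝔐.mem_iff ht (h₄.2 _ _ (h₃.2 _ _ (hv 0)))).symm ?_
  refine (𝔐.truth (fun k n φ => h (Or.inl (Or.inl ⟨⟨k, n, φ⟩, rfl⟩))) φ (fun i => ?_)
    (fun i => i.elim0)).symm
  induction i using Fin.cases with
  | zero => exact ht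
  | succ i => exact h₄.2 _ _ (h₃.2 _ _ (hv i.succ))

theorem axChoice (h : zcReqs ⊆ Q) : AxChoice 𝔐.M 𝔐.mem := by
  intro f hne hdis
  obtain ⟨c₁, g₁, h₁, v, hv, nv⟩ := 𝔐.grow_node h 𝔐.base f
  have hU := Hom.unf (𝔐.F c₁) 1
  set u := unf^[1] v with hu
  have hud : u ∈ Dom (𝔐.F c₁) := hU.dom (𝔐.dom hv)
  have ne : ∀ a, E a u → ∃ z, E z a := by
    intro a ha
    by_contra! hn
    obtain ⟨a₀, -, rfl⟩ := (hU.emb.E_node nv).1 ha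
    obtain ⟨c₂, g₂, h₂, x, w, hx, ⟨k1, -⟩, hP⟩ := 𝔐.name₁
      (show emptyReq ∈ Q from h (by simp [zcReqs])) hv hU (Dom_of_E hud ha)
      ⟨ha, isNode_unf _, hn⟩
    obtain ⟨b, hb⟩ := hne x ((h₂.mem_iff hv hx).2 k1)
    obtain ⟨c₃, g₃, h₃, t, ht⟩ := 𝔐.grow c₂ b
    exact (hP _ _ h₃.1).2.2 t ((h₃.mem_iff hx ht).1 hb)
  have dis : ∀ a b, E a u → E b u → ∀ z, E z a → E z b → a = b := by
    intro a b ha hb z hza hzb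
    by_contra hab
    obtain ⟨c₂, g₂, h₂, x, w, hx, ⟨k1, b', k2, k3, z', k4, k5⟩, -⟩ := 𝔐.name₁
      (show overlapReq₁ ∈ Q from h (by simp [zcReqs])) hv hU (Dom_of_E hud ha)
      ⟨ha, b, hb, hab, z, hza, hzb⟩
    have hv₂ := h₂.2 _ _ hv
    obtain ⟨c₃, g₃, h₃, y, w', hy, ⟨l1, l2, z'', l3, l4⟩, -⟩ := 𝔐.name₂
      (show overlapReq₂ ∈ Q from h (by simp [zcReqs])) hv₂ hx (Hom.id _)
      (Dom_of_E (𝔐.dom hv₂) k2) ⟨k2, k3, z', k4, k5⟩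
    have hx₃ := h₃.2 _ _ hx
    obtain ⟨c₄, g₄, h₄, z, w'', hz, ⟨m1, m2⟩, -⟩ := 𝔐.name₂
      (show interReq ∈ Q from h (by simp [zcReqs])) hx₃ hy (Hom.id _)
      (Dom_of_E (𝔐.dom hy) l4) ⟨l3, l4⟩
    exact l2 ((𝔐.eq_iff hx₃ hy).1 (hdis x y ((𝔐.mem_iff hx (h₂.2 _ _ hv)).2 k1)
      ((h₃.mem_iff hv₂ hy).2 l1) ⟨z, (h₄.mem_iff hx₃ hz).2 m1, (h₄.mem_iff hy hz).2 m2⟩))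
  have : Nonempty W := ⟨v⟩
  choose! e he using ne
  have hsm : Small.{0} (e '' {a | E a u}) := small_image _ _
  obtain ⟨c₂, g₂, h₂, s, w, hs, -, hP⟩ := 𝔐.name₁ (show choiceReq ∈ Q from h (by simp [zcReqs]))
    hv hU (w := node (e '' {a | E a u})) (node_dom (by
      rintro _ ⟨a, ha, rfl⟩
      exact Dom_of_E (Dom_of_E hud ha) (he a ha)))
    ⟨isNode_unf _, isNode_node _, fun a ha => ⟨e a, he a ha, (E_node _ _).2 ⟨a, ha, rfl⟩, by
      intro z hz hz'
      obtain ⟨b, hb, rfl⟩ := (E_node _ _).1 hz'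
      rw [dis a b ha hb _ hz (he b hb)]⟩⟩
  refine ⟨s, fun a ha => ?_⟩
  obtain ⟨c₃, g₃, h₃, t, ht⟩ := 𝔐.grow c₂ a
  obtain ⟨z, hzt, hzw, -⟩ := (hP _ _ h₃.1).2.2 t ((h₃.mem_iff (h₂.2 _ _ hv) ht).1 ha)
  have hs₃ := h₃.2 _ _ hs
  obtain ⟨c₄, g₄, h₄, y, w', hy, ⟨k1, k2⟩, -⟩ := 𝔐.name₂
    (show interReq ∈ Q from h (by simp [zcReqs])) ht hs₃ (Hom.id _)
    (Dom_of_E (𝔐.dom ht) hzt) ⟨hzt, hzw⟩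
  refine ⟨y, ⟨(h₄.mem_iff ht hy).2 k1, (h₄.mem_iff hs₃ hy).2 k2⟩, ?_⟩
  rintro y' ⟨ha', hs'⟩
  obtain ⟨c₅, g₅, h₅, r, hr⟩ := 𝔐.grow c₄ y'
  have h35 := h₅.comp h₄
  obtain ⟨z₁, -, -, hz₁⟩ := (hP _ _ (h35.comp h₃).1).2.2 (g₅ (g₄ t))
    ((𝔐.mem_iff (h35.2 _ _ ht) (h35.2 _ _ (h₃.2 _ _ (h₂.2 _ _ hv)))).1 ha)
  rw [𝔐.eq_iff hr (h₅.2 _ _ hy),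
    hz₁ r ((h35.mem_iff ht hr).1 ha') ((h35.mem_iff hs₃ hr).1 hs'),
    hz₁ _ (h₅.1.emb.E_iff.2 k1) (h₅.1.emb.E_iff.2 k2)]

theorem zcfnd (h : zcReqs ⊆ Q) : ZCfnd 𝔐.M 𝔐.mem :=
  ⟨axExt h, axPairing h, axUnion h, axPower h, axInfinity h, axComp h, axChoice h, axFound h⟩

end GM

section Combinatorial

variable {M : Type*} (mem : M → M → Prop)

/-- `p = {a}`. -/
def Sg (p a : M) : Prop := ∀ w, mem w p ↔ w = a

/-- `p = {a, b}`. -/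
def Up (p a b : M) : Prop := ∀ w, mem w p ↔ w = a ∨ w = b

def IsSg (p : M) : Prop := ∃ a, Sg mem p a

/-- `q = {t, x, y, z}`, where `x`, `y`, `z` are singletons and `t` is not a singleton. -/
def Code (q t x y z : M) : Prop :=
  (∀ w, mem w q ↔ w = t ∨ w = x ∨ w = y ∨ w = z) ∧ ¬ IsSg mem t ∧ IsSg mem x ∧ IsSg mem y ∧
    IsSg mem z

def Step (s s' : M) : Prop :=
  ∃ x y z s'' x' y' z', Code mem s s' x y z ∧ Code mem s' s'' x' y' z' ∧
    Sg mem x x' ∧ Sg mem y y' ∧ Sg mem z z'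

def Valid (t : M) : Prop := ∀ Z, mem t Z → ∃ s s', mem s Z ∧ ¬ mem s' Z ∧ Step mem s s'

/-- Some valid set codes the triple of `x`, `y`, `z`. -/
def Rel (x y z : M) : Prop := ∃ q t, Code mem q t x y z ∧ Valid mem q

/-- `p` is the ordered pair of `a` and `b`. -/
def Pr (p a b : M) : Prop := ∀ w, mem w p ↔ Sg mem w a ∨ Up mem w a b

def Trip (t i j k : M) : Prop := ∃ p, Pr mem p i j ∧ Pr mem t p k

/-- The set `V` of triples from `I` is finite in each line but meets all triples. -/
def Free (I U V : M) : Prop :=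
  (∀ i j, mem i I → mem j I → ∃ v, mem v U ∧ ∀ k t, mem k I → Trip mem t i j k → mem t V →
    mem k v) ∧
  ∀ i j k, mem i I → mem j I → mem k I → i ≠ j → k ≠ i → k ≠ j →
    ∃ t, mem t V ∧ (Trip mem t i j k ∨ Trip mem t j k i ∨ Trip mem t i k j)

/-- The fibres over `I` form a family without a global choice function, as witnessed by `o`, `U`,
`T`. -/
def BadAt (I o U T : M) : Prop :=
  (∀ i j k, mem i I → mem j I → mem k I → ∃ t, mem t T ∧ Trip mem t i j k) ∧
  (∀ i, mem i I → ∃ p, (∃ x, mem x p) ∧ ∀ x, mem x p ↔ Rel mem x o i) ∧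
  (∀ i j x y, mem i I → mem j I → Rel mem x o i → Rel mem y o j →
    ∃ v, mem v U ∧ ∀ k, mem k I → Rel mem x y k → mem k v) ∧
  (∀ i j k x y z, mem i I → mem j I → mem k I → i ≠ j → k ≠ i → k ≠ j →
    Rel mem x o i → Rel mem y o j → Rel mem z o k →
    Rel mem x y k ∨ Rel mem y z i ∨ Rel mem x z j) ∧
  ¬ ∃ V, Free mem I U V

def Bad : Prop := ∃ I o U T, BadAt mem I o U T

variable {mem}

theorem Sg.unique (h : AxExt M mem) {p q a : M} (hp : Sg mem p a) (hq : Sg mem q a) : p = q :=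
  h _ _ fun z => (hp z).trans (hq z).symm

theorem Up.unique (h : AxExt M mem) {p q a b : M} (hp : Up mem p a b) (hq : Up mem q a b) :
    p = q :=
  h _ _ fun z => (hp z).trans (hq z).symm

theorem Pr.unique (h : AxExt M mem) {p q a b : M} (hp : Pr mem p a b) (hq : Pr mem q a b) :
    p = q :=
  h _ _ fun z => (hp z).trans (hq z).symm

theorem Pr.inj (hp : AxPairing M mem) {p a b a' b' : M} (h : Pr mem p a b) (h' : Pr mem p a' b') :
    a = a' ∧ b = b' := by
  obtain ⟨s, hs⟩ := hp a a
  obtain ⟨u, hu⟩ := hp a b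
  obtain ⟨u', hu'⟩ := hp a' b'
  have hs : Sg mem s a := fun w => by rw [hs w, or_self]
  have h1 := (h' s).1 ((h s).2 (.inl hs))
  have h2 := (h' u).1 ((h u).2 (.inr hu))
  have h3 := (h u').1 ((h' u').2 (.inr hu'))
  have e1 := (hs a).2 rfl
  have e2 := (hu a).2 (.inl rfl)
  have e3 := (hu b).2 (.inr rfl)
  have e4 := (hu' a').2 (.inl rfl)
  have e5 := (hu' b').2 (.inr rfl)
  have ha : a = a' := by
    rcases h1 with h1 | h1
    · exact ((hs a').1 ((h1 a').2 rfl)).symm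
    · exact ((hs a').1 ((h1 a').2 (.inl rfl))).symm
  subst ha
  refine ⟨rfl, ?_⟩
  rcases h2 with h2 | h2 <;> rcases h3 with h3 | h3
  · rw [(h2 b).1 e3, (h3 b').1 e5]
  · have := (h2 b).1 e3
    have := (h3 b').1 e5
    grind
  · have := (h2 b).1 e3
    have := (h3 b').1 e5
    grind
  · have := (h2 b).1 e3
    have := (h3 b').1 e5
    have := (hu b').1 ((h2 b').2 (.inr rfl))
    grind

theorem Trip.inj (hp : AxPairing M mem) {t i j k i' j' k' : M} (h : Trip mem t i j k)
    (h' : Trip mem t i' j' k') : i = i' ∧ j = j' ∧ k = k' := by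
  obtain ⟨p, h1, h2⟩ := h
  obtain ⟨p', h3, h4⟩ := h'
  obtain ⟨rfl, rfl⟩ := h2.inj hp h4
  obtain ⟨rfl, rfl⟩ := h1.inj hp h3
  simp

theorem Trip.unique (h : AxExt M mem) {t t' i j k : M} (ht : Trip mem t i j k)
    (ht' : Trip mem t' i j k) : t = t' := by
  obtain ⟨p, h1, h2⟩ := ht
  obtain ⟨p', h3, h4⟩ := ht'
  obtain rfl := h1.unique h h3
  exact h2.unique h h4

theorem Code.unique {q t x y z t' x' y' z' : M} (h : Code mem q t x y z)
    (h' : Code mem q t' x' y' z') :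
    t = t' ∧ ∀ w, (w = x ∨ w = y ∨ w = z) ↔ (w = x' ∨ w = y' ∨ w = z') := by
  obtain ⟨h1, h2, h3, h4, h5⟩ := h
  obtain ⟨k1, k2, k3, k4, k5⟩ := h'
  have ht := (k1 t).1 ((h1 t).2 (.inl rfl))
  obtain rfl : t = t' := by grind
  refine ⟨rfl, fun w => ?_⟩
  have hw := (h1 w).symm.trans (k1 w)
  grind

theorem Step.unique (h : AxExt M mem) {s r s' : M} (hs : Step mem s s') (hr : Step mem r s') :
    s = r := by
  obtain ⟨x, y, z, s'', x', y', z', h1, h2, h3, h4, h5⟩ := hs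
  obtain ⟨u, v, w, r'', u', v', w', k1, k2, k3, k4, k5⟩ := hr
  obtain ⟨-, he⟩ := h2.unique k2
  refine h _ _ fun a => ?_
  rw [h1.1 a, k1.1 a]
  have U : ∀ {p q b c}, Sg mem p b → Sg mem q c → b = c → p = q := by
    rintro p q b _ hp hq rfl
    exact hp.unique h hq
  have u1 := U h3 k3
  have u2 := U h3 k4
  have u3 := U h3 k5
  have u4 := U h4 k3
  have u5 := U h4 k4
  have u6 := U h4 k5
  have u7 := U h5 k3
  have u8 := U h5 k4
  have u9 := U h5 k5
  refine or_congr Iff.rfl ⟨?_, ?_⟩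
  · have hx := (he x').1 (by simp)
    have hy := (he y').1 (by simp)
    have hz := (he z').1 (by simp)
    grind
  · have hx := (he u').2 (by simp)
    have hy := (he v').2 (by simp)
    have hz := (he w').2 (by simp)
    grind

theorem Code.mem_self {q t x y z : M} (h : Code mem q t x y z) : mem t q := (h.1 t).2 (.inl rfl)

theorem Code.not_isSg {q t x y z : M} (h : Code mem q t x y z) : ¬ IsSg mem q := by
  rintro ⟨a, ha⟩
  obtain rfl := (ha t).1 h.mem_self
  obtain rfl := (ha x).1 ((h.1 x).2 (by simp))
  exact h.2.1 h.2.2.1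

/-- Global Choice rules out the bad configuration, provided that the relevant instance of
Comprehension holds. -/
theorem not_badAt (hE : AxExt M mem) (hP : AxPairing M mem) {j : M → M} (hj : AxGC M mem j)
    {I o U T : M} (hC : ∃ V, ∀ t, mem t V ↔ mem t T ∧ ∃ i i' k p p', mem i I ∧ mem i' I ∧ mem k I ∧
      Trip mem t i i' k ∧ (∀ x, mem x p ↔ Rel mem x o i) ∧ (∀ x, mem x p' ↔ Rel mem x o i') ∧
      Rel mem (j p) (j p') k) :
    ¬ BadAt mem I o U T := by
  rintro ⟨h0, h1, h2, h3, h4⟩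
  obtain ⟨V, hV⟩ := hC
  choose! P hPne hPmem using h1
  have hR : ∀ i, mem i I → Rel mem (j (P i)) o i := fun i hi =>
    (hPmem i hi _).1 (hj _ (hPne i hi))
  have hVR : ∀ i i' k t, mem i I → mem i' I → mem k I → Trip mem t i i' k →
      (mem t V ↔ mem t T ∧ Rel mem (j (P i)) (j (P i')) k) := by
    intro i i' k t hi hi' hk ht
    rw [hV]
    refine and_congr Iff.rfl ⟨?_, fun h =>
      ⟨i, i', k, P i, P i', hi, hi', hk, ht, hPmem i hi, hPmem i' hi', h⟩⟩
    rintro ⟨l, l', m, p, p', hl, hl', hm, ht', hp, hp', h⟩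
    obtain ⟨rfl, rfl, rfl⟩ := ht.inj hP ht'
    rwa [hE (P i) p fun x => (hPmem i hi x).trans (hp x).symm,
      hE (P i') p' fun x => (hPmem i' hi' x).trans (hp' x).symm]
  refine h4 ⟨V, fun i i' hi hi' => ?_, fun i i' k hi hi' hk n1 n2 n3 => ?_⟩
  · obtain ⟨v, hv, h⟩ := h2 i i' _ _ hi hi' (hR i hi) (hR i' hi')
    exact ⟨v, hv, fun k t hk ht htV => h k hk ((hVR i i' k t hi hi' hk ht).1 htV).2⟩
  · rcases h3 i i' k _ _ _ hi hi' hk n1 n2 n3 (hR i hi) (hR i' hi') (hR k hk) with h | h | h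
    · obtain ⟨t, hT, ht⟩ := h0 i i' k hi hi' hk
      exact ⟨t, (hVR _ _ _ t hi hi' hk ht).2 ⟨hT, h⟩, .inl ht⟩
    · obtain ⟨t, hT, ht⟩ := h0 i' k i hi' hk hi
      exact ⟨t, (hVR _ _ _ t hi' hk hi ht).2 ⟨hT, h⟩, .inr (.inl ht)⟩
    · obtain ⟨t, hT, ht⟩ := h0 i k i' hi hk hi'
      exact ⟨t, (hVR _ _ _ t hi hk hi' ht).2 ⟨hT, h⟩, .inr (.inr ht)⟩

end Combinatorial

open W

theorem ut_dom {n : ℕ} {a : Atom} : ut n a ∈ Dom F ↔ a ∈ Al F := Sup_ut (Al_legs F)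

theorem sh_leg {a b c : Atom} (s : Idx → Vec) (i : Fin 3) :
    (![a, b, c] i).sh s = ![a.sh s, b.sh s, c.sh s] i := by
  fin_cases i <;> rfl

theorem Tri.mem_legs {τ a b c : Atom} (h : Tri τ a b c) (i : Fin 3) : ![a, b, c] i ∈ τ.legs := by
  rw [h.legs]
  fin_cases i <;> simp

theorem Tri.legs_leg {τ a b c : Atom} (h : Tri τ a b c) (i : Fin 3) :
    (![a, b, c] i).legs = {![a, b, c] i} := by
  fin_cases i
  exacts [h.legs_a, h.legs_b, h.legs_c]

theorem Tri.unique {τ a b c a' b' c' : Atom} (h : Tri τ a b c) (h' : Tri τ a' b' c') :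
    a = a' ∧ b = b' ∧ c = c' := by
  cases h <;> cases h' <;> simp

/-- `w` is the part of `q` given by the leg `i`. -/
def legReq (i : Fin 3) : Req := req₁ (fun _ q w => ∃ n τ a b c, Tri τ a b c ∧ q = ut (n + 1) τ ∧
    w = ut n (![a, b, c] i)) <| by
  rintro F G g ⟨m, s, -, -, rfl⟩ q w - - ⟨n, τ, a, b, c, h, rfl, rfl⟩
  refine ⟨m + n, _, _, _, _, h.sh s, mor_ut _ _ _ _, ?_⟩
  rw [mor_ut, sh_leg]

def downReq : Req := req₁ (fun _ q w => ∃ n a, q = ut (n + 1) a ∧ w = ut n a) <| by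
  rintro F G g ⟨m, s, -, -, rfl⟩ q w - - ⟨n, a, rfl, rfl⟩
  exact ⟨m + n, a.sh s, mor_ut _ _ _ _, mor_ut _ _ _ _⟩

def upReq : Req := req₁ (fun _ q w => ∃ n a, q = ut n a ∧ w = ut (n + 1) a) <| by
  rintro F G g ⟨m, s, -, -, rfl⟩ q w - - ⟨n, a, rfl, rfl⟩
  exact ⟨m + n, a.sh s, mor_ut _ _ _ _, mor_ut _ _ _ _⟩

/-- `w` is a member of `Z` one of whose members is not in `Z`. -/
def exitReq : Req := req₁ (fun _ Z w => ∃ n τ a b c, Tri τ a b c ∧ w = ut (n + 1) τ ∧ E w Z ∧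
    ¬ E (ut n τ) Z) <| by
  rintro F G g ⟨m, s, h1, h2, rfl⟩ Z w - - ⟨n, τ, a, b, c, h, rfl, h3, h4⟩
  refine ⟨m + n, _, _, _, _, h.sh s, mor_ut _ _ _ _, (mor_emb m s).E_iff.2 h3, ?_⟩
  rwa [← mor_ut, (mor_emb m s).E_iff]

def triReq : Req := req₃ (fun _ x y z w => ∃ n τ a b c, Tri τ a b c ∧ x = ut n a ∧ y = ut n b ∧
    z = ut n c ∧ w = ut (n + 1) τ) <| by
  rintro F G g ⟨m, s, h1, h2, rfl⟩ x y z w - - - - ⟨n, τ, a, b, c, h, rfl, rfl, rfl, rfl⟩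
  exact ⟨m + n, _, _, _, _, h.sh s, mor_ut _ _ _ _, mor_ut _ _ _ _, mor_ut _ _ _ _, mor_ut _ _ _ _⟩

/-- `v` is an unfolding of a link or of an edge. -/
def Gen (v : W) : Prop := ∃ n τ a b c, Tri τ a b c ∧ v = ut n τ

/-- `v` is an unfolding of an atom which is neither a link nor an edge. -/
def Simp (v : W) : Prop := ∃ n a, a.legs = {a} ∧ v = ut n a

theorem Gen.mor {v : W} (h : Gen v) (m : ℕ) (s : Idx → Vec) : Gen (mor m s v) := by
  obtain ⟨n, τ, a, b, c, h, rfl⟩ := h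
  exact ⟨_, _, _, _, _, h.sh s, mor_ut _ _ _ _⟩

theorem Simp.mor {v : W} (h : Simp v) (m : ℕ) (s : Idx → Vec) : Simp (mor m s v) := by
  obtain ⟨n, a, h, rfl⟩ := h
  exact ⟨_, a.sh s, by rw [Atom.legs_sh, h, Set.image_singleton], mor_ut _ _ _ _⟩

theorem Gen.of_mor {v : W} {m : ℕ} {s : Idx → Vec} (h : Gen (ZCForcing.mor m s v)) : Gen v := by
  obtain ⟨n, τ, a, b, c, h, e⟩ := h
  have e₁ : unf^[m] v = ut n (τ.sh s) := by
    rw [← rho_ut, ← e, ZCForcing.mor, Function.comp_apply, ← unf_iterate_rho, rho_self]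
  rcases le_or_gt m n with hmn | hmn
  · obtain ⟨k, rfl⟩ := Nat.exists_eq_add_of_le hmn
    rw [ut, Function.iterate_add_apply] at e₁
    exact ⟨k, _, _, _, _, h.sh s, (unf_emb.iterate m).inj e₁⟩
  · obtain ⟨k, rfl⟩ := Nat.exists_eq_add_of_lt hmn
    rw [ut, add_assoc, Function.iterate_add_apply] at e₁
    have := (unf_emb.iterate n).inj e₁
    rw [Function.iterate_succ_apply'] at this
    exact absurd this (unf_ne_at _ _)

theorem simp_or_gen (a : Atom) : Simp (atm a) ∨ Gen (atm a) := by
  rcases a.tri_or with ⟨b, c, d, h⟩ | h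
  · exact .inr ⟨0, a, b, c, d, h, rfl⟩
  · exact .inl ⟨0, a, h, rfl⟩

/-- `Z` contains `q` and refutes its validity. -/
def refuteReq : Req := req₁ (fun _ q Z => E q Z ∧ IsNode Z ∧ (∀ y, E y Z → ¬ Gen y) ∧
    ∀ y, E y Z → Simp y ∨ ∀ y', E y' y → ¬ Gen y' → E y' Z) <| by
  rintro F G g ⟨m, s, -, -, rfl⟩ q Z - - ⟨h1, h2, h3, h4⟩
  have hE := mor_emb m s
  refine ⟨hE.E_iff.2 h1, hE.isNode h2, fun y hy => ?_, fun y hy => ?_⟩ <;>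
    obtain ⟨y, hy₀, rfl⟩ := (hE.E_node h2).1 hy
  · exact fun h => h3 y hy₀ h.of_mor
  · rcases h4 y hy₀ with h | h
    · exact .inl (h.mor m s)
    rcases y.cases with ⟨a, rfl⟩ | ⟨S, hS, rfl⟩
    · exact (simp_or_gen a).imp (fun h => h.mor m s) fun h => absurd h (h3 _ hy₀)
    · refine .inr fun y' hy' hn => ?_
      obtain ⟨y', hy₁, rfl⟩ := (hE.E_node (isNode_node S)).1 hy'
      exact hE.E_iff.2 (h y' hy₁ fun h => hn (h.mor m s))

/-- `y` is in the transitive closure of `{x}`. -/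
def Reach : W → W → Prop := Relation.ReflTransGen fun y' y => E y' y

instance small_reach (x : W) : Small.{0} {y | Reach y x} := by
  induction x using E_wf.induction with
  | _ x ih =>
    have (z : {z | E z x}) : Small.{0} {y | Reach y z.1} := ih z.1 z.2
    refine small_subset (s := insert x (⋃ z : {z | E z x}, {y | Reach y z.1})) fun y hy => ?_
    rcases Relation.ReflTransGen.cases_tail hy with h | ⟨z, h, h'⟩
    · exact .inl h.symm
    · exact .inr (Set.mem_iUnion.2 ⟨⟨z, h'⟩, h⟩)

def codeReqs : Set Req :=
  Set.range legReq ∪ {downReq, upReq, exitReq, triReq, refuteReq}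

namespace GM

variable {Q : Set Req} {𝔐 : GM Q} {c c' : 𝔐.Stage} {m : ℕ} {s : Idx → Vec}

theorem Ext.val (hg : 𝔐.Ext c c' (mor m s)) {x : 𝔐.M} {n : ℕ} {a : Atom} (h : 𝔐.At c x (ut n a)) :
    𝔐.At c' x (ut (m + n) (a.sh s)) := by
  have := hg.2 _ _ h
  rwa [mor_ut] at this

theorem Ext.val_succ (hg : 𝔐.Ext c c' (mor m s)) {x : 𝔐.M} {n : ℕ} {a : Atom}
    (h : 𝔐.At c x (ut (n + 1) a)) : 𝔐.At c' x (ut (m + n + 1) (a.sh s)) :=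
  hg.val h

theorem mem_iff_range {ι : Type*} {q : 𝔐.M} {v : W} (hq : 𝔐.At c q v) (nv : IsNode v) {x : ι → 𝔐.M}
    {u : ι → W} (hx : ∀ i, 𝔐.At c (x i) (u i)) (hE : ∀ y, E y v ↔ ∃ i, y = u i) (w : 𝔐.M) :
    𝔐.mem w q ↔ ∃ i, w = x i := by
  obtain ⟨c', g, hg, t, ht⟩ := 𝔐.grow c w
  rw [hg.mem_iff hq ht, hg.1.emb.E_node nv]
  constructor
  · rintro ⟨y, hy, rfl⟩
    obtain ⟨i, rfl⟩ := (hE y).1 hy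
    exact ⟨i, (𝔐.eq_iff ht (hg.2 _ _ (hx i))).2 rfl⟩
  · rintro ⟨i, rfl⟩
    exact ⟨u i, (hE _).2 ⟨i, rfl⟩, ((𝔐.eq_iff ht (hg.2 _ _ (hx i))).1 rfl).symm⟩

theorem sg_of_vals {x x' : 𝔐.M} {n : ℕ} {a : Atom} (ha : a.legs = {a})
    (hx : 𝔐.At c x (ut (n + 1) a))
    (hx' : 𝔐.At c x' (ut n a)) : Sg 𝔐.mem x x' := by
  intro w
  rw [mem_iff_range (ι := Unit) hx (isNode_ut_succ _ _) (fun _ => hx') (fun y => by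
    rw [E_ut_succ, ha]; simp)]
  simp

/-- The index of a value can be made positive. -/
theorem val_succ (hz : zcReqs ⊆ Q) {q : 𝔐.M} {n : ℕ} {a : Atom} (hq : 𝔐.At c q (ut n a)) :
    ∃ c' m s, 𝔐.Ext c c' (mor m s) ∧ ∃ k, m + n = k + 1 := by
  obtain ⟨c', g, hg, hn⟩ := hq.node hz
  obtain ⟨m, s, -, -, rfl⟩ := id hg.1
  refine ⟨c', m, s, hg, ?_⟩
  rw [mor_ut] at hn
  cases h : m + n with
  | zero => rw [h] at hn; exact absurd rfl (hn _)
  | succ k => exact ⟨k, rfl⟩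

theorem name_down (hc : codeReqs ⊆ Q) {q : 𝔐.M} {n : ℕ} {a : Atom} (hq : 𝔐.At c q (ut (n + 1) a)) :
    ∃ c' m s, 𝔐.Ext c c' (mor m s) ∧ ∃ x, 𝔐.At c' x (ut (m + n) (a.sh s)) := by
  obtain ⟨c', g, hg, x, w, hx, ⟨k, b, e, rfl⟩, -⟩ := 𝔐.name₁
    (show downReq ∈ Q from hc (by simp [codeReqs])) hq (Hom.id _) (w := ut n a)
    (ut_dom.2 (ut_dom.1 (𝔐.dom hq))) ⟨n, a, rfl, rfl⟩
  obtain ⟨m, s, -, -, rfl⟩ := id hg.1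
  rw [mor_ut, ut_inj] at e
  obtain ⟨e, rfl⟩ := e
  obtain rfl : m + n = k := by omega
  exact ⟨c', m, s, hg, x, hx⟩

theorem name_up (hc : codeReqs ⊆ Q) {q : 𝔐.M} {n : ℕ} {a : Atom} (hq : 𝔐.At c q (ut n a)) :
    ∃ c' m s, 𝔐.Ext c c' (mor m s) ∧ ∃ x, 𝔐.At c' x (ut (m + n + 1) (a.sh s)) := by
  obtain ⟨c', g, hg, x, w, hx, ⟨k, b, e, rfl⟩, -⟩ := 𝔐.name₁
    (show upReq ∈ Q from hc (by simp [codeReqs])) hq (Hom.id _) (w := ut (n + 1) a)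
    (ut_dom.2 (ut_dom.1 (𝔐.dom hq))) ⟨n, a, rfl, rfl⟩
  obtain ⟨m, s, -, -, rfl⟩ := id hg.1
  rw [mor_ut, ut_inj] at e
  obtain ⟨rfl, rfl⟩ := e
  exact ⟨c', m, s, hg, x, hx⟩

theorem name_leg (hc : codeReqs ⊆ Q)
    (i : Fin 3) {q : 𝔐.M} {n : ℕ} {τ a b d : Atom} (h : Tri τ a b d)
    (hq : 𝔐.At c q (ut (n + 1) τ)) :
    ∃ c' m s, 𝔐.Ext c c' (mor m s) ∧ ∃ x, 𝔐.At c' x (ut (m + n) ((![a, b, d] i).sh s)) := by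
  obtain ⟨c', g, hg, x, w, hx, ⟨k, τ', a', b', d', h', e, rfl⟩, -⟩ := 𝔐.name₁
    (show legReq i ∈ Q from hc (.inl ⟨i, rfl⟩)) hq (Hom.id _) (w := ut n (![a, b, d] i))
    (ut_dom.2 (Al_legs _ _ (ut_dom.1 (𝔐.dom hq)) (h.mem_legs i))) ⟨n, τ, a, b, d, h, rfl, rfl⟩
  obtain ⟨m, s, -, -, rfl⟩ := id hg.1
  rw [mor_ut, ut_inj] at e
  obtain ⟨e, rfl⟩ := e
  obtain rfl : m + n = k := by omega
  obtain ⟨rfl, rfl, rfl⟩ := h'.unique (h.sh s)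
  exact ⟨c', m, s, hg, x, by rwa [sh_leg]⟩

theorem Ext.mor_comp {c'' : 𝔐.Stage} {m' : ℕ} {s' : Idx → Vec} (h' : 𝔐.Ext c' c'' (mor m' s'))
    (h : 𝔐.Ext c c' (mor m s)) : 𝔐.Ext c c'' (mor (m' + m) (s + s')) := by
  have := h'.comp h
  rwa [show mor m' s' ∘ mor m s = _ from funext fun x => mor_mor _ _ _ _ x] at this

theorem name_legs (hc : codeReqs ⊆ Q) {q : 𝔐.M} {n : ℕ} {τ a b d : Atom} (h : Tri τ a b d)
    (hq : 𝔐.At c q (ut (n + 1) τ)) :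
    ∃ c' m s, 𝔐.Ext c c' (mor m s) ∧
      ∃ x : Fin 3 → 𝔐.M, ∀ i, 𝔐.At c' (x i) (ut (m + n) ((![a, b, d] i).sh s)) := by
  obtain ⟨c₀, m₀, s₀, h₀, x, hx⟩ := name_leg hc 0 h hq
  obtain ⟨c₁, m₁, s₁, h₁, y, hy⟩ := name_leg hc 1 (h.sh s₀) (h₀.val_succ hq)
  obtain ⟨c₂, m₂, s₂, h₂, z, hz⟩ := name_leg hc 2 ((h.sh s₀).sh s₁) (h₁.val_succ (h₀.val_succ hq))
  refine ⟨c₂, _, _, h₂.mor_comp (h₁.mor_comp h₀), ![x, y, z], fun i => ?_⟩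
  simp only [← Atom.sh_sh, add_assoc]
  fin_cases i
  exacts [h₂.val (h₁.val hx), h₂.val hy, hz]

theorem isSg_of_val (hz : zcReqs ⊆ Q) (hc : codeReqs ⊆ Q)
    {x : 𝔐.M} {n : ℕ} {a : Atom} (ha : a.legs = {a}) (hx : 𝔐.At c x (ut n a)) :
    IsSg 𝔐.mem x := by
  obtain ⟨c₁, m₁, s₁, h₁, k, e⟩ := val_succ hz hx
  have hx := h₁.val hx
  rw [e] at hx
  obtain ⟨c₂, m₂, s₂, h₂, y, hy⟩ := name_down hc hx
  exact ⟨y, sg_of_vals (by rw [Atom.legs_sh, Atom.legs_sh, ha, Set.image_singleton,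
    Set.image_singleton]) (h₂.val_succ hx) hy⟩

theorem not_isSg_of_val (hz : zcReqs ⊆ Q) (hc : codeReqs ⊆ Q)
    {x : 𝔐.M} {n : ℕ} {τ a b d : Atom} (h : Tri τ a b d)
    (hx : 𝔐.At c x (ut n τ)) : ¬ IsSg 𝔐.mem x := by
  rintro ⟨y, hy⟩
  obtain ⟨c₁, m₁, s₁, h₁, k, e⟩ := val_succ hz hx
  have hx := h₁.val hx
  have h := h.sh s₁
  rw [e] at hx
  obtain ⟨c₂, m₂, s₂, h₂, u, hu⟩ := name_down hc hx
  have hx := h₂.val_succ hx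
  have h := h.sh s₂
  obtain ⟨c₃, m₃, s₃, h₃, v, hv⟩ := name_leg hc 0 h hx
  have hx := h₃.val_succ hx
  have hu := h₃.val hu
  have h := h.sh s₃
  have e1 := (hy u).1 ((𝔐.mem_iff hu hx).2 (E_ut_succ.2 ⟨_, Atom.mem_legs _, rfl⟩))
  have e2 := (hy v).1 ((𝔐.mem_iff hv hx).2 (E_ut_succ.2 ⟨_, h.mem_legs 0, rfl⟩))
  have := (𝔐.eq_iff hv hu).1 (e2.trans e1.symm)
  exact h.ne_a (ut_inj.1 this).2

theorem code_of_vals (hz : zcReqs ⊆ Q) (hc : codeReqs ⊆ Q)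
    {q x₀ : 𝔐.M} {x : Fin 3 → 𝔐.M} {n : ℕ} {τ a b d : Atom} (h : Tri τ a b d)
    (hq : 𝔐.At c q (ut (n + 1) τ)) (hx₀ : 𝔐.At c x₀ (ut n τ))
    (hx : ∀ i, 𝔐.At c (x i) (ut n (![a, b, d] i))) : Code 𝔐.mem q x₀ (x 0) (x 1) (x 2) := by
  have hs := fun i => isSg_of_val hz hc (h.legs_leg i) (hx i)
  refine ⟨fun w => ?_, not_isSg_of_val hz hc h hx₀, hs 0, hs 1, hs 2⟩
  rw [mem_iff_range (ι := Option (Fin 3)) (x := fun i => i.elim x₀ x)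
    (u := fun i => ut n (i.elim τ ![a, b, d])) hq (isNode_ut_succ _ _)
    (fun i => by cases i; exacts [hx₀, hx _]) (fun y => by
      rw [E_ut_succ, h.legs]
      simp [Option.exists, Fin.exists_fin_succ])]
  simp [Option.exists, Fin.exists_fin_succ]

theorem step_of_vals (hz : zcReqs ⊆ Q) (hc : codeReqs ⊆ Q)
    {q x₀ : 𝔐.M} {n : ℕ} {τ a b d : Atom} (h : Tri τ a b d)
    (hq : 𝔐.At c q (ut (n + 1) τ)) (hx₀ : 𝔐.At c x₀ (ut n τ)) : Step 𝔐.mem q x₀ := by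
  obtain ⟨c₁, m₁, s₁, h₁, x, hx⟩ := name_legs hc h hq
  have hC := code_of_vals hz hc (h.sh s₁) (h₁.val_succ hq) (h₁.val hx₀)
    (by simpa only [sh_leg] using hx)
  obtain ⟨c₂, m₂, s₂, h₂, k, e⟩ := val_succ hz (h₁.val hx₀)
  have hx := fun i => h₂.val (hx i)
  have hx₀ := h₂.val (h₁.val hx₀)
  have h := (h.sh s₁).sh s₂
  rw [e] at hx₀
  simp only [e, sh_leg] at hx
  obtain ⟨c₃, m₃, s₃, h₃, y₀, hy₀⟩ := name_down hc hx₀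
  have hx := fun i => h₃.val_succ (hx i)
  have hx₀ := h₃.val_succ hx₀
  have h := h.sh s₃
  simp only [sh_leg] at hx
  obtain ⟨c₄, m₄, s₄, h₄, y, hy⟩ := name_legs hc h hx₀
  have hx := fun i => h₄.val_succ (hx i)
  have h := h.sh s₄
  simp only [sh_leg] at hx hy
  have hC' := code_of_vals hz hc h (h₄.val_succ hx₀) (h₄.val hy₀) hy
  have hs := fun i => sg_of_vals (h.legs_leg i) (hx i) (hy i)
  exact ⟨_, _, _, _, _, _, _, hC, hC', hs 0, hs 1, hs 2⟩

theorem valid_of_val (hz : zcReqs ⊆ Q) (hc : codeReqs ⊆ Q)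
    {q : 𝔐.M} {n : ℕ} {τ a b d : Atom} (h : Tri τ a b d)
    (hq : 𝔐.At c q (ut n τ)) : Valid 𝔐.mem q := by
  intro Z hZ
  obtain ⟨c₁, g₁, h₁, z, hz₁, nz⟩ := 𝔐.grow_node hz c Z
  obtain ⟨m₁, s₁, -, -, rfl⟩ := id h₁.1
  have hq := h₁.val hq
  have h := h.sh s₁
  rw [𝔐.mem_iff hq hz₁] at hZ
  have hU : ∃ k, E (ut k (τ.sh s₁)) (unf z) := ⟨_, by
    rw [← unf_ut]
    exact unf_emb.E_iff.2 hZ⟩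
  classical
  obtain ⟨k, hk⟩ : ∃ k, Nat.find hU = k + 1 := by
    refine Nat.exists_eq_succ_of_ne_zero fun h0 => ?_
    have := Nat.find_spec hU
    rw [h0, unf_emb.E_node nz] at this
    obtain ⟨y, -, hy⟩ := this
    exact unf_ne_at _ _ hy
  have hk1 := Nat.find_spec hU
  have hk2 := Nat.find_min hU (show k < _ by omega)
  rw [hk] at hk1
  obtain ⟨c₂, g₂, h₂, r, w, hr, ⟨l, σ, a', b', d', h', rfl, e1, e2⟩, -⟩ := 𝔐.name₁
    (show exitReq ∈ Q from hc (by simp [codeReqs])) hz₁ (Hom.unf _ 1)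
    (ut_dom.2 (ut_dom.1 (𝔐.dom hq))) ⟨k, _, _, _, _, h, rfl, hk1, hk2⟩
  have hz₂ := h₂.2 _ _ hz₁
  obtain ⟨c₃, m₃, s₃, h₃, r', hr'⟩ := name_down hc hr
  refine ⟨r, r', (𝔐.mem_iff hr hz₂).2 e1, ?_, step_of_vals hz hc (h'.sh s₃) (h₃.val_succ hr) hr'⟩
  rwa [𝔐.mem_iff hr' (h₃.2 _ _ hz₂), ← mor_ut, h₃.1.emb.E_iff]

theorem rel_of_vals (hz : zcReqs ⊆ Q) (hc : codeReqs ⊆ Q)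
    {x y z : 𝔐.M} {n : ℕ} {τ a b d : Atom} (h : Tri τ a b d) (hτ : τ ∈ Al (𝔐.F c))
    (hx : 𝔐.At c x (ut n a)) (hy : 𝔐.At c y (ut n b)) (hz' : 𝔐.At c z (ut n d)) :
    Rel 𝔐.mem x y z := by
  obtain ⟨c₁, g₁, h₁, q, w, hq, k, τ', a', b', d', h', e1, e2, e3, rfl⟩ := 𝔐.name₃
    (show triReq ∈ Q from hc (by simp [codeReqs])) hx hy hz' (Hom.id _) (ut_dom.2 hτ)
    ⟨n, τ, a, b, d, h, rfl, rfl, rfl, rfl⟩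
  have hx := h₁.2 _ _ hx
  have hy := h₁.2 _ _ hy
  have hz' := h₁.2 _ _ hz'
  rw [e1] at hx
  rw [e2] at hy
  rw [e3] at hz'
  obtain ⟨c₂, m₂, s₂, h₂, q', hq'⟩ := name_down hc hq
  refine ⟨q, q', ?_, valid_of_val hz hc h' hq⟩
  refine code_of_vals (x := ![x, y, z]) hz hc (h'.sh s₂) (h₂.val_succ hq) hq' fun i => ?_
  fin_cases i
  exacts [h₂.val hx, h₂.val hy, h₂.val hz']

theorem gen_of_valid (hz : zcReqs ⊆ Q) (hc : codeReqs ⊆ Q) {q : 𝔐.M} {v : W} (hV : Valid 𝔐.mem q)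
    (hq : 𝔐.At c q v) : Gen v := by
  by_contra hv
  have hR : ∀ y, Reach y v → y ∈ Dom (𝔐.F c) := by
    intro y hy
    induction hy using Relation.ReflTransGen.head_induction_on with
    | refl => exact 𝔐.dom hq
    | head h _ ih => exact Dom_of_E ih h
  have : Small.{0} {y | ¬ Gen y ∧ Reach y v} :=
    small_subset (s := {y | Reach y v}) fun y hy => hy.2
  obtain ⟨c₁, g₁, h₁, Z, zv, hZ, -, hP⟩ := 𝔐.name₁
    (show refuteReq ∈ Q from hc (by simp [codeReqs])) hq (Hom.id _)
    (w := node {y | ¬ Gen y ∧ Reach y v}) (node_dom fun y hy => hR y hy.2)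
    (by
      refine ⟨(E_node _ _).2 ⟨hv, .refl⟩, isNode_node _, fun y hy => ((E_node _ _).1 hy).1, ?_⟩
      intro y hy
      refine .inr fun y' hy' hn => (E_node _ _).2 ⟨hn, .head hy' ((E_node _ _).1 hy).2⟩)
  obtain ⟨r, r', hrZ, hrZ', hst⟩ := hV Z
    ((𝔐.mem_iff (h₁.2 _ _ hq) hZ).2 (hP _ _ (Hom.id _)).1)
  obtain ⟨c₂, g₂, h₂, w, hw⟩ := 𝔐.grow c₁ r
  obtain ⟨c₃, g₃, h₃, w', hw'⟩ := 𝔐.grow c₂ r'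
  have hw := h₃.2 _ _ hw
  have hZ := h₃.2 _ _ (h₂.2 _ _ hZ)
  obtain ⟨-, -, e3, e4⟩ := hP _ _ (h₃.1.comp h₂.1)
  rw [𝔐.mem_iff hw hZ] at hrZ
  rw [𝔐.mem_iff hw' hZ] at hrZ'
  have hC' : ∃ x y z, Code 𝔐.mem r r' x y z := by
    obtain ⟨x, y, z, s'', x', y', z', h, -⟩ := hst
    exact ⟨x, y, z, h⟩
  obtain ⟨x', y', z', hC'⟩ := hC'
  rcases e4 _ hrZ with ⟨n, a, ha, e⟩ | h
  · rw [e] at hw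
    exact hC'.not_isSg (isSg_of_val hz hc ha hw)
  · have hg : Gen w' := by
      by_contra hn
      exact hrZ' (h _ ((𝔐.mem_iff hw' hw).1 hC'.mem_self) hn)
    obtain ⟨n, τ, a, b, d, ht, rfl⟩ := hg
    obtain ⟨c₄, m₄, s₄, h₄, u, hu⟩ := name_up hc hw'
    have := hst.unique (axExt hz) (step_of_vals hz hc (ht.sh s₄) hu (h₄.val hw'))
    have := (𝔐.eq_iff (h₄.2 _ _ hw) hu).1 this
    exact e3 _ hrZ (Gen.of_mor (m := m₄) (s := s₄) ⟨_, _, _, _, _, ht.sh s₄, this⟩)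

/-- Every instance of the relation is induced by a link or an edge. -/
theorem exists_of_rel (hz : zcReqs ⊆ Q) (hc : codeReqs ⊆ Q)
    {x y z : 𝔐.M} (h : Rel 𝔐.mem x y z) (c : 𝔐.Stage) :
    ∃ c' m s, 𝔐.Ext c c' (mor m s) ∧ ∃ n τ a b d, Tri τ a b d ∧ τ ∈ Al (𝔐.F c') ∧
      ∃ u : Fin 3 → 𝔐.M, (∀ i, 𝔐.At c' (u i) (ut n (![a, b, d] i))) ∧
        ∀ w, (w = x ∨ w = y ∨ w = z) ↔ ∃ i, w = u i := by
  obtain ⟨q, t, hC, hV⟩ := h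
  obtain ⟨c₁, g₁, h₁, v, hq⟩ := 𝔐.grow c q
  obtain ⟨m₁, s₁, -, -, rfl⟩ := id h₁.1
  obtain ⟨n, τ, a, b, d, ht, rfl⟩ := gen_of_valid hz hc hV hq
  obtain ⟨c₂, m₂, s₂, h₂, k, e⟩ := val_succ hz hq
  have hq := h₂.val hq
  have ht := ht.sh s₂
  rw [e] at hq
  obtain ⟨c₃, m₃, s₃, h₃, t', ht'⟩ := name_down hc hq
  have hq := h₃.val_succ hq
  have ht := ht.sh s₃
  obtain ⟨c₄, m₄, s₄, h₄, u, hu⟩ := name_legs hc ht hq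
  have hq := h₄.val_succ hq
  have ht := ht.sh s₄
  simp only [sh_leg] at hu
  refine ⟨c₄, _, _, h₄.mor_comp (h₃.mor_comp (h₂.mor_comp h₁)), _, _, _, _, _, ht,
    ut_dom.1 (𝔐.dom hq), u, hu, fun w => ?_⟩
  rw [(hC.unique (code_of_vals hz hc ht hq (h₄.val ht') hu)).2 w]
  simp [Fin.exists_fin_succ]

end GM

open W

/-- The Kuratowski pair. -/
noncomputable def kp (x y : W) : W := node {node {x}, node {x, y}}

noncomputable def tr (x y z : W) : W := kp (kp x y) z

theorem Emb.kp {g : W → W} (hg : Emb g) (x y : W) : g (kp x y) = kp (g x) (g y) := by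
  rw [ZCForcing.kp, hg.map_node]
  refine node_congr ?_
  rw [Set.image_pair, hg.map_node, hg.map_node, node_congr (Set.image_singleton),
    node_congr (Set.image_pair _ _ _)]

theorem Emb.tr {g : W → W} (hg : Emb g) (x y z : W) : g (tr x y z) = tr (g x) (g y) (g z) := by
  rw [ZCForcing.tr, hg.kp, hg.kp, ZCForcing.tr]

theorem kp_dom {x y : W} (hx : x ∈ Dom F) (hy : y ∈ Dom F) : kp x y ∈ Dom F := by
  refine node_dom ?_
  rintro _ (rfl | rfl) <;> refine node_dom ?_
  · rintro _ rfl; exact hx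
  · rintro _ (rfl | rfl) <;> assumption

theorem tr_dom {x y z : W} (hx : x ∈ Dom F) (hy : y ∈ Dom F) (hz : z ∈ Dom F) : tr x y z ∈ Dom F :=
  kp_dom (kp_dom hx hy) hz

/-- The unfoldings of the labels. -/
noncomputable def lb (m : ℕ) (k : Idx) : W := ut m (.lab k)

theorem mor_lb (m' : ℕ) (s : Idx → Vec) (m : ℕ) (k : Idx) : mor m' s (lb m k) = lb (m' + m) k :=
  mor_ut _ _ _ _

theorem lb_dom (m : ℕ) (k : Idx) : lb m k ∈ Dom F := ut_dom.2 (lab_mem_Al k)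

theorem lb_inj {m m' : ℕ} {k k' : Idx} : lb m k = lb m' k' ↔ m = m' ∧ k = k' := by
  rw [lb, lb, ut_inj, Atom.lab.injEq]

noncomputable def fS (m : ℕ) (S : Set Idx) : W := node (lb m '' S)

noncomputable def fI (m : ℕ) : W := fS m Set.univ

noncomputable def fU (m : ℕ) : W := node (Set.range fun S : Finset Idx => fS m S)

noncomputable def fT (m : ℕ) : W :=
  node (Set.range fun t : Idx × Idx × Idx => tr (lb m t.1) (lb m t.2.1) (lb m t.2.2))

/-- The unfolding of the fibre over `k`. -/
noncomputable def fP (k : Idx) (m : ℕ) : W := node (Set.range fun a => ut m (.pt k a))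

theorem mor_fS (m' : ℕ) (s : Idx → Vec) (m : ℕ) (S : Set Idx) :
    mor m' s (fS m S) = fS (m' + m) S := by
  rw [fS, (mor_emb m' s).map_node]
  refine node_congr ?_
  rw [Set.image_image]
  simp only [mor_lb]

theorem mor_fI (m' : ℕ) (s : Idx → Vec) (m : ℕ) : mor m' s (fI m) = fI (m' + m) := mor_fS _ _ _ _

theorem mor_fU (m' : ℕ) (s : Idx → Vec) (m : ℕ) : mor m' s (fU m) = fU (m' + m) := by
  rw [fU, (mor_emb m' s).map_node]
  refine node_congr ?_
  rw [← Set.range_comp]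
  simp only [Function.comp_def, mor_fS]

theorem mor_fT (m' : ℕ) (s : Idx → Vec) (m : ℕ) : mor m' s (fT m) = fT (m' + m) := by
  rw [fT, (mor_emb m' s).map_node]
  refine node_congr ?_
  rw [← Set.range_comp]
  simp only [Function.comp_def, (mor_emb m' s).tr, mor_lb]

theorem mor_fP (k : Idx) (m' : ℕ) (s : Idx → Vec) (m : ℕ) :
    mor m' s (fP k m) = fP k (m' + m) := by
  rw [fP, (mor_emb m' s).map_node]
  refine node_congr ?_
  rw [← Set.range_comp]
  have : (mor m' s ∘ fun a => ut m (.pt k a)) =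
      (fun a => ut (m' + m) (.pt k a)) ∘ fun a => a + s k :=
    funext fun a => mor_ut _ _ _ _
  rw [this]
  exact (Equiv.addRight (s k)).surjective.range_comp _

theorem E_fS {m : ℕ} {S : Set Idx} {w : W} : E w (fS m S) ↔ ∃ k ∈ S, lb m k = w := E_node _ _

theorem E_fI {m : ℕ} {w : W} : E w (fI m) ↔ ∃ k, lb m k = w := by simp [fI, E_fS]

theorem fS_dom (m : ℕ) (S : Set Idx) : fS m S ∈ Dom F :=
  node_dom (by rintro _ ⟨k, -, rfl⟩; exact lb_dom _ _)

/-- `w` is the member with index `m` of the family `f`, where `m` is the index of `o`. -/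
def famReq (f : ℕ → W) (hf : ∀ m' s m, mor m' s (f m) = f (m' + m)) : Req :=
  req₁ (fun _ o w => ∃ m, o = ut m .star ∧ w = f m) <| by
    rintro F G g ⟨m', s, -, -, rfl⟩ o w - - ⟨m, rfl, rfl⟩
    exact ⟨m' + m, mor_ut _ _ _ _, hf _ _ _⟩

def starReq : Req := ⟨0, fun _ _ w => ∃ m, w = ut m .star, by
  rintro F G g v w ⟨m', s, -, -, rfl⟩ - - ⟨m, rfl⟩
  exact ⟨m' + m, mor_ut _ _ _ _⟩⟩

def fibreReq : Req := req₁ (fun F i w => ∃ m k, i = lb m k ∧ k ∈ F ∧ w = fP k m) <| by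
  rintro F G g ⟨m', s, hF, -, rfl⟩ i w - - ⟨m, k, rfl, hk, rfl⟩
  exact ⟨m' + m, k, mor_lb _ _ _ _, hF hk, mor_fP _ _ _ _⟩

/-- `w` is a finite set of labels bounding the edges between `x` and `y`. -/
def boundReq : Req := req₂ (fun F x y w => ∃ (m : ℕ) (S : Finset Idx) (i j : Idx) (a b : Vec),
    x = ut m (.pt i a) ∧ y = ut m (.pt j b) ∧ i ∈ F ∧ j ∈ F ∧ w = fS m S ∧
    ∀ k, (.edge i a j b k ∈ Al F ∨ .edge j b i a k ∈ Al F) → k ∈ S) <| by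
  rintro F G g ⟨m', s, hF, hs, rfl⟩ x y w - - - ⟨m, S, i, j, a, b, rfl, rfl, hi, hj, rfl, h⟩
  refine ⟨m' + m, S, i, j, a + s i, b + s j, mor_ut _ _ _ _, mor_ut _ _ _ _, hF hi, hF hj,
    mor_fS _ _ _ _, fun k hk => h k (hk.imp ?_ ?_)⟩
  · rw [edge_mem_Al, edge_mem_Al]
    rintro ⟨-, -, n1, n2, n3, e⟩
    exact ⟨hi, hj, n1, n2, n3, by rwa [← hs.sig hi hj n1 n2 n3]⟩
  · rw [edge_mem_Al, edge_mem_Al]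
    rintro ⟨-, -, n1, n2, n3, e⟩
    exact ⟨hj, hi, n1, n2, n3, by rwa [← hs.sig hj hi n1 n2 n3]⟩

/-- `V` omits all triples formed from the distinct labels `x`, `y`, `z`. -/
def Omits (V x y z : W) : Prop := ∃ m i j k, x = lb m i ∧ y = lb m j ∧ z = lb m k ∧ i ≠ j ∧ k ≠ i ∧
  k ≠ j ∧ ¬ E (tr x y z) V ∧ ¬ E (tr y z x) V ∧ ¬ E (tr x z y) V

theorem Omits.mor {V x y z : W} (h : Omits V x y z) (m' : ℕ) (s : Idx → Vec) :
    Omits (mor m' s V) (mor m' s x) (mor m' s y) (mor m' s z) := by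
  obtain ⟨m, i, j, k, rfl, rfl, rfl, n1, n2, n3, h1, h2, h3⟩ := h
  have hE := mor_emb m' s
  refine ⟨m' + m, i, j, k, mor_lb _ _ _ _, mor_lb _ _ _ _, mor_lb _ _ _ _, n1, n2, n3, ?_⟩
  rw [← hE.tr, ← hE.tr, ← hE.tr, hE.E_iff, hE.E_iff, hE.E_iff]
  exact ⟨h1, h2, h3⟩

def omitsReq₁ : Req := req₂ (fun _ I V x => E x I ∧ ∃ y z, Omits V x y z) <| by
  rintro F G g ⟨m', s, -, -, rfl⟩ I V x - - - ⟨h, y, z, h'⟩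
  exact ⟨(mor_emb m' s).E_iff.2 h, _, _, h'.mor m' s⟩

def omitsReq₂ : Req := req₂ (fun _ V x y => ∃ z, Omits V x y z) <| by
  rintro F G g ⟨m', s, -, -, rfl⟩ V x y - - - ⟨z, h'⟩
  exact ⟨_, h'.mor m' s⟩

def omitsReq₃ : Req := req₃ (fun _ V x y z => Omits V x y z) <| by
  rintro F G g ⟨m', s, -, -, rfl⟩ V x y z - - - - h'
  exact h'.mor m' s

/-- The line of `V` given by the labels `x`, `y` is infinite. -/
def InfLine (V x y : W) : Prop := ∃ m i j, x = lb m i ∧ y = lb m j ∧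
  {k | E (tr x y (lb m k)) V}.Infinite

theorem InfLine.mor {V x y : W} (h : InfLine V x y) (m' : ℕ) (s : Idx → Vec) :
    InfLine (mor m' s V) (mor m' s x) (mor m' s y) := by
  obtain ⟨m, i, j, rfl, rfl, h⟩ := h
  have hE := mor_emb m' s
  refine ⟨m' + m, i, j, mor_lb _ _ _ _, mor_lb _ _ _ _, ?_⟩
  simpa only [← mor_lb m' s, ← hE.tr, hE.E_iff] using h

def infReq₁ : Req := req₂ (fun _ I V x => E x I ∧ ∃ y, InfLine V x y) <| by
  rintro F G g ⟨m', s, -, -, rfl⟩ I V x - - - ⟨h, y, h'⟩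
  exact ⟨(mor_emb m' s).E_iff.2 h, _, h'.mor m' s⟩

def infReq₂ : Req := req₂ (fun _ V x y => InfLine V x y) <| by
  rintro F G g ⟨m', s, -, -, rfl⟩ V x y - - - h'
  exact h'.mor m' s

def avoidReq : Req := req₃ (fun _ V v p w => E (kp p w) V ∧ ¬ E w v ∧
    ∃ m i j k, p = kp (lb m i) (lb m j) ∧ w = lb m k) <| by
  rintro F G g ⟨m', s, -, -, rfl⟩ V v p w - - - - ⟨h1, h2, m, i, j, k, rfl, rfl⟩
  have hE := mor_emb m' s
  refine ⟨?_, ?_, m' + m, i, j, k, ?_, mor_lb _ _ _ _⟩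
  · rwa [← hE.kp, hE.E_iff]
  · rwa [hE.E_iff]
  · rw [hE.kp, mor_lb, mor_lb]

def famReqs : Set Req := {starReq, famReq fI mor_fI, famReq fU mor_fU, famReq fT mor_fT, fibreReq,
  boundReq, omitsReq₁, omitsReq₂, omitsReq₃, infReq₁, infReq₂, avoidReq}

namespace GM

variable {Q : Set Req} {𝔐 : GM Q} {c c' : 𝔐.Stage} {m m' : ℕ} {s : Idx → Vec}

theorem name_up' (hz : zcReqs ⊆ Q) {a b : 𝔐.M} {x y : W} (ha : 𝔐.At c a x) (hb : 𝔐.At c b y) :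
    ∃ c' g, 𝔐.Ext c c' g ∧ ∃ p, 𝔐.At c' p (node {g x, g y}) ∧ Up 𝔐.mem p a b := by
  obtain ⟨c', g, hg, p, w, hp, rfl, -⟩ := 𝔐.name₂
    (show pairReq ∈ Q from hz (by simp [zcReqs])) ha hb (Hom.id _) (w := node {x, y})
    (node_dom (by rintro _ (rfl | rfl); exacts [𝔐.dom ha, 𝔐.dom hb])) rfl
  refine ⟨c', g, hg, p, hp, fun w => ?_⟩
  rw [mem_iff_range (x := ![a, b]) (u := ![g x, g y]) hp (isNode_node _)
    (Fin.forall_fin_two.2 ⟨hg.2 _ _ ha, hg.2 _ _ hb⟩) (by simp [Fin.exists_fin_two])]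
  simp [Fin.exists_fin_two]

theorem name_pr (hz : zcReqs ⊆ Q) {a b : 𝔐.M} {x y : W} (ha : 𝔐.At c a x) (hb : 𝔐.At c b y) :
    ∃ c' g, 𝔐.Ext c c' g ∧ ∃ p, 𝔐.At c' p (kp (g x) (g y)) ∧ Pr 𝔐.mem p a b := by
  obtain ⟨c₁, g₁, h₁, p, hp, up⟩ := name_up' hz ha ha
  obtain ⟨c₂, g₂, h₂, q, hq, uq⟩ := name_up' hz (h₁.2 _ _ ha) (h₁.2 _ _ hb)
  obtain ⟨c₃, g₃, h₃, r, hr, ur⟩ := name_up' hz (h₂.2 _ _ hp) hq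
  refine ⟨c₃, _, h₃.comp (h₂.comp h₁), r, ?_, fun w => ?_⟩
  · convert hr using 1
    refine node_congr ?_
    rw [h₂.1.emb.map_node, h₃.1.emb.map_node, h₃.1.emb.map_node]
    congr 1
    · exact node_congr (by simp)
    · congr 1
      exact node_congr (by simp [Set.image_pair])
  · rw [ur w]
    have sp : Sg 𝔐.mem p a := fun w => by rw [up w, or_self]
    refine or_congr ⟨?_, fun h => h.unique (axExt hz) sp⟩ ⟨?_, fun h => h.unique (axExt hz) uq⟩
    · rintro rfl; exact sp
    · rintro rfl; exact uq

theorem name_trip (hz : zcReqs ⊆ Q) {i j k : 𝔐.M} {x y z : W} (hi : 𝔐.At c i x) (hj : 𝔐.At c j y)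
    (hk : 𝔐.At c k z) :
    ∃ c' g, 𝔐.Ext c c' g ∧ ∃ t, 𝔐.At c' t (g (tr x y z)) ∧ Trip 𝔐.mem t i j k := by
  obtain ⟨c₁, g₁, h₁, p, hp, pp⟩ := name_pr hz hi hj
  obtain ⟨c₂, g₂, h₂, t, ht, pt⟩ := name_pr hz hp (h₁.2 _ _ hk)
  refine ⟨c₂, _, h₂.comp h₁, t, ?_, p, pp, pt⟩
  rwa [Function.comp_apply, h₁.1.emb.tr, h₂.1.emb.tr, tr, ← h₂.1.emb.kp]

theorem mem_iff_tr (hz : zcReqs ⊆ Q)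
    {t i j k V : 𝔐.M} {x y z v : W} (hi : 𝔐.At c i x) (hj : 𝔐.At c j y)
    (hk : 𝔐.At c k z) (hV : 𝔐.At c V v) (ht : Trip 𝔐.mem t i j k) :
    𝔐.mem t V ↔ E (tr x y z) v := by
  obtain ⟨c₁, g₁, h₁, t', ht', tt'⟩ := name_trip hz hi hj hk
  obtain rfl := ht.unique (axExt hz) tt'
  rw [h₁.mem_iff hV ht', h₁.1.emb.E_iff]

variable (𝔐) in
/-- The sets `I`, `o`, `U`, `T` have their intended values at the stage `c`. -/
structure Std (I o U T : 𝔐.M) (c : 𝔐.Stage) (m : ℕ) : Prop where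
  o : 𝔐.At c o (ut m .star)
  I : 𝔐.At c I (fI m)
  U : 𝔐.At c U (fU m)
  T : 𝔐.At c T (fT m)

variable {I o U T : 𝔐.M}

theorem Std.ext (h : 𝔐.Std I o U T c m) (hg : 𝔐.Ext c c' (mor m' s)) :
    𝔐.Std I o U T c' (m' + m) where
  o := hg.val h.o
  I := by simpa only [mor_fI] using hg.2 _ _ h.I
  U := by simpa only [mor_fU] using hg.2 _ _ h.U
  T := by simpa only [mor_fT] using hg.2 _ _ h.T

theorem exists_std (hf : famReqs ⊆ Q) : ∃ I o U T c m, 𝔐.Std I o U T c m := by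
  have key : ∀ {c o m f hf} (_ : famReq f hf ∈ Q) (_ : 𝔐.At c o (ut m .star)), f m ∈ Dom (𝔐.F c) →
      ∃ c' m' s, 𝔐.Ext c c' (mor m' s) ∧ ∃ x, 𝔐.At c' x (f (m' + m)) := by
    intro c o m f hf hQ ho hd
    obtain ⟨c', g, hg, x, w, hx, ⟨k, e, rfl⟩, -⟩ := 𝔐.name₁ hQ ho (Hom.id _) hd ⟨m, rfl, rfl⟩
    obtain ⟨m', s, -, -, rfl⟩ := id hg.1
    rw [mor_ut, ut_inj] at e
    obtain ⟨rfl, -⟩ := e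
    exact ⟨c', m', s, hg, x, hx⟩
  obtain ⟨c₀, -, -, o, w, ho, m, rfl⟩ := 𝔐.name (show starReq ∈ Q from hf (by simp [famReqs]))
    (c := 𝔐.base) (x := Fin.elim0) (v := Fin.elim0) (fun i => i.elim0) (Hom.id _) (w := ut 0 .star)
    (ut_dom.2 star_mem_Al) ⟨0, rfl⟩
  obtain ⟨c₁, m₁, s₁, h₁, I, hI⟩ := key (hf (by simp [famReqs])) ho
    (f := fI) (hf := mor_fI) (fS_dom _ _)
  have ho := h₁.val ho
  obtain ⟨c₂, m₂, s₂, h₂, U, hU⟩ := key (hf (by simp [famReqs])) ho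
    (f := fU) (hf := mor_fU) (node_dom (by rintro _ ⟨S, rfl⟩; exact fS_dom _ _))
  have ho := h₂.val ho
  have hI := h₂.2 _ _ hI
  rw [mor_fI] at hI
  obtain ⟨c₃, m₃, s₃, h₃, T, hT⟩ := key (hf (by simp [famReqs])) ho
    (f := fT) (hf := mor_fT) (node_dom (by
      rintro _ ⟨t, rfl⟩; exact tr_dom (lb_dom _ _) (lb_dom _ _) (lb_dom _ _)))
  have ho := h₃.val ho
  have hI := h₃.2 _ _ hI
  have hU := h₃.2 _ _ hU
  rw [mor_fI] at hI
  rw [mor_fU] at hU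
  exact ⟨I, o, U, T, _, _, ho, hI, hU, hT⟩

theorem Ext.lb (hg : 𝔐.Ext c c' (mor m' s)) {i : 𝔐.M} {k : Idx} (h : 𝔐.At c i (lb m k)) :
    𝔐.At c' i (lb (m' + m) k) := by
  simpa only [mor_lb] using hg.2 _ _ h

theorem Std.mem_I (hs : 𝔐.Std I o U T c m) {i : 𝔐.M} (hi : 𝔐.mem i I) :
    ∃ c' m' s, 𝔐.Ext c c' (mor m' s) ∧ ∃ k, 𝔐.At c' i (lb (m' + m) k) := by
  obtain ⟨c', g, hg, w, hw⟩ := 𝔐.grow c i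
  obtain ⟨m', s, -, -, rfl⟩ := id hg.1
  obtain ⟨k, rfl⟩ := E_fI.1 ((𝔐.mem_iff hw (hs.ext hg).I).1 hi)
  exact ⟨c', m', s, hg, k, hw⟩

theorem Std.mem_I₂ (hs : 𝔐.Std I o U T c m) {i j : 𝔐.M} (hi : 𝔐.mem i I) (hj : 𝔐.mem j I) :
    ∃ c' m' s, 𝔐.Ext c c' (mor m' s) ∧ ∃ k l, 𝔐.At c' i (lb (m' + m) k) ∧
      𝔐.At c' j (lb (m' + m) l) := by
  obtain ⟨c₁, m₁, s₁, h₁, k, hk⟩ := hs.mem_I hi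
  obtain ⟨c₂, m₂, s₂, h₂, l, hl⟩ := (hs.ext h₁).mem_I hj
  have hk := h₂.lb hk
  rw [← add_assoc] at hk hl
  exact ⟨c₂, _, _, h₂.mor_comp h₁, k, l, hk, hl⟩

theorem Std.mem_I₃ (hs : 𝔐.Std I o U T c m) {i j l : 𝔐.M} (hi : 𝔐.mem i I) (hj : 𝔐.mem j I)
    (hl : 𝔐.mem l I) :
    ∃ c' m' s, 𝔐.Ext c c' (mor m' s) ∧ ∃ i₀ j₀ l₀, 𝔐.At c' i (lb (m' + m) i₀) ∧
      𝔐.At c' j (lb (m' + m) j₀) ∧ 𝔐.At c' l (lb (m' + m) l₀) := by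
  obtain ⟨c₁, m₁, s₁, h₁, i₀, j₀, hi, hj⟩ := hs.mem_I₂ hi hj
  obtain ⟨c₂, m₂, s₂, h₂, l₀, hl⟩ := (hs.ext h₁).mem_I hl
  have hi := h₂.lb hi
  have hj := h₂.lb hj
  rw [← add_assoc] at hi hj hl
  exact ⟨c₂, _, _, h₂.mor_comp h₁, i₀, j₀, l₀, hi, hj, hl⟩

end GM

open W

namespace GM

variable {Q : Set Req} {𝔐 : GM Q} {c c' : 𝔐.Stage} {m m' : ℕ} {s : Idx → Vec} {I o U T : 𝔐.M}

theorem link_of_rel (hz : zcReqs ⊆ Q) (hc : codeReqs ⊆ Q)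
    {o x i : 𝔐.M} {k : Idx} (ho : 𝔐.At c o (ut m .star)) (hi : 𝔐.At c i (lb m k))
    (h : Rel 𝔐.mem x o i) :
    ∃ c' m' s, 𝔐.Ext c c' (mor m' s) ∧ ∃ a, k ∈ 𝔐.F c' ∧ 𝔐.At c' x (ut (m' + m) (.pt k a)) := by
  obtain ⟨c', m', s, hg, n, τ, a, b, d, ht, hτ, u, hu, he⟩ := exists_of_rel hz hc h c
  have ho := hg.val ho
  have hi := hg.lb hi
  obtain ⟨p, hp⟩ := (he o).1 (by simp)
  obtain ⟨q, hq⟩ := (he i).1 (by simp)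
  have e1 := ut_inj.1 ((𝔐.eq_iff ho (hu p)).1 hp)
  have e2 := ut_inj.1 ((𝔐.eq_iff hi (hu q)).1 hq)
  have h0 := (he (u 0)).2 ⟨0, rfl⟩
  cases ht with
  | link l a =>
    obtain rfl : l = k := by
      fin_cases q
      · simp at e2
      · simp at e2
      · simpa using e2.2.symm
    obtain rfl : m' + m = n := e1.1
    have hx : u 0 = x := by
      rcases h0 with h0 | h0 | h0
      · exact h0
      · have := ut_inj.1 ((𝔐.eq_iff (hu 0) ho).1 h0)
        simp [Atom.sh] at this
      · have := ut_inj.1 ((𝔐.eq_iff (hu 0) hi).1 h0)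
        simp at this
    refine ⟨c', m', s, hg, a, link_mem_Al.1 hτ, ?_⟩
    rw [← hx]
    exact hu 0
  | edge i a j b k =>
    exfalso
    fin_cases p <;> simp [Atom.sh] at e1

theorem edge_of_rel (hz : zcReqs ⊆ Q) (hc : codeReqs ⊆ Q)
    {x y z : 𝔐.M} {i j k : Idx} {a b : Vec} (hx : 𝔐.At c x (ut m (.pt i a)))
    (hy : 𝔐.At c y (ut m (.pt j b))) (hk : 𝔐.At c z (lb m k)) (h : Rel 𝔐.mem x y z) :
    ∃ c' m' s, 𝔐.Ext c c' (mor m' s) ∧ (.edge i (a + s i) j (b + s j) k ∈ Al (𝔐.F c') ∨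
      .edge j (b + s j) i (a + s i) k ∈ Al (𝔐.F c')) := by
  obtain ⟨c', m', s, hg, n, τ, a', b', d, ht, hτ, u, hu, he⟩ := exists_of_rel hz hc h c
  have hx : 𝔐.At c' x (ut (m' + m) (.pt i (a + s i))) := hg.val hx
  have hy : 𝔐.At c' y (ut (m' + m) (.pt j (b + s j))) := hg.val hy
  have hk : 𝔐.At c' z (ut (m' + m) (.lab k)) := hg.lb hk
  refine ⟨c', m', s, hg, ?_⟩
  obtain ⟨p, hp⟩ := (he x).1 (by simp)
  obtain ⟨q, hq⟩ := (he y).1 (by simp)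
  obtain ⟨r, hr⟩ := (he z).1 (by simp)
  have e1 := ut_inj.1 ((𝔐.eq_iff hx (hu p)).1 hp)
  have e2 := ut_inj.1 ((𝔐.eq_iff hy (hu q)).1 hq)
  have e3 := ut_inj.1 ((𝔐.eq_iff hk (hu r)).1 hr)
  have h0 := (he (u 0)).2 ⟨0, rfl⟩
  have h1 := (he (u 1)).2 ⟨1, rfl⟩
  rw [𝔐.eq_iff (hu 0) hx, 𝔐.eq_iff (hu 0) hy, 𝔐.eq_iff (hu 0) hk, ut_inj, ut_inj, ut_inj] at h0
  rw [𝔐.eq_iff (hu 1) hx, 𝔐.eq_iff (hu 1) hy, 𝔐.eq_iff (hu 1) hk, ut_inj, ut_inj, ut_inj] at h1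
  cases ht with
  | link l a => simp at h1
  | edge i' a' j' b' k' =>
    have hn := (edge_mem_Al.1 hτ).2.2.1
    obtain rfl : k = k' := by
      fin_cases r <;> simp_all
    simp only [Matrix.cons_val_zero, Matrix.cons_val_one, Atom.pt.injEq, reduceCtorEq, and_false,
      or_false] at h0 h1
    rcases h0 with ⟨-, rfl, rfl⟩ | ⟨-, rfl, rfl⟩ <;> rcases h1 with ⟨-, rfl, rfl⟩ | ⟨-, rfl, rfl⟩
    · exact absurd rfl hn
    · exact .inl hτ
    · exact .inr hτ
    · exact absurd rfl hn

theorem Std.fibres (hz : zcReqs ⊆ Q) (hc : codeReqs ⊆ Q)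
    (hs : 𝔐.Std I o U T c m) (hf : famReqs ⊆ Q) {i : 𝔐.M} (hi : 𝔐.mem i I) :
    ∃ p, (∃ x, 𝔐.mem x p) ∧ ∀ x, 𝔐.mem x p ↔ Rel 𝔐.mem x o i := by
  classical
  obtain ⟨c₁, m₁, s₁, h₁, k, hk⟩ := hs.mem_I hi
  have hs := hs.ext h₁
  generalize m₁ + m = m at hs hk
  obtain ⟨g, hg⟩ := exists_hom (Finset.subset_insert k (𝔐.F c₁))
  obtain ⟨m', s, -, -, rfl⟩ := id hg
  obtain ⟨c₂, g₂, h₂, p, w, hp, ⟨n, l, e, hl, rfl⟩, -⟩ := 𝔐.name₁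
    (show fibreReq ∈ Q from hf (by simp [famReqs])) hk hg (w := fP k (m' + m))
    (node_dom (by
      rintro _ ⟨a, rfl⟩
      exact ut_dom.2 (pt_mem_Al.2 (Finset.mem_insert_self _ _))))
    ⟨m' + m, k, mor_lb _ _ _ _, Finset.mem_insert_self _ _, rfl⟩
  obtain ⟨m₂, s₂, -, -, rfl⟩ := id h₂.1
  have hs := hs.ext h₂
  have hk := h₂.lb hk
  rw [mor_lb, lb_inj] at e
  obtain ⟨e, rfl⟩ := e
  rw [e] at hs hk
  clear h₂ e
  refine ⟨p, ?_, fun x => ⟨fun hx => ?_, fun hx => ?_⟩⟩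
  · by_contra hne
    push Not at hne
    have := E_of_subset hz hp hs.I (fun z h => absurd h (hne z)) (w := ut n (.pt k 0))
      ((E_node _ _).2 ⟨0, rfl⟩)
    obtain ⟨k', e⟩ := E_fI.1 this
    exact absurd (ut_inj.1 e).2 (by simp)
  · obtain ⟨c₃, g₃, h₃, w, hw⟩ := 𝔐.grow c₂ x
    obtain ⟨m₃, s₃, hF, -, rfl⟩ := id h₃.1
    rw [h₃.mem_iff hp hw, mor_fP] at hx
    obtain ⟨a, rfl⟩ := (E_node _ _).1 hx
    exact rel_of_vals hz hc (.link k a) (link_mem_Al.2 (hF hl)) hw (hs.ext h₃).o (h₃.lb hk)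
  · obtain ⟨c₃, m₃, s₃, h₃, a, -, hx⟩ := link_of_rel hz hc hs.o hk hx
    rw [h₃.mem_iff hp hx, mor_fP]
    exact (E_node _ _).2 ⟨a, rfl⟩

theorem Std.bound (hz : zcReqs ⊆ Q) (hc : codeReqs ⊆ Q)
    (hs : 𝔐.Std I o U T c m) (hf : famReqs ⊆ Q) {i j x y : 𝔐.M} (hi : 𝔐.mem i I)
    (hj : 𝔐.mem j I) (hx : Rel 𝔐.mem x o i) (hy : Rel 𝔐.mem y o j) :
    ∃ v, 𝔐.mem v U ∧ ∀ k, 𝔐.mem k I → Rel 𝔐.mem x y k → 𝔐.mem k v := by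
  classical
  obtain ⟨c₁, m₁, s₁, h₁, i₀, j₀, hi, hj⟩ := hs.mem_I₂ hi hj
  have hs := hs.ext h₁
  generalize m₁ + m = m at hs hi hj
  obtain ⟨c₂, m₂, s₂, h₂, a, hiF, hx⟩ := link_of_rel hz hc hs.o hi hx
  have hs := hs.ext h₂
  have hj := h₂.lb hj
  generalize m₂ + m = m at hs hj hx
  obtain ⟨c₃, m₃, s₃, h₃, b, hjF, hy⟩ := link_of_rel hz hc hs.o hj hy
  have hs := hs.ext h₃
  have hx : 𝔐.At c₃ x (ut (m₃ + m) (.pt i₀ (a + s₃ i₀))) := h₃.val hx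
  have hiF := h₃.1.sub hiF
  generalize m₃ + m = m at hs hx hy
  generalize a + s₃ i₀ = a at hx
  let S : Finset Idx := 𝔐.F c₃ ∪ a.support.biUnion id ∪ b.support.biUnion id
  obtain ⟨c₄, g₄, h₄, v, w, hv, ⟨n, S', i, j, a', b', e1, e2, -, -, rfl, -⟩, hP⟩ := 𝔐.name₂
    (show boundReq ∈ Q from hf (by simp [famReqs])) hx hy (Hom.id _) (w := fS m S) (fS_dom _ _)
    ⟨m, S, i₀, j₀, a, b, rfl, rfl, hiF, hjF, rfl, fun k hk => by
      rcases hk with hk | hk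
      · exact edge_finite hk
      · have := edge_finite hk
        simp only [S, Finset.mem_union] at this ⊢
        tauto⟩
  obtain ⟨m₄, s₄, -, -, rfl⟩ := id h₄.1
  rw [mor_ut, ut_inj] at e1
  obtain ⟨rfl, -⟩ := e1
  have hs := hs.ext h₄
  have hx : 𝔐.At c₄ x (ut (m₄ + m) (.pt i₀ (a + s₄ i₀))) := h₄.val hx
  have hy : 𝔐.At c₄ y (ut (m₄ + m) (.pt j₀ (b + s₄ j₀))) := h₄.val hy
  refine ⟨v, (𝔐.mem_iff hv hs.U).2 ((E_node _ _).2 ⟨S', rfl⟩), fun k hk hR => ?_⟩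
  obtain ⟨c₅, m₅, s₅, h₅, k₀, hk⟩ := hs.mem_I hk
  obtain ⟨c₆, m₆, s₆, h₆, he⟩ := edge_of_rel hz hc (h₅.val hx) (h₅.val hy) hk hR
  obtain ⟨n', S'', i, j, a', b', e1, e2, -, -, e3, he'⟩ := hP _ _ (h₆.1.comp h₅.1)
  rw [Function.comp_apply, mor_ut, mor_ut, mor_ut, ut_inj] at e1 e2
  obtain ⟨rfl, e1⟩ := e1
  obtain ⟨-, e2⟩ := e2
  have e1 := Atom.pt.inj e1
  have e2 := Atom.pt.inj e2
  obtain ⟨rfl, rfl⟩ := e1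
  obtain ⟨rfl, rfl⟩ := e2
  rw [(h₆.comp h₅).mem_iff hv (h₆.lb hk), e3, E_fS]
  exact ⟨k₀, he' k₀ he, rfl⟩

theorem Std.triangle (hz : zcReqs ⊆ Q) (hc : codeReqs ⊆ Q)
    (hs : 𝔐.Std I o U T c m) {i j k x y z : 𝔐.M} (hi : 𝔐.mem i I)
    (hj : 𝔐.mem j I) (hk : 𝔐.mem k I) (hij : i ≠ j) (hki : k ≠ i) (hkj : k ≠ j)
    (hx : Rel 𝔐.mem x o i) (hy : Rel 𝔐.mem y o j) (hw : Rel 𝔐.mem z o k) :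
    Rel 𝔐.mem x y k ∨ Rel 𝔐.mem y z i ∨ Rel 𝔐.mem x z j := by
  obtain ⟨c₁, m₁, s₁, h₁, i₀, j₀, k₀, hi, hj, hk⟩ := hs.mem_I₃ hi hj hk
  have hs := hs.ext h₁
  generalize m₁ + m = m at hs hi hj hk
  obtain ⟨c₂, m₂, s₂, h₂, a, hiF, hx⟩ := link_of_rel hz hc hs.o hi hx
  have hs := hs.ext h₂
  have hi := h₂.lb hi
  have hj := h₂.lb hj
  have hk := h₂.lb hk
  generalize m₂ + m = m at hs hi hj hk hx
  obtain ⟨c₃, m₃, s₃, h₃, b, hjF, hy⟩ := link_of_rel hz hc hs.o hj hy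
  have hs := hs.ext h₃
  have hi := h₃.lb hi
  have hj := h₃.lb hj
  have hk := h₃.lb hk
  have hx : 𝔐.At c₃ x (ut (m₃ + m) (.pt i₀ (a + s₃ i₀))) := h₃.val hx
  generalize m₃ + m = m at hs hi hj hk hx hy
  obtain ⟨c₄, m₄, s₄, h₄, d, hkF, hw⟩ := link_of_rel hz hc hs.o hk hw
  have hi := h₄.lb hi
  have hj := h₄.lb hj
  have hk := h₄.lb hk
  have hx : 𝔐.At c₄ x (ut (m₄ + m) (.pt i₀ (a + s₃ i₀ + s₄ i₀))) := h₄.val hx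
  have hy : 𝔐.At c₄ y (ut (m₄ + m) (.pt j₀ (b + s₄ j₀))) := h₄.val hy
  rw [ne_eq, 𝔐.eq_iff hi hj, lb_inj] at hij
  rw [ne_eq, 𝔐.eq_iff hk hi, lb_inj] at hki
  rw [ne_eq, 𝔐.eq_iff hk hj, lb_inj] at hkj
  simp only [true_and] at hij hki hkj
  rcases parity (h₄.1.sub (h₃.1.sub hiF)) (h₄.1.sub hjF) hkF hij hki hkj
    (a + s₃ i₀ + s₄ i₀) (b + s₄ j₀) d with h | h | h
  · exact .inl (rel_of_vals hz hc (.edge _ _ _ _ _) h hx hy hk)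
  · exact .inr (.inl (rel_of_vals hz hc (.edge _ _ _ _ _) h hy hw hi))
  · exact .inr (.inr (rel_of_vals hz hc (.edge _ _ _ _ _) h hx hw hj))

theorem Std.triples (hz : zcReqs ⊆ Q) (hs : 𝔐.Std I o U T c m) {i j k : 𝔐.M} (hi : 𝔐.mem i I)
    (hj : 𝔐.mem j I) (hk : 𝔐.mem k I) : ∃ t, 𝔐.mem t T ∧ Trip 𝔐.mem t i j k := by
  obtain ⟨c₁, m₁, s₁, h₁, i₀, j₀, k₀, hi, hj, hk⟩ := hs.mem_I₃ hi hj hk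
  have hs := hs.ext h₁
  obtain ⟨c₂, g₂, h₂, t, ht, tt⟩ := name_trip hz hi hj hk
  refine ⟨t, ?_, tt⟩
  rw [h₂.mem_iff hs.T ht, h₂.1.emb.E_iff]
  exact (E_node _ _).2 ⟨(i₀, j₀, k₀), rfl⟩

theorem Std.not_omits (hz : zcReqs ⊆ Q) (hf : famReqs ⊆ Q)
    {V : 𝔐.M} {v x y z : W} (hs : 𝔐.Std I o U T c m) (hV : 𝔐.At c V v)
    (hF : Free 𝔐.mem I U V) (h : Omits v x y z) (hx : E x (fI m)) : False := by
  have hd : ∀ {F : Finset Idx} {x y z v}, Omits v x y z → x ∈ Dom F ∧ y ∈ Dom F ∧ z ∈ Dom F := by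
    rintro F x y z v ⟨m, i, j, k, rfl, rfl, rfl, -⟩
    exact ⟨lb_dom _ _, lb_dom _ _, lb_dom _ _⟩
  obtain ⟨c₁, g₁, h₁, i, x₁, hi, ⟨hx₁, y₁, z₁, h⟩, -⟩ := 𝔐.name₂
    (show omitsReq₁ ∈ Q from hf (by simp [famReqs])) hs.I hV (Hom.id _) (hd h).1
    ⟨hx, y, z, h⟩
  obtain ⟨m₁, s₁, -, -, rfl⟩ := id h₁.1
  have hs := hs.ext h₁
  have hV := h₁.2 _ _ hV
  rw [mor_fI] at hx₁
  generalize mor m₁ s₁ v = v at hV h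
  generalize m₁ + m = m at hs hx₁
  obtain ⟨c₂, g₂, h₂, j, y₂, hj, ⟨z₂, h⟩, -⟩ := 𝔐.name₂
    (show omitsReq₂ ∈ Q from hf (by simp [famReqs])) hV hi (Hom.id _) (hd h).2.1 ⟨z₁, h⟩
  have hV := h₂.2 _ _ hV
  have hi := h₂.2 _ _ hi
  obtain ⟨c₃, g₃, h₃, k, z₃, hk, h⟩ := 𝔐.name₃
    (show omitsReq₃ ∈ Q from hf (by simp [famReqs])) hV hi hj (Hom.id _) (hd h).2.2 h
  have hV := h₃.2 _ _ hV
  have hi := h₃.2 _ _ hi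
  have hj := h₃.2 _ _ hj
  have hI := (h₃.comp h₂).2 _ _ hs.I
  have hx₃ : E (g₃ (g₂ x₁)) ((g₃ ∘ g₂) (fI m)) := (h₃.comp h₂).1.emb.E_iff.2 hx₁
  obtain ⟨m₃, s₃, -, -, e⟩ := id (h₃.comp h₂).1
  rw [e, mor_fI] at hI hx₃
  obtain ⟨n, i₀, j₀, k₀, e1, e2, e3, n1, n2, n3, h1, h2, h3⟩ := h
  obtain ⟨k', e4⟩ := E_fI.1 hx₃
  rw [e1, lb_inj] at e4
  obtain ⟨rfl, -⟩ := e4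
  have mI : ∀ {l l₀}, 𝔐.At c₃ l (lb (m₃ + m) l₀) → 𝔐.mem l I := fun h =>
    (𝔐.mem_iff h hI).2 (E_fI.2 ⟨_, rfl⟩)
  rw [e1, e2, e3] at h1 h2 h3
  rw [e1] at hi
  rw [e2] at hj
  rw [e3] at hk
  have ne : ∀ {l l' l₀ l₀'}, 𝔐.At c₃ l (lb (m₃ + m) l₀) → 𝔐.At c₃ l' (lb (m₃ + m) l₀') → l₀ ≠ l₀' →
      l ≠ l' := fun h h' hn e => hn (lb_inj.1 ((𝔐.eq_iff h h').1 e)).2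
  obtain ⟨t, htV, ht | ht | ht⟩ := hF.2 i j k (mI hi) (mI hj) (mI hk) (ne hi hj n1) (ne hk hi n2)
    (ne hk hj n3)
  · exact h1 ((mem_iff_tr hz hi hj hk hV ht).1 htV)
  · exact h2 ((mem_iff_tr hz hj hk hi hV ht).1 htV)
  · exact h3 ((mem_iff_tr hz hi hk hj hV ht).1 htV)

theorem Std.not_infLine (hz : zcReqs ⊆ Q) (hf : famReqs ⊆ Q)
    {V : 𝔐.M} {v x y : W} (hs : 𝔐.Std I o U T c m) (hV : 𝔐.At c V v)
    (hF : Free 𝔐.mem I U V) (h : InfLine v x y) (hx : E x (fI m)) : False := by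
  have hd : ∀ {F : Finset Idx} {x y v}, InfLine v x y → x ∈ Dom F ∧ y ∈ Dom F := by
    rintro F x y v ⟨m, i, j, rfl, rfl, -⟩
    exact ⟨lb_dom _ _, lb_dom _ _⟩
  obtain ⟨c₁, g₁, h₁, i, x₁, hi, ⟨hx₁, y₁, h⟩, -⟩ := 𝔐.name₂
    (show infReq₁ ∈ Q from hf (by simp [famReqs])) hs.I hV (Hom.id _) (hd h).1 ⟨hx, y, h⟩
  obtain ⟨m₁, s₁, -, -, rfl⟩ := id h₁.1
  have hs := hs.ext h₁
  have hV := h₁.2 _ _ hV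
  rw [mor_fI] at hx₁
  obtain ⟨i₀, rfl⟩ := E_fI.1 hx₁
  generalize mor m₁ s₁ v = v at hV h
  generalize m₁ + m = m at hs hx₁ hi h
  obtain ⟨c₂, g₂, h₂, j, y₂, hj, ⟨n, i₁, j₀, e1, rfl, hinf⟩, -⟩ := 𝔐.name₂
    (show infReq₂ ∈ Q from hf (by simp [famReqs])) hV hi (Hom.id _) (hd h).2 h
  obtain ⟨m₂, s₂, -, -, rfl⟩ := id h₂.1
  have hs := hs.ext h₂
  have hV := h₂.2 _ _ hV
  have hi := h₂.lb hi
  rw [mor_lb] at e1 hinf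
  obtain ⟨rfl, rfl⟩ := lb_inj.1 e1
  generalize mor m₂ s₂ v = v at hV hinf
  generalize m₂ + m = m at hs hi hj hinf
  have mI : ∀ {c m l l₀}, 𝔐.Std I o U T c m → 𝔐.At c l (lb m l₀) → 𝔐.mem l I := fun hs h =>
    (𝔐.mem_iff h hs.I).2 (E_fI.2 ⟨_, rfl⟩)
  obtain ⟨u, huU, hu⟩ := hF.1 i j (mI hs hi) (mI hs hj)
  obtain ⟨c₃, g₃, h₃, w, huw⟩ := 𝔐.grow c₂ u
  obtain ⟨m₃, s₃, -, -, rfl⟩ := id h₃.1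
  have hs := hs.ext h₃
  have hV := h₃.2 _ _ hV
  have hi := h₃.lb hi
  have hj := h₃.lb hj
  obtain ⟨S, rfl⟩ := (E_node _ _).1 ((𝔐.mem_iff huw hs.U).1 huU)
  obtain ⟨k₀, hk, hkS⟩ := hinf.exists_notMem_finset S
  have hk : E (tr (lb (m₃ + m) i₀) (lb (m₃ + m) j₀) (lb (m₃ + m) k₀)) (mor m₃ s₃ v) := by
    rw [← mor_lb m₃ s₃, ← mor_lb m₃ s₃, ← mor_lb m₃ s₃, ← (mor_emb m₃ s₃).tr, (mor_emb m₃ s₃).E_iff]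
    exact hk
  generalize mor m₃ s₃ v = v at hV hk
  generalize m₃ + m = m at hs hV hi hj hk huw
  obtain ⟨c₄, g₄, h₄, p, hp, pp⟩ := name_pr hz hi hj
  obtain ⟨m₄, s₄, -, -, rfl⟩ := id h₄.1
  have hE := mor_emb m₄ s₄
  have hV := h₄.2 _ _ hV
  have huw := h₄.2 _ _ huw
  rw [mor_fS] at huw
  rw [mor_lb, mor_lb] at hp
  have hk := hE.E_iff.2 hk
  rw [hE.tr, mor_lb, mor_lb, mor_lb] at hk
  have hs := hs.ext h₄
  generalize mor m₄ s₄ v = v at hV hk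
  generalize m₄ + m = m at hs hp hk huw
  obtain ⟨c₅, g₅, h₅, k, w, hkw, h1, h2, n, i₁, j₁, k₁, e1, rfl⟩ := 𝔐.name₃
    (show avoidReq ∈ Q from hf (by simp [famReqs])) hV huw hp (Hom.id _) (lb_dom _ k₀)
    ⟨hk, by
      rintro h
      obtain ⟨k', hk', e⟩ := E_fS.1 h
      obtain rfl := (lb_inj.1 e).2
      exact hkS hk', m, i₀, j₀, k₀, rfl, rfl⟩
  obtain ⟨m₅, s₅, -, -, rfl⟩ := id h₅.1
  have hE := mor_emb m₅ s₅
  have hs := hs.ext h₅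
  have hV := h₅.2 _ _ hV
  have huw := h₅.2 _ _ huw
  have hp := h₅.2 _ _ hp
  rw [hE.kp, mor_lb, mor_lb] at e1
  have e2 : m₅ + m = n := by
    have := (E_node _ _).1 (e1 ▸ (E_node _ _).2 (Set.mem_insert (node {lb (m₅ + m) i₀}) _) :
      E (node {lb (m₅ + m) i₀}) (kp (lb n i₁) (lb n j₁)))
    have : E (lb (m₅ + m) i₀) (node {lb n i₁}) ∨ E (lb (m₅ + m) i₀) (node {lb n i₁, lb n j₁}) := by
      rcases this with h | h <;> [left; right] <;> rw [← h] <;> simp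
    simp only [E_node, Set.mem_singleton_iff, Set.mem_insert_iff, lb_inj] at this
    tauto
  subst e2
  obtain ⟨c₆, g₆, h₆, t, ht, pt⟩ := name_pr hz hp hkw
  have htV : 𝔐.mem t V := by
    rw [h₆.mem_iff hV ht, ← h₆.1.emb.kp, h₆.1.emb.E_iff]
    exact h1
  have := hu k t (mI hs hkw) ⟨p, pp, pt⟩ htV
  rw [𝔐.mem_iff hkw huw] at this
  exact h2 this

theorem Std.not_free (hz : zcReqs ⊆ Q) (hf : famReqs ⊆ Q)
    (hs : 𝔐.Std I o U T c m) : ¬ ∃ V, Free 𝔐.mem I U V := by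
  rintro ⟨V, hF⟩
  obtain ⟨c₁, g₁, h₁, v, hV⟩ := 𝔐.grow c V
  obtain ⟨m₁, s₁, -, -, rfl⟩ := id h₁.1
  have hs := hs.ext h₁
  generalize m₁ + m = m at hs
  let S : Idx → Idx → Set Idx := fun i j => {k | E (tr (lb m i) (lb m j) (lb m k)) v}
  by_cases hS : ∀ i j, (S i j).Finite
  · obtain ⟨i, j, k, n1, n2, n3, h1, h2, h3⟩ := exists_free_triple S hS
    exact hs.not_omits hz hf hV hF ⟨m, i, j, k, rfl, rfl, rfl, n1, n2, n3, h1, h2, h3⟩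
      (E_fI.2 ⟨_, rfl⟩)
  · push Not at hS
    obtain ⟨i, j, h⟩ := hS
    exact hs.not_infLine hz hf hV hF ⟨m, i, j, rfl, rfl, h⟩ (E_fI.2 ⟨_, rfl⟩)

theorem bad (hz : zcReqs ⊆ Q) (hf : famReqs ⊆ Q) (hc : codeReqs ⊆ Q) : Bad 𝔐.mem := by
  obtain ⟨I, o, U, T, c, m, hs⟩ := exists_std (𝔐 := 𝔐) hf
  exact ⟨I, o, U, T, fun i j k hi hj hk => hs.triples hz hi hj hk,
    fun i hi => hs.fibres hz hc hf hi, fun i j x y hi hj hx hy => hs.bound hz hc hf hi hj hx hy,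
    fun i j k x y z hi hj hk n1 n2 n3 hx hy hw => hs.triangle hz hc hi hj hk n1 n2 n3 hx hy hw,
    hs.not_free hz hf⟩

end GM

section Definability

open FirstOrder FirstOrder.Language

variable {ι : Type*} (L : FirstOrder.Language.{0, 0}) (M : ι → Type) [∀ i, L.Structure (M i)]

/-- The predicate `P` is given by a formula, uniformly in the structures `M i`. -/
def Df {α : Type} (P : ∀ i, (α → M i) → Prop) : Prop :=
  ∃ φ : L.Formula α, ∀ i v, φ.Realize v ↔ P i v

variable {L M} {α : Type} {P Q : ∀ i, (α → M i) → Prop}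

theorem Df.eq (a b : α) : Df L M fun _ v => v a = v b :=
  ⟨(Term.var a).equal (.var b), fun _ _ => Formula.realize_equal⟩

theorem Df.fn {F : L.Functions 1} {f : ∀ i, M i → M i}
    (hF : ∀ i (x : Fin 1 → M i), Structure.funMap F x = f i (x 0)) (a b : α) :
    Df L M fun i v => v a = f i (v b) :=
  ⟨(Term.var a).equal (F.apply₁ (.var b)), fun i v => by
    rw [Formula.realize_equal, Term.realize_functions_apply₁, hF]; rfl⟩

theorem Df.not (hP : Df L M P) : Df L M fun i v => ¬ P i v := by
  obtain ⟨φ, hφ⟩ := hP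
  exact ⟨φ.not, fun i v => by rw [Formula.realize_not, hφ]⟩

theorem Df.and (hP : Df L M P) (hQ : Df L M Q) : Df L M fun i v => P i v ∧ Q i v := by
  obtain ⟨φ, hφ⟩ := hP
  obtain ⟨ψ, hψ⟩ := hQ
  exact ⟨φ ⊓ ψ, fun i v => by rw [Formula.realize_inf, hφ, hψ]⟩

theorem Df.or (hP : Df L M P) (hQ : Df L M Q) : Df L M fun i v => P i v ∨ Q i v := by
  obtain ⟨φ, hφ⟩ := hP
  obtain ⟨ψ, hψ⟩ := hQ
  exact ⟨φ ⊔ ψ, fun i v => by rw [Formula.realize_sup, hφ, hψ]⟩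

theorem Df.imp (hP : Df L M P) (hQ : Df L M Q) : Df L M fun i v => P i v → Q i v := by
  obtain ⟨φ, hφ⟩ := hP
  obtain ⟨ψ, hψ⟩ := hQ
  exact ⟨φ.imp ψ, fun i v => by rw [Formula.realize_imp, hφ, hψ]⟩

theorem Df.iff (hP : Df L M P) (hQ : Df L M Q) : Df L M fun i v => (P i v ↔ Q i v) := by
  obtain ⟨φ, hφ⟩ := hP
  obtain ⟨ψ, hψ⟩ := hQ
  exact ⟨φ.iff ψ, fun i v => by rw [Formula.realize_iff, hφ, hψ]⟩

theorem Df.ex {P : ∀ i, (α → M i) → M i → Prop}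
    (hP : Df L M fun i (v : α ⊕ Unit → M i) => P i (fun a => v (.inl a)) (v (.inr ()))) :
    Df L M fun i v => ∃ x, P i v x := by
  obtain ⟨φ, hφ⟩ := hP
  refine ⟨φ.iExs Unit, fun i v => ?_⟩
  simp only [Formula.realize_iExs, hφ, Sum.elim_inl, Sum.elim_inr]
  exact ⟨fun ⟨x, h⟩ => ⟨x (), h⟩, fun ⟨x, h⟩ => ⟨fun _ => x, h⟩⟩

theorem Df.all {P : ∀ i, (α → M i) → M i → Prop}
    (hP : Df L M fun i (v : α ⊕ Unit → M i) => P i (fun a => v (.inl a)) (v (.inr ()))) :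
    Df L M fun i v => ∀ x, P i v x := by
  obtain ⟨φ, hφ⟩ := hP
  refine ⟨φ.iAlls Unit, fun i v => ?_⟩
  simp only [Formula.realize_iAlls, hφ, Sum.elim_inl, Sum.elim_inr]
  exact ⟨fun h x => h fun _ => x, fun h x => h (x ())⟩

/-- The relation symbol `R` denotes `mem i` in `M i`. -/
def Denotes (R : L.Relations 2) (mem : ∀ i, M i → M i → Prop) : Prop :=
  ∀ i (x : Fin 2 → M i), Structure.RelMap R x ↔ mem i (x 0) (x 1)

variable {R : L.Relations 2} {mem : ∀ i, M i → M i → Prop}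

theorem Df.rel (hR : Denotes R mem) (a b : α) : Df L M fun i v => mem i (v a) (v b) :=
  ⟨R.formula₂ (.var a) (.var b), fun i v => by rw [Formula.realize_rel₂, hR]; rfl⟩

theorem Df.sg (hR : Denotes R mem) (a b : α) : Df L M fun i v => Sg (mem i) (v a) (v b) :=
  .all (.iff (.rel hR _ _) (.eq _ _))

theorem Df.up (hR : Denotes R mem) (a b c : α) : Df L M fun i v => Up (mem i) (v a) (v b) (v c) :=
  .all (.iff (.rel hR _ _) (.or (.eq _ _) (.eq _ _)))

theorem Df.isSg (hR : Denotes R mem) (a : α) : Df L M fun i v => IsSg (mem i) (v a) :=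
  .ex (.sg hR _ _)

theorem Df.code (hR : Denotes R mem) (a b c d e : α) :
    Df L M fun i v => Code (mem i) (v a) (v b) (v c) (v d) (v e) :=
  .and (.all (.iff (.rel hR _ _) (.or (.eq _ _) (.or (.eq _ _) (.or (.eq _ _) (.eq _ _))))))
    (.and (.not (.isSg hR _)) (.and (.isSg hR _) (.and (.isSg hR _) (.isSg hR _))))

theorem Df.step (hR : Denotes R mem) (a b : α) : Df L M fun i v => Step (mem i) (v a) (v b) :=
  .ex <| .ex <| .ex <| .ex <| .ex <| .ex <| .ex <| .and (.code hR _ _ _ _ _) <|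
    .and (.code hR _ _ _ _ _) <| .and (.sg hR _ _) <| .and (.sg hR _ _) (.sg hR _ _)

theorem Df.valid (hR : Denotes R mem) (a : α) : Df L M fun i v => Valid (mem i) (v a) :=
  .all <| .imp (.rel hR _ _) <| .ex <| .ex <| .and (.rel hR _ _) <|
    .and (.not (.rel hR _ _)) (.step hR _ _)

theorem Df.linked (hR : Denotes R mem) (a b c : α) :
    Df L M fun i v => Rel (mem i) (v a) (v b) (v c) :=
  .ex <| .ex <| .and (.code hR _ _ _ _ _) (.valid hR _)

theorem Df.pr (hR : Denotes R mem) (a b c : α) : Df L M fun i v => Pr (mem i) (v a) (v b) (v c) :=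
  .all (.iff (.rel hR _ _) (.or (.sg hR _ _) (.up hR _ _ _)))

theorem Df.trip (hR : Denotes R mem) (a b c d : α) :
    Df L M fun i v => Trip (mem i) (v a) (v b) (v c) (v d) :=
  .ex (.and (.pr hR _ _ _) (.pr hR _ _ _))

theorem Df.free (hR : Denotes R mem) (a b c : α) :
    Df L M fun i v => Free (mem i) (v a) (v b) (v c) := by
  refine .and (.all <| .all <| .imp (.rel hR _ _) <| .imp (.rel hR _ _) <| .ex <|
    .and (.rel hR _ _) <| .all <| .all <| .imp (.rel hR _ _) <| .imp (.trip hR _ _ _ _) <|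
    .imp (.rel hR _ _) (.rel hR _ _)) ?_
  exact .all <| .all <| .all <| .imp (.rel hR _ _) <| .imp (.rel hR _ _) <|
    .imp (.rel hR _ _) <| .imp (.not (.eq _ _)) <| .imp (.not (.eq _ _)) <|
    .imp (.not (.eq _ _)) <| .ex <| .and (.rel hR _ _) <| .or (.trip hR _ _ _ _) <|
    .or (.trip hR _ _ _ _) (.trip hR _ _ _ _)

theorem Df.badAt (hR : Denotes R mem) (a b c d : α) :
    Df L M fun i v => BadAt (mem i) (v a) (v b) (v c) (v d) := by
  refine .and ?_ (.and ?_ (.and ?_ (.and ?_ ?_)))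
  · exact .all <| .all <| .all <| .imp (.rel hR _ _) <| .imp (.rel hR _ _) <|
      .imp (.rel hR _ _) <| .ex <| .and (.rel hR _ _) (.trip hR _ _ _ _)
  · exact .all <| .imp (.rel hR _ _) <| .ex <| .and (.ex (.rel hR _ _)) <| .all <|
      .iff (.rel hR _ _) (.linked hR _ _ _)
  · exact .all <| .all <| .all <| .all <| .imp (.rel hR _ _) <| .imp (.rel hR _ _) <|
      .imp (.linked hR _ _ _) <| .imp (.linked hR _ _ _) <| .ex <| .and (.rel hR _ _) <| .all <|
      .imp (.rel hR _ _) <| .imp (.linked hR _ _ _) (.rel hR _ _)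
  · exact .all <| .all <| .all <| .all <| .all <| .all <| .imp (.rel hR _ _) <|
      .imp (.rel hR _ _) <| .imp (.rel hR _ _) <| .imp (.not (.eq _ _)) <|
      .imp (.not (.eq _ _)) <| .imp (.not (.eq _ _)) <| .imp (.linked hR _ _ _) <|
      .imp (.linked hR _ _ _) <| .imp (.linked hR _ _ _) <| .or (.linked hR _ _ _) <|
      .or (.linked hR _ _ _) (.linked hR _ _ _)
  · exact .not (.ex (.free hR _ _ _))

theorem Df.bad (hR : Denotes R mem) : Df L M fun i (_ : α → M i) => Bad (mem i) :=
  .ex <| .ex <| .ex <| .ex <| .badAt hR _ _ _ _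

end Definability

open FirstOrder FirstOrder.Language

theorem exists_sentence : ∃ φ : Lmem.Sentence, ∀ (M : Type) (mem : M → M → Prop),
    (letI := memStructure mem; M ⊨ φ) ↔ ¬ Bad mem := by
  let _ (i : Σ M : Type, M → M → Prop) : Lmem.Structure i.1 := memStructure i.2
  obtain ⟨φ, hφ⟩ := Df.not (Df.bad (α := Empty) (L := Lmem)
    (M := fun i : Σ M : Type, M → M → Prop => i.1) (R := memRel.mem) (mem := fun i => i.2)
    fun _ _ => Iff.rfl)
  exact ⟨φ, fun M mem => hφ ⟨M, mem⟩ _⟩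

theorem exists_choice_triples {M : Type} {mem : M → M → Prop} {j : M → M} (h : AxCompJ M mem j)
    (I o T : M) : ∃ V, ∀ t, mem t V ↔ mem t T ∧ ∃ i i' k p p', mem i I ∧ mem i' I ∧ mem k I ∧
      Trip mem t i i' k ∧ (∀ x, mem x p ↔ Rel mem x o i) ∧ (∀ x, mem x p' ↔ Rel mem x o i') ∧
      Rel mem (j p) (j p') k := by
  let := memjStructure mem j
  have hR : Denotes (L := Lmemj) (M := fun _ : Unit => M) memRel.mem fun _ => mem :=
    fun _ _ => Iff.rfl
  have hF : ∀ (_ : Unit) (x : Fin 1 → M), Structure.funMap (L := Lmemj) jFun.j x = j (x 0) :=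
    fun _ _ => rfl
  have hD : Df Lmemj (fun _ : Unit => M) fun _ (v : Fin 3 → M) => ∃ i i' k p p' q q',
      mem i (v 1) ∧ mem i' (v 1) ∧ mem k (v 1) ∧ Trip mem (v 0) i i' k ∧
      (∀ x, mem x p ↔ Rel mem x (v 2) i) ∧ (∀ x, mem x p' ↔ Rel mem x (v 2) i') ∧
      q = j p ∧ q' = j p' ∧ Rel mem q q' k :=
    .ex <| .ex <| .ex <| .ex <| .ex <| .ex <| .ex <| .and (.rel hR _ _) <|
      .and (.rel hR _ _) <| .and (.rel hR _ _) <| .and (.trip hR _ _ _ _) <|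
      .and (.all (.iff (.rel hR _ _) (.linked hR _ _ _))) <|
      .and (.all (.iff (.rel hR _ _) (.linked hR _ _ _))) <| .and (.fn hF _ _) <|
      .and (.fn hF _ _) (.linked hR _ _ _)
  obtain ⟨φ, hφ⟩ := hD
  obtain ⟨V, hV⟩ := h 2 φ T ![I, o]
  refine ⟨V, fun t => (hV t).trans (and_congr_right fun _ => (hφ () _).trans ?_)⟩
  exact ⟨fun ⟨i, i', k, p, p', _, _, hi, hi', hk, ht, hp, hp', e, e', hR⟩ =>
      ⟨i, i', k, p, p', hi, hi', hk, ht, hp, hp', e ▸ e' ▸ hR⟩,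
    fun ⟨i, i', k, p, p', hi, hi', hk, ht, hp, hp', hR⟩ =>
      ⟨i, i', k, p, p', _, _, hi, hi', hk, ht, hp, hp', rfl, rfl, hR⟩⟩

theorem countable_reqs : (zcReqs ∪ codeReqs ∪ famReqs).Countable :=
  (countable_zcReqs.union ((Set.countable_range _).union (Set.toFinite _).countable)).union
    (by unfold famReqs; exact (Set.toFinite _).countable)

end ZCForcing

/-- **Global Choice is not conservative over ZC with Foundation.**  There is a
sentence `φ` of the language `{∈}` such that every model `(M, mem, j)` of
ZC_fnd + GC (ZC_fnd together with the Global Choice axiom and Comprehension for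
`{∈, j}`-formulas) satisfies `φ`, while `φ` is not a logical consequence of
ZC_fnd: some model of ZC_fnd fails to satisfy `φ`. -/
theorem globalChoice_not_conservative_over_ZCfnd :
    ∃ φ : Lmem.Sentence,
      (∀ (M : Type) (mem : M → M → Prop) (j : M → M),
          ZCfnd M mem → AxGC M mem j → AxCompJ M mem j →
          (letI := memStructure mem; M ⊨ φ)) ∧
      ¬ (∀ (M : Type) (mem : M → M → Prop),
          ZCfnd M mem → (letI := memStructure mem; M ⊨ φ)) := by
  obtain ⟨φ, hφ⟩ := ZCForcing.exists_sentence
  refine ⟨φ, fun M mem j hZ hj hC => (hφ M mem).2 ?_, fun h => ?_⟩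
  · rintro ⟨I, o, U, T, hB⟩
    exact ZCForcing.not_badAt hZ.1 hZ.2.1 hj (ZCForcing.exists_choice_triples hC I o T) hB
  · obtain ⟨𝔐⟩ := ZCForcing.exists_model _ ZCForcing.countable_reqs
    exact (hφ _ _).1 (h 𝔐.M 𝔐.mem (𝔐.zcfnd fun _ hx => .inl (.inl hx)))
      (𝔐.bad (fun _ hx => .inl (.inl hx)) (fun _ hx => .inr hx) fun _ hx => .inl (.inr hx))
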